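/- Every 3-connected planar graph has a unique embedding in the sphere up to homeomorphism. -/

import Mathlib

noncomputable section

/-- The unit sphere `Σ` in `ℝ³`. -/
abbrev Sphere2 : Type := Metric.sphere (0 : EuclideanSpace ℝ (Fin 3)) 1

/-- `A` is a simple arc on the sphere from `x` to `y`. -/
def IsArc (A : Set Sphere2) (x y : Sphere2) : Prop :=
  ∃ f : ℝ → Sphere2, ContinuousOn f (Set.Icc 0 1) ∧ Set.InjOn f (Set.Icc 0 1) ∧
    f 0 = x ∧ f 1 = y ∧ f '' Set.Icc 0 1 = A

/-- A plane drawing (planar embedding) of a graph `G` in the sphere `Σ`: vertices are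
mapped to distinct points, edges to simple arcs between their end vertices, and arcs
do not cross, except in common end vertices. -/
structure SphereEmbedding {V : Type*} (G : SimpleGraph V) where
  pos : V → Sphere2
  arc : Sym2 V → Set Sphere2
  pos_inj : Function.Injective pos
  arc_isArc : ∀ e ∈ G.edgeSet, ∀ v w : V, e = s(v, w) → IsArc (arc e) (pos v) (pos w)
  arc_vertex : ∀ e ∈ G.edgeSet, ∀ v : V, pos v ∈ arc e → v ∈ e
  arc_inter : ∀ e ∈ G.edgeSet, ∀ e' ∈ G.edgeSet, e ≠ e' →
    arc e ∩ arc e' ⊆ {x | ∃ v : V, v ∈ e ∧ v ∈ e' ∧ pos v = x}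

/-- The point set of the drawing. -/
def SphereEmbedding.image {V : Type*} {G : SimpleGraph V} (D : SphereEmbedding G) :
    Set Sphere2 :=
  Set.range D.pos ∪ ⋃ e ∈ G.edgeSet, D.arc e

/-- A planar graph is a graph that admits a plane drawing. -/
def SimpleGraph.IsPlanar {V : Type*} (G : SimpleGraph V) : Prop :=
  Nonempty (SphereEmbedding G)

/-- A face of a plane drawing: a connected region of `Σ` minus the drawing. -/
def SphereEmbedding.IsFace {V : Type*} {G : SimpleGraph V} (D : SphereEmbedding G)
    (U : Set Sphere2) : Prop :=
  ∃ x ∈ D.imageᶜ, U = connectedComponentIn D.imageᶜ x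

/-- Two plane drawings of the same graph are equivalent (homeomorphic) if some
homeomorphism of the sphere maps vertices, edges (and hence faces) of the first
drawing onto vertices and edges of the second. -/
def SphereEmbedding.EquivEmb {V : Type*} {G : SimpleGraph V}
    (D₁ D₂ : SphereEmbedding G) : Prop :=
  ∃ (φ : Sphere2 ≃ₜ Sphere2) (σ : G ≃g G),
    (∀ v, φ (D₁.pos v) = D₂.pos (σ v)) ∧
    ∀ e ∈ G.edgeSet, φ '' D₁.arc e = D₂.arc (e.map σ)

/-- `G` is 3-connected: it has at least 4 vertices and deleting any at most two
vertices leaves it connected. -/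
def ThreeConnected {V : Type*} [Fintype V] (G : SimpleGraph V) : Prop :=
  4 ≤ Fintype.card V ∧
    ∀ s : Set V, s.ncard ≤ 2 → (((⊤ : G.Subgraph).deleteVerts s).coe).Connected

/-- `G` is maximal planar: planar, and no edge can be added keeping planarity. -/
def IsMaximalPlanar {V : Type*} (G : SimpleGraph V) : Prop :=
  G.IsPlanar ∧ ∀ H : SimpleGraph V, G ≤ H → H.IsPlanar → H = G


namespace Whitney
open Set Filter Topology Metric

variable {X : Type*} [TopologicalSpace X]

/-- `f` has a continuous logarithm on `K`. -/
def HasLog (K : Set X) (f : X → ℂ) : Prop :=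
  ∃ g : X → ℂ, ContinuousOn g K ∧ ∀ z ∈ K, Complex.exp (g z) = f z

theorem HasLog.mono {K L : Set X} {f : X → ℂ} (h : HasLog K f) (hL : L ⊆ K) : HasLog L f := by
  obtain ⟨g, hg, hgf⟩ := h
  exact ⟨g, hg.mono hL, fun z hz => hgf z (hL hz)⟩

theorem HasLog.congr {K : Set X} {f f' : X → ℂ} (h : HasLog K f) (hf : ∀ z ∈ K, f z = f' z) :
    HasLog K f' := by
  obtain ⟨g, hg, hgf⟩ := h
  exact ⟨g, hg, fun z hz => (hgf z hz).trans (hf z hz)⟩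

theorem HasLog.zpow {K : Set X} {f : X → ℂ} (h : HasLog K f) (n : ℤ) :
    HasLog K (fun z => f z ^ n) := by
  obtain ⟨g, hg, hgf⟩ := h
  exact ⟨fun z => n * g z, continuousOn_const.mul hg, fun z hz => by
    rw [Complex.exp_int_mul, hgf z hz]⟩

theorem HasLog.inv {K : Set X} {f : X → ℂ} (h : HasLog K f) : HasLog K (fun z => (f z)⁻¹) := by
  simpa using h.zpow (-1)

theorem HasLog.const {K : Set X} {c : ℂ} (hc : c ≠ 0) : HasLog K (fun _ => c) :=
  ⟨fun _ => Complex.log c, continuousOn_const, fun _ _ => Complex.exp_log hc⟩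

/-- Logarithms can be transported along homotopies of nonvanishing functions. -/
theorem HasLog.of_homotopy {K : Set X} {H : ℝ → X → ℂ}
    (hH : ContinuousOn (Function.uncurry H) (Icc 0 1 ×ˢ K))
    (h0 : ∀ t ∈ Icc (0 : ℝ) 1, ∀ z ∈ K, H t z ≠ 0) (hlog : HasLog K (H 0)) :
    HasLog K (H 1) := by
  classical
  obtain ⟨g, hg, hgf⟩ := hlog
  let H' : C(unitInterval × K, {z : ℂ // z ≠ 0}) :=
    ⟨fun p => ⟨H p.1 p.2, h0 _ p.1.2 _ p.2.2⟩, by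
      refine Continuous.subtype_mk ?_ _
      have : Continuous fun p : unitInterval × K => ((p.1 : ℝ), (p.2 : X)) := by fun_prop
      exact hH.comp_continuous this fun p => ⟨p.1.2, p.2.2⟩⟩
  let f' : C(K, ℂ) := ⟨fun a => g a, continuousOn_iff_continuous_domRestrict.1 hg⟩
  have hH0 : ∀ a, H' (0, a) = (fun z : ℂ ↦ (⟨_, z.exp_ne_zero⟩ : {z : ℂ // z ≠ 0})) (f' a) := by
    intro a
    apply Subtype.ext
    exact (hgf a a.2).symm
  let G := Complex.isCoveringMap_exp.liftHomotopy H' f' hH0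
  have hG := Complex.isCoveringMap_exp.liftHomotopy_lifts H' f' hH0
  refine ⟨fun z => if hz : z ∈ K then G (1, ⟨z, hz⟩) else 0, ?_, fun z hz => ?_⟩
  · rw [continuousOn_iff_continuous_domRestrict]
    have : Continuous fun a : K => G (1, a) := by fun_prop
    convert this using 1
    ext a
    simp
  · have := congrArg Subtype.val (congrFun hG (1, ⟨z, hz⟩))
    simp only [Function.comp_apply] at this
    simp only [hz, dif_pos]
    exact this

theorem hasLog_of_convex {E : Type*} [NormedAddCommGroup E] [NormedSpace ℝ E] {K : Set E}
    (hK : Convex ℝ K) {f : E → ℂ} (hf : ContinuousOn f K) (h0 : ∀ z ∈ K, f z ≠ 0) :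
    HasLog K f := by
  rcases K.eq_empty_or_nonempty with rfl | ⟨a, ha⟩
  · exact ⟨0, by simp, by simp⟩
  have hm : ∀ p ∈ Icc (0 : ℝ) 1 ×ˢ K, a + p.1 • (p.2 - a) ∈ K := by
    rintro ⟨t, z⟩ ⟨ht, hz⟩
    have := hK ha hz (sub_nonneg.2 ht.2) ht.1 (by ring)
    convert this using 1
    module
  have := HasLog.of_homotopy (K := K) (H := fun t z => f (a + t • (z - a))) ?_ ?_ ?_
  · exact this.congr fun z _ => by simp
  · refine hf.comp (f := fun p : ℝ × E => a + p.1 • (p.2 - a)) ?_ hm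
    fun_prop
  · exact fun t ht z hz => h0 _ (hm (t, z) ⟨ht, hz⟩)
  · exact (HasLog.const (h0 a ha)).congr fun z _ => by simp

/-- Maps on a compact set factor continuously through its continuous images. -/
theorem continuousOn_image_of_comp {Y Z : Type*} [TopologicalSpace Y] [TopologicalSpace Z]
    [T2Space Y] {S : Set X} (hS : IsCompact S) {φ : X → Y} (hφ : ContinuousOn φ S) {g : Y → Z}
    (hg : ContinuousOn (fun s => g (φ s)) S) : ContinuousOn g (φ '' S) := by
  rw [continuousOn_iff_isClosed]
  intro t ht
  obtain ⟨u, hu, hu'⟩ := continuousOn_iff_isClosed.1 hg t ht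
  refine ⟨φ '' (S ∩ u), ((hS.inter_right hu).image_of_continuousOn
    (hφ.mono inter_subset_left)).isClosed, ?_⟩
  ext y
  constructor
  · rintro ⟨h1, s, hs, rfl⟩
    have : s ∈ u ∩ S := hu' ▸ ⟨h1, hs⟩
    exact ⟨⟨s, ⟨hs, this.1⟩, rfl⟩, s, hs, rfl⟩
  · rintro ⟨⟨s, ⟨hs, hsu⟩, rfl⟩, _⟩
    have : s ∈ (fun s => g (φ s)) ⁻¹' t ∩ S := hu' ▸ ⟨hsu, hs⟩
    exact ⟨this.1, s, hs, rfl⟩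

theorem hasLog_image {Y : Type*} [TopologicalSpace Y] [T2Space Y] {S : Set X} (hS : IsCompact S)
    {φ : X → Y} (hφ : ContinuousOn φ S) {f : Y → ℂ} {g : X → ℂ} (hg : ContinuousOn g S)
    (hgf : ∀ s ∈ S, Complex.exp (g s) = f (φ s))
    (hfib : ∀ s ∈ S, ∀ t ∈ S, φ s = φ t → g s = g t) : HasLog (φ '' S) f := by
  classical
  let g' : Y → ℂ := fun y => if h : ∃ s ∈ S, φ s = y then g h.choose else 0
  have hg' : ∀ s ∈ S, g' (φ s) = g s := by
    intro s hs
    have h : ∃ s' ∈ S, φ s' = φ s := ⟨s, hs, rfl⟩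
    simp only [g', dif_pos h]
    exact hfib _ h.choose_spec.1 _ hs h.choose_spec.2
  refine ⟨g', continuousOn_image_of_comp hS hφ (hg.congr hg'), ?_⟩
  rintro _ ⟨s, hs, rfl⟩
  rw [hg' s hs, hgf s hs]

/-- Two logarithms of the same function on a preconnected set differ by a constant. -/
theorem log_sub_const {K : Set X} (hK : IsPreconnected K) {g g' : X → ℂ}
    (hg : ContinuousOn g K) (hg' : ContinuousOn g' K)
    (h : ∀ z ∈ K, Complex.exp (g z) = Complex.exp (g' z)) {a b : X} (ha : a ∈ K) (hb : b ∈ K) :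
    g a - g' a = g b - g' b := by
  have hpi : (2 * Real.pi : ℝ) ≠ 0 := by positivity
  have hcont : ContinuousOn (fun z => ((g z - g' z) / (2 * Real.pi * Complex.I)).re) K := by
    refine Complex.continuous_re.comp_continuousOn ?_
    exact (hg.sub hg').div_const _
  have hval : ∀ z ∈ K, ∃ n : ℤ, g z - g' z = n * (2 * Real.pi * Complex.I) := by
    intro z hz
    obtain ⟨n, hn⟩ := Complex.exp_eq_exp_iff_exists_int.1 (h z hz)
    exact ⟨n, by rw [hn]; ring⟩
  have hne : (2 * Real.pi * Complex.I : ℂ) ≠ 0 := Complex.two_pi_I_ne_zero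
  have hmaps : MapsTo (fun z => ((g z - g' z) / (2 * Real.pi * Complex.I)).re) K
      (range ((↑) : ℤ → ℝ)) := by
    intro z hz
    obtain ⟨n, hn⟩ := hval z hz
    refine ⟨n, ?_⟩
    simp only [hn]
    rw [mul_div_cancel_right₀ _ hne]
    simp
  have hd : IsDiscrete (range ((↑) : ℤ → ℝ)) :=
    Int.isClosedEmbedding_coe_real.isEmbedding.isDiscrete_range
  have := hK.constant_of_mapsTo hd hcont hmaps ha hb
  obtain ⟨n, hn⟩ := hval a ha
  obtain ⟨k, hk⟩ := hval b hb
  simp only [hn, hk] at this ⊢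
  rw [mul_div_cancel_right₀ _ hne, mul_div_cancel_right₀ _ hne] at this
  simp only [Complex.intCast_re] at this
  rw [Int.cast_injective this]

theorem exists_continuous_extension {K : Set ℂ} (hK : IsClosed K) {g : ℂ → ℂ}
    (hg : ContinuousOn g K) : ∃ G : ℂ → ℂ, Continuous G ∧ EqOn G g K := by
  obtain ⟨G, hG⟩ := ContinuousMap.exists_restrict_eq hK
    (⟨K.domRestrict g, continuousOn_iff_continuous_domRestrict.1 hg⟩ : C(K, ℂ))
  exact ⟨G, G.continuous, fun z hz => congrArg (fun f : C(K, ℂ) => f ⟨z, hz⟩) hG⟩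

theorem not_hasLog_sphere {x : ℂ} {R : ℝ} (hR : 0 < R) {m : ℤ}
    (h : HasLog (sphere x R) (fun z => (z - x) ^ m)) : m = 0 := by
  let c : ℝ → ℂ := fun θ => x + R * Complex.exp (θ * Complex.I)
  have hc : Continuous c := by fun_prop
  have hcm : ∀ θ, c θ ∈ sphere x R := by
    intro θ
    simp [c, Complex.norm_exp_ofReal_mul_I, abs_of_pos hR]
  obtain ⟨g, hg, hgf⟩ := h
  have hRc : (R : ℂ) ≠ 0 := by exact_mod_cast hR.ne'
  have h1 := log_sub_const (K := (univ : Set ℝ)) isPreconnected_univ (g := g ∘ c)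
    (g' := fun θ : ℝ => m * (Complex.log R + θ * Complex.I))
    ((hg.comp_continuous hc hcm).continuousOn) (by fun_prop) (fun θ _ => by
      simp only [Function.comp_apply]
      rw [hgf _ (hcm θ), Complex.exp_int_mul, Complex.exp_add, Complex.exp_log hRc]
      simp [c]) (mem_univ 0) (mem_univ (2 * Real.pi))
  have h2 : c (2 * Real.pi) = c 0 := by
    simp [c, Complex.exp_two_pi_mul_I]
  simp only [Function.comp_apply, h2] at h1
  have h3 : (m : ℂ) * (2 * Real.pi * Complex.I) = 0 := by
    push_cast at h1
    linear_combination h1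
  simpa [Complex.two_pi_I_ne_zero, Real.pi_ne_zero] using h3

theorem zpow_eq_zero_of_hasLog {K U : Set ℂ} (hK : IsClosed K) (hUb : Bornology.IsBounded U)
    (hU : IsOpen U) (hfr : frontier U ⊆ K) {x y : ℂ} (hx : x ∈ U) (hy : y ∉ closure U) {m k : ℤ}
    (h : HasLog K (fun z => (z - x) ^ m * (z - y) ^ k)) : m = 0 := by
  classical
  obtain ⟨g, hg, hgf⟩ := h
  obtain ⟨G, hG, hGg⟩ := exists_continuous_extension hK hg
  let F : ℂ → ℂ := fun z => if z ∈ closure U then (z - y) ^ (-k) * Complex.exp (G z)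
    else (z - x) ^ m
  have hney : ∀ z ∈ closure U, z - y ≠ 0 := fun z hz h0 => hy (sub_eq_zero.1 h0 ▸ hz)
  have hnex : ∀ z ∉ U, z - x ≠ 0 := fun z hz h0 => hz ((sub_eq_zero.1 h0).symm ▸ hx)
  have hF : Continuous F := by
    refine continuous_if ?_ ?_ ?_
    · intro a ha
      have ha' : a ∈ frontier U := frontier_closure_subset ha
      have haK := hfr ha'
      rw [hGg haK, hgf a haK]
      have h1 := hney a ha'.1
      rw [zpow_neg]
      field_simp
    · change ContinuousOn _ (closure (closure U))
      rw [closure_closure]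
      refine ContinuousOn.mul ?_ (by fun_prop)
      exact ContinuousOn.zpow₀ (by fun_prop) _ fun z hz => Or.inl (hney z hz)
    · have : closure {a | a ∉ closure U} ⊆ Uᶜ :=
        closure_minimal (fun a ha ha' => ha (subset_closure ha')) hU.isClosed_compl
      exact ContinuousOn.zpow₀ (by fun_prop) _ fun z hz => Or.inl (hnex z (this hz))
  have hF0 : ∀ z, F z ≠ 0 := by
    intro z
    simp only [F]
    split_ifs with hz
    · exact mul_ne_zero (zpow_ne_zero _ (hney z hz)) (Complex.exp_ne_zero _)
    · exact zpow_ne_zero _ (hnex z fun h => hz (subset_closure h))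
  have hlog : HasLog univ F := hasLog_of_convex convex_univ hF.continuousOn fun z _ => hF0 z
  obtain ⟨R, hR, hUR⟩ := hUb.closure.subset_ball_lt 0 x
  refine not_hasLog_sphere hR ((hlog.mono (subset_univ (sphere x R))).congr fun z hz => ?_)
  have : z ∉ closure U := fun hz' => by
    have := hUR hz'
    rw [mem_ball] at this
    rw [mem_sphere] at hz
    linarith
  simp [F, this]

/-- Easy direction of Eilenberg's criterion. -/
theorem hasLog_of_joinedIn {K : Set ℂ} {x y : ℂ} (h : JoinedIn Kᶜ x y) :
    HasLog K (fun z => (z - x) / (z - y)) := by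
  obtain ⟨γ, hγ⟩ := h.symm
  have hy : y ∉ K := by simpa using hγ 0
  have h2 : ∀ t, ∀ z ∈ K, z - γ.extend t ≠ 0 := by
    intro t z hz h0
    have h3 : γ.extend t ∈ Kᶜ := by
      have : γ.extend t ∈ range γ := by rw [← γ.extend_range]; exact mem_range_self t
      obtain ⟨s, hs⟩ := this
      exact hs ▸ hγ s
    exact h3 (sub_eq_zero.1 h0 ▸ hz)
  have h3 : ∀ z ∈ K, z - y ≠ 0 := fun z hz h0 => hy (sub_eq_zero.1 h0 ▸ hz)
  have := HasLog.of_homotopy (K := K) (H := fun t z => (z - γ.extend t) / (z - y)) ?_ ?_ ?_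
  · simpa using this
  · refine ContinuousOn.div ?_ (by fun_prop) fun p hp => h3 _ hp.2
    have := γ.continuous_extend
    fun_prop
  · exact fun t _ z hz => div_ne_zero (h2 t z hz) (h3 z hz)
  · refine (HasLog.const one_ne_zero).congr fun z hz => ?_
    simp [h3 z hz]

end Whitney

namespace Whitney
open Set Filter Topology Metric

theorem HasLog.union_aux {X : Type*} [TopologicalSpace X] {K L : Set X}
    (hKL : IsPreconnected (K ∩ L)) {f : X → ℂ} (hK : HasLog K f) (hL : HasLog L f)
    (hglue : ∀ g : X → ℂ, ContinuousOn g K → ContinuousOn g L → ContinuousOn g (K ∪ L)) :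
    HasLog (K ∪ L) f := by
  classical
  obtain ⟨g, hg, hgf⟩ := hK
  obtain ⟨g', hg', hgf'⟩ := hL
  obtain ⟨c, hc, hgc⟩ : ∃ c : ℂ, Complex.exp c = 1 ∧ ∀ z ∈ K ∩ L, g z = g' z + c := by
    rcases (K ∩ L).eq_empty_or_nonempty with h | ⟨a, ha⟩
    · exact ⟨0, by simp, by simp [h]⟩
    · refine ⟨g a - g' a, ?_, fun z hz => ?_⟩
      · rw [Complex.exp_sub, hgf a ha.1, hgf' a ha.2, div_self]
        rw [← hgf a ha.1]
        exact Complex.exp_ne_zero _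
      · have := log_sub_const hKL (hg.mono inter_subset_left) (hg'.mono inter_subset_right)
          (fun z hz => (hgf z hz.1).trans (hgf' z hz.2).symm) ha hz
        rw [this]
        ring
  let G : X → ℂ := fun z => if z ∈ K then g z else g' z + c
  have hGK : EqOn G g K := fun z hz => by simp [G, hz]
  have hGL : EqOn G (fun z => g' z + c) L := fun z hz => by
    by_cases hzK : z ∈ K
    · simp [G, hzK, hgc z ⟨hzK, hz⟩]
    · simp [G, hzK]
  refine ⟨G, hglue G (hg.congr hGK) ((hg'.add continuousOn_const).congr hGL), ?_⟩
  rintro z (hz | hz)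
  · rw [hGK hz, hgf z hz]
  · rw [hGL hz, Complex.exp_add, hgf' z hz, hc, mul_one]

theorem isPreconnected_compl_closedBall (c : ℂ) {R : ℝ} :
    IsPreconnected (closedBall c R)ᶜ := by
  have h : (closedBall c R)ᶜ =
      (fun p : ℝ × ℝ => c + (p.1 : ℂ) * Complex.exp (p.2 * Complex.I)) '' (Ioi R ×ˢ univ) := by
    ext z
    simp only [mem_compl_iff, mem_closedBall, not_le, mem_image, mem_prod, mem_Ioi,
      mem_univ, and_true, Prod.exists, dist_eq_norm]
    constructor
    · intro hz
      exact ⟨‖z - c‖, (z - c).arg, hz, by rw [Complex.norm_mul_exp_arg_mul_I]; ring⟩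
    · rintro ⟨r, θ, hr, rfl⟩
      rw [add_sub_cancel_left, norm_mul, Complex.norm_exp_ofReal_mul_I, mul_one, Complex.norm_real]
      exact hr.trans_le (le_abs_self r)
  rw [h]
  exact (isPreconnected_Ioi.prod isPreconnected_univ).image _ (by fun_prop)

section LocallyConnected
variable {X : Type*} [TopologicalSpace X] [LocallyConnectedSpace X]

theorem frontier_connectedComponentIn_subset {U : Set X} (hU : IsOpen U) (x : X) :
    frontier (connectedComponentIn U x) ⊆ Uᶜ := by
  intro z hz hzU
  have ho : IsOpen (connectedComponentIn U z) := hU.connectedComponentIn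
  have hzm : z ∈ connectedComponentIn U z := mem_connectedComponentIn hzU
  obtain ⟨w, hw1, hw2⟩ := mem_closure_iff.1 hz.1 _ ho hzm
  have h1 := connectedComponentIn_eq hw1
  have h2 := connectedComponentIn_eq hw2
  rw [hU.connectedComponentIn.frontier_eq] at hz
  exact hz.2 (by rw [h2, ← h1]; exact hzm)

end LocallyConnected

theorem joinedIn_of_isPreconnected {K S : Set ℂ} (hK : IsClosed K) (hS : IsPreconnected S)
    (hSK : S ⊆ Kᶜ) {x y : ℂ} (hx : x ∈ S) (hy : y ∈ S) : JoinedIn Kᶜ x y := by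
  have hx' := hSK hx
  have h1 : IsOpen (connectedComponentIn Kᶜ x) := hK.isOpen_compl.connectedComponentIn
  have h2 : IsConnected (connectedComponentIn Kᶜ x) :=
    isConnected_connectedComponentIn_iff.2 hx'
  exact ((h1.isConnected_iff_isPathConnected.1 h2).joinedIn x (mem_connectedComponentIn hx') y
    (hS.subset_connectedComponentIn hx hSK hy)).mono (connectedComponentIn_subset _ _)

theorem joinedIn_iff_mem_connectedComponentIn {K : Set ℂ} (hK : IsClosed K) {x y : ℂ}
    (hx : x ∉ K) : JoinedIn Kᶜ x y ↔ y ∈ connectedComponentIn Kᶜ x := by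
  constructor
  · intro h
    obtain ⟨γ, hγ⟩ := h
    have h1 : IsPreconnected (range γ) := isPreconnected_range γ.continuous
    exact h1.subset_connectedComponentIn ⟨0, γ.source⟩ (range_subset_iff.2 hγ) ⟨1, γ.target⟩
  · intro h
    exact joinedIn_of_isPreconnected hK isPreconnected_connectedComponentIn
      (connectedComponentIn_subset _ _) (mem_connectedComponentIn hx) h

theorem joinedIn_of_not_isBounded {K : Set ℂ} (hK : IsCompact K) {x y : ℂ}
    (hx : ¬ Bornology.IsBounded (connectedComponentIn Kᶜ x))
    (hy : ¬ Bornology.IsBounded (connectedComponentIn Kᶜ y)) : JoinedIn Kᶜ x y := by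
  obtain ⟨R, hR, hKR⟩ := hK.isBounded.subset_closedBall_lt 0 (0 : ℂ)
  have key : ∀ x : ℂ, ¬ Bornology.IsBounded (connectedComponentIn Kᶜ x) →
      ∃ x' ∈ (closedBall (0 : ℂ) R)ᶜ, JoinedIn Kᶜ x x' := by
    intro x hx
    have : ¬ connectedComponentIn Kᶜ x ⊆ closedBall 0 R := fun h =>
      hx (isBounded_closedBall.subset h)
    obtain ⟨x', hx', hxR⟩ := not_subset.1 this
    have hxK : x ∈ Kᶜ := connectedComponentIn_nonempty_iff.1 ⟨x', hx'⟩
    exact ⟨x', hxR, (joinedIn_iff_mem_connectedComponentIn hK.isClosed hxK).2 hx'⟩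
  obtain ⟨x', hx', hxx'⟩ := key x hx
  obtain ⟨y', hy', hyy'⟩ := key y hy
  exact (hxx'.trans (joinedIn_of_isPreconnected hK.isClosed (isPreconnected_compl_closedBall 0)
    (compl_subset_compl.2 hKR) hx' hy')).trans hyy'.symm

theorem notMem_closure_of_not_joinedIn {K : Set ℂ} (hK : IsClosed K) {x y : ℂ} (hx : x ∉ K)
    (hy : y ∉ K) (h : ¬ JoinedIn Kᶜ x y) : y ∉ closure (connectedComponentIn Kᶜ x) := by
  intro hyc
  refine h ((joinedIn_iff_mem_connectedComponentIn hK hx).2 ?_)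
  by_contra hyn
  have ho : IsOpen (connectedComponentIn Kᶜ x) := hK.isOpen_compl.connectedComponentIn
  exact frontier_connectedComponentIn_subset hK.isOpen_compl x
    (show y ∈ frontier _ from ⟨hyc, by rwa [ho.interior_eq]⟩) hy

theorem zpow_eq_zero_of_isBounded {K : Set ℂ} (hK : IsClosed K) {x y : ℂ} (hx : x ∉ K)
    (hy : y ∉ K) (hb : Bornology.IsBounded (connectedComponentIn Kᶜ x)) (h : ¬ JoinedIn Kᶜ x y)
    {m k : ℤ} (hlog : HasLog K (fun z => (z - x) ^ m * (z - y) ^ k)) : m = 0 := by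
  have := frontier_connectedComponentIn_subset hK.isOpen_compl x
  rw [compl_compl] at this
  exact zpow_eq_zero_of_hasLog hK hb hK.isOpen_compl.connectedComponentIn this
    (mem_connectedComponentIn hx) (notMem_closure_of_not_joinedIn hK hx hy h) hlog

/-- Eilenberg's criterion. -/
theorem joinedIn_of_hasLog {K : Set ℂ} (hK : IsCompact K) {x y : ℂ} (hx : x ∉ K) (hy : y ∉ K)
    (h : HasLog K (fun z => (z - x) / (z - y))) : JoinedIn Kᶜ x y := by
  by_contra hn
  by_cases hbx : Bornology.IsBounded (connectedComponentIn Kᶜ x)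
  · have := zpow_eq_zero_of_isBounded hK.isClosed hx hy hbx hn (m := 1) (k := -1)
      (h.congr fun z _ => by simp [div_eq_mul_inv])
    simp at this
  · by_cases hby : Bornology.IsBounded (connectedComponentIn Kᶜ y)
    · have := zpow_eq_zero_of_isBounded hK.isClosed hy hx hby (fun h => hn h.symm) (m := 1)
        (k := -1) (h.inv.congr fun z _ => by simp [div_eq_mul_inv])
      simp at this
    · exact hn (joinedIn_of_not_isBounded hK hbx hby)

/-- Janiszewski's theorem. -/
theorem janiszewski {K L : Set ℂ} (hK : IsCompact K) (hL : IsCompact L)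
    (hKL : IsPreconnected (K ∩ L)) {x y : ℂ} (h1 : JoinedIn Kᶜ x y) (h2 : JoinedIn Lᶜ x y) :
    JoinedIn (K ∪ L)ᶜ x y := by
  refine joinedIn_of_hasLog (hK.union hL) ?_ ?_ ?_
  · exact fun h => h.elim h1.source_mem h2.source_mem
  · exact fun h => h.elim h1.target_mem h2.target_mem
  · exact HasLog.union_aux hKL (hasLog_of_joinedIn h1) (hasLog_of_joinedIn h2)
      fun g hg hg' => hg.union_of_isClosed hg' hK.isClosed hL.isClosed

end Whitney

namespace Whitney
open Set Filter Topology Metric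

variable {X Y : Type*} [TopologicalSpace X] [TopologicalSpace Y]

/-- `A` is a simple arc from `x` to `y`. -/
def Arc (A : Set X) (x y : X) : Prop :=
  ∃ f : ℝ → X, ContinuousOn f (Icc 0 1) ∧ InjOn f (Icc 0 1) ∧ f 0 = x ∧ f 1 = y ∧ f '' Icc 0 1 = A

theorem arc_of_Icc {f : ℝ → X} {a b : ℝ} (hab : a < b) (hf : ContinuousOn f (Icc a b))
    (hi : InjOn f (Icc a b)) : Arc (f '' Icc a b) (f a) (f b) := by
  have hba : 0 < b - a := sub_pos.2 hab
  have him : (fun t : ℝ => (b - a) * t + a) '' Icc 0 1 = Icc a b := by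
    rw [image_affine_Icc' hba]
    simp
  have hm : MapsTo (fun t : ℝ => (b - a) * t + a) (Icc 0 1) (Icc a b) := him ▸ mapsTo_image _ _
  refine ⟨fun t => f ((b - a) * t + a), hf.comp (by fun_prop) hm, ?_, by simp, by simp, ?_⟩
  · intro s hs t ht hst
    have := hi (hm hs) (hm ht) hst
    simp only at this
    have : (b - a) * s = (b - a) * t := by linarith
    exact mul_left_cancel₀ hba.ne' this
  · rw [← him, image_image]

theorem Arc.symm {A : Set X} {x y : X} (h : Arc A x y) : Arc A y x := by
  obtain ⟨f, hf, hi, h0, h1, hA⟩ := h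
  have him : (fun t : ℝ => 1 - t) '' Icc 0 1 = Icc 0 1 := by
    rw [image_const_sub_Icc]
    simp
  have hm : MapsTo (fun t : ℝ => 1 - t) (Icc 0 1) (Icc 0 1) := by
    nth_rw 2 [← him]
    exact mapsTo_image _ _
  refine ⟨fun t => f (1 - t), hf.comp (by fun_prop) hm, ?_, by simp [h1], by simp [h0], ?_⟩
  · intro s hs t ht hst
    have := hi (hm hs) (hm ht) hst
    simp only at this
    linarith
  · rw [← hA]
    nth_rw 2 [← him]
    rw [image_image]

theorem Arc.left_mem {A : Set X} {x y : X} (h : Arc A x y) : x ∈ A := by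
  obtain ⟨f, hf, hi, h0, h1, hA⟩ := h
  exact hA ▸ ⟨0, by simp, h0⟩

theorem Arc.right_mem {A : Set X} {x y : X} (h : Arc A x y) : y ∈ A := h.symm.left_mem

theorem Arc.ne {A : Set X} {x y : X} (h : Arc A x y) : x ≠ y := by
  obtain ⟨f, hf, hi, rfl, rfl, hA⟩ := h
  intro h
  exact zero_ne_one (hi (by simp) (by simp) h)

theorem Arc.isCompact {A : Set X} {x y : X} (h : Arc A x y) : IsCompact A := by
  obtain ⟨f, hf, hi, h0, h1, hA⟩ := h
  exact hA ▸ isCompact_Icc.image_of_continuousOn hf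

theorem Arc.isPreconnected {A : Set X} {x y : X} (h : Arc A x y) : IsPreconnected A := by
  obtain ⟨f, hf, hi, h0, h1, hA⟩ := h
  exact hA ▸ isPreconnected_Icc.image _ hf

theorem Arc.image {A : Set X} {x y : X} (h : Arc A x y) {φ : X → Y} (hφ : ContinuousOn φ A)
    (hi : InjOn φ A) : Arc (φ '' A) (φ x) (φ y) := by
  obtain ⟨f, hf, hfi, rfl, rfl, rfl⟩ := h
  exact ⟨φ ∘ f, hφ.comp hf (mapsTo_image _ _), hi.comp hfi (mapsTo_image _ _), rfl, rfl,
    image_comp _ _ _⟩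

theorem Arc.diff_eq {X : Type*} {f : ℝ → X} (hi : InjOn f (Icc 0 1)) :
    f '' Icc 0 1 \ {f 0, f 1} = f '' Ioo 0 1 := by
  ext z
  constructor
  · rintro ⟨⟨t, ht, rfl⟩, h⟩
    simp only [mem_insert_iff, mem_singleton_iff, not_or] at h
    refine ⟨t, ⟨lt_of_le_of_ne ht.1 ?_, lt_of_le_of_ne ht.2 ?_⟩, rfl⟩
    · rintro rfl; exact h.1 rfl
    · rintro rfl; exact h.2 rfl
  · rintro ⟨t, ht, rfl⟩
    refine ⟨⟨t, Ioo_subset_Icc_self ht, rfl⟩, ?_⟩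
    rintro (h | h)
    · exact ht.1.ne' (hi (Ioo_subset_Icc_self ht) (by simp) h)
    · exact ht.2.ne (hi (Ioo_subset_Icc_self ht) (by simp) h)

theorem Arc.isPreconnected_diff {A : Set X} {x y : X} (h : Arc A x y) :
    IsPreconnected (A \ {x, y}) := by
  obtain ⟨f, hf, hi, rfl, rfl, rfl⟩ := h
  rw [Arc.diff_eq hi]
  exact isPreconnected_Ioo.image _ (hf.mono Ioo_subset_Icc_self)

theorem Arc.diff_nonempty {A : Set X} {x y : X} (h : Arc A x y) : (A \ {x, y}).Nonempty := by
  obtain ⟨f, hf, hi, rfl, rfl, rfl⟩ := h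
  rw [Arc.diff_eq hi]
  exact ⟨f (1 / 2), 1 / 2, by norm_num, rfl⟩

theorem Arc.subset_closure_diff {A : Set X} {x y : X} (h : Arc A x y) :
    A ⊆ closure (A \ {x, y}) := by
  obtain ⟨f, hf, hi, rfl, rfl, rfl⟩ := h
  rw [Arc.diff_eq hi]
  rintro _ ⟨t, ht, rfl⟩
  have : ContinuousWithinAt f (Ioo 0 1) t := (hf t ht).mono Ioo_subset_Icc_self
  refine this.mem_closure_image ?_
  rwa [closure_Ioo zero_ne_one]

/-- Cutting an arc at an interior point. -/
theorem Arc.split {A : Set X} {x y w : X} (h : Arc A x y) (hw : w ∈ A) (hx : w ≠ x) (hy : w ≠ y) :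
    ∃ A₁ A₂, Arc A₁ x w ∧ Arc A₂ w y ∧ A₁ ∪ A₂ = A ∧ A₁ ∩ A₂ = {w} := by
  obtain ⟨f, hf, hi, rfl, rfl, rfl⟩ := h
  obtain ⟨t, ht, rfl⟩ := hw
  have h0 : 0 < t := lt_of_le_of_ne ht.1 fun h => hx (by rw [h])
  have h1 : t < 1 := lt_of_le_of_ne ht.2 fun h => hy (by rw [h])
  have hs0 : Icc 0 t ⊆ Icc (0 : ℝ) 1 := Icc_subset_Icc_right h1.le
  have hs1 : Icc t 1 ⊆ Icc (0 : ℝ) 1 := Icc_subset_Icc_left h0.le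
  refine ⟨f '' Icc 0 t, f '' Icc t 1, arc_of_Icc h0 (hf.mono hs0) (hi.mono hs0),
    arc_of_Icc h1 (hf.mono hs1) (hi.mono hs1), ?_, ?_⟩
  · rw [← image_union, Icc_union_Icc_eq_Icc h0.le h1.le]
  · rw [← hi.image_inter hs0 hs1, Icc_inter_Icc_eq_singleton h0.le h1.le, image_singleton]

/-- The part of an arc close to its end. -/
theorem Arc.split_near {A : Set X} {x y : X} (h : Arc A x y) {N : Set X} (hN : N ∈ 𝓝 y) :
    ∃ w A₁ A₂, Arc A₁ x w ∧ Arc A₂ w y ∧ A₁ ∪ A₂ = A ∧ A₁ ∩ A₂ = {w} ∧ A₂ ⊆ N := by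
  obtain ⟨f, hf, hi, rfl, rfl, rfl⟩ := h
  have h1 : f ⁻¹' N ∈ 𝓝[Icc 0 1] (1 : ℝ) := hf 1 (by simp) hN
  rw [nhdsWithin_Icc_eq_nhdsLE zero_lt_one] at h1
  obtain ⟨t, ht, htN⟩ := mem_nhdsLE_iff_exists_Icc_subset.1 h1
  let s := max t (1 / 2)
  have h0 : 0 < s := lt_max_of_lt_right (by norm_num)
  have h1 : s < 1 := max_lt ht (by norm_num)
  have hs0 : Icc 0 s ⊆ Icc (0 : ℝ) 1 := Icc_subset_Icc_right h1.le
  have hs1 : Icc s 1 ⊆ Icc (0 : ℝ) 1 := Icc_subset_Icc_left h0.le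
  refine ⟨f s, f '' Icc 0 s, f '' Icc s 1, arc_of_Icc h0 (hf.mono hs0) (hi.mono hs0),
    arc_of_Icc h1 (hf.mono hs1) (hi.mono hs1), ?_, ?_, ?_⟩
  · rw [← image_union, Icc_union_Icc_eq_Icc h0.le h1.le]
  · rw [← hi.image_inter hs0 hs1, Icc_inter_Icc_eq_singleton h0.le h1.le, image_singleton]
  · rintro _ ⟨r, hr, rfl⟩
    exact htN ⟨(le_max_left _ _).trans hr.1, hr.2⟩

/-- Concatenation of arcs. -/
theorem Arc.trans {A B : Set X} {x y z : X} (hA : Arc A x y) (hB : Arc B y z)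
    (hAB : A ∩ B = {y}) : Arc (A ∪ B) x z := by
  classical
  obtain ⟨f, hf, hi, rfl, rfl, rfl⟩ := hA
  obtain ⟨g, hg, hgi, hg0, rfl, rfl⟩ := hB
  have hm : MapsTo (fun t : ℝ => t - 1) (Icc 1 2) (Icc 0 1) := fun t ht =>
    ⟨by linarith [ht.1], by linarith [ht.2]⟩
  let k : ℝ → X := fun t => if t ≤ 1 then f t else g (t - 1)
  have hk0 : EqOn k f (Icc 0 1) := fun t ht => by simp [k, ht.2]
  have hk1 : EqOn k (fun t => g (t - 1)) (Icc 1 2) := fun t ht => by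
    by_cases h : t ≤ 1
    · have : t = 1 := le_antisymm h ht.1
      simp [k, this, hg0]
    · simp [k, h]
  have hu : Icc (0 : ℝ) 1 ∪ Icc 1 2 = Icc 0 2 := Icc_union_Icc_eq_Icc (by norm_num) (by norm_num)
  have hkc : ContinuousOn k (Icc 0 2) := by
    rw [← hu]
    refine ContinuousOn.union_of_isClosed ?_ ?_ isClosed_Icc isClosed_Icc
    · exact hf.congr hk0
    · exact (hg.comp (by fun_prop) hm).congr hk1
  have hi1 : k '' Icc 0 1 = f '' Icc 0 1 := hk0.image_eq
  have hi2 : k '' Icc 1 2 = g '' Icc 0 1 := by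
    rw [hk1.image_eq, ← image_image g (fun t => t - 1)]
    rw [image_sub_const_Icc]
    norm_num
  have hmix : ∀ s ∈ Icc (0 : ℝ) 1, ∀ t ∈ Icc (1 : ℝ) 2, k s = k t → s = t := by
    intro s hs t ht hst
    have h1 : k s ∈ f '' Icc 0 1 := hi1 ▸ mem_image_of_mem k hs
    have h2 : k t ∈ g '' Icc 0 1 := hi2 ▸ mem_image_of_mem k ht
    have h3 : k s ∈ ({f 1} : Set X) := hAB ▸ ⟨h1, hst ▸ h2⟩
    have h4 : s = 1 := hi hs (by simp) (by rw [← hk0 hs]; exact h3)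
    have h5 : t - 1 = 0 := hgi (hm ht) (by simp) (by
      rw [hg0]
      have := hk1 ht
      simp only at this
      rw [← this, ← hst]
      exact h3)
    linarith
  have hki : InjOn k (Icc 0 2) := by
    rw [← hu]
    rintro s (hs | hs) t (ht | ht) hst
    · exact hi hs ht (by rw [← hk0 hs, ← hk0 ht, hst])
    · exact hmix s hs t ht hst
    · exact (hmix t ht s hs hst.symm).symm
    · have := hgi (hm hs) (hm ht) (by
        have h1 := hk1 hs
        have h2 := hk1 ht
        simp only at h1 h2
        rw [← h1, ← h2, hst])
      simp only at this
      linarith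
  have := arc_of_Icc (by norm_num) hkc hki
  rw [← hu, image_union, hi1, hi2] at this
  convert this using 1
  · exact (hk0 (by simp)).symm
  · have := hk1 (show (2 : ℝ) ∈ Icc 1 2 by norm_num)
    rw [this]
    norm_num

/-- `J` is the union of two arcs `A`, `B` which share exactly their ends `u`, `v`. -/
structure JordanSplit (J A B : Set X) (u v : X) : Prop where
  left : Arc A u v
  right : Arc B u v
  inter : A ∩ B = {u, v}
  union : A ∪ B = J

/-- `J` is a simple closed curve. -/
def IsJordan (J : Set X) : Prop := ∃ A B u v, JordanSplit J A B u v

namespace JordanSplit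
variable {J A B : Set X} {u v w : X}

theorem isJordan (h : JordanSplit J A B u v) : IsJordan J := ⟨A, B, u, v, h⟩

theorem swap (h : JordanSplit J A B u v) : JordanSplit J B A u v :=
  ⟨h.right, h.left, by rw [inter_comm, h.inter], by rw [union_comm, h.union]⟩

theorem symm (h : JordanSplit J A B u v) : JordanSplit J A B v u :=
  ⟨h.left.symm, h.right.symm, by rw [h.inter, pair_comm], h.union⟩

theorem left_subset (h : JordanSplit J A B u v) : A ⊆ J := h.union ▸ subset_union_left
theorem right_subset (h : JordanSplit J A B u v) : B ⊆ J := h.union ▸ subset_union_right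

theorem ne (h : JordanSplit J A B u v) : u ≠ v := h.left.ne

theorem image (h : JordanSplit J A B u v) {φ : X → Y} (hφ : ContinuousOn φ J) (hi : InjOn φ J) :
    JordanSplit (φ '' J) (φ '' A) (φ '' B) (φ u) (φ v) :=
  ⟨h.left.image (hφ.mono h.left_subset) (hi.mono h.left_subset),
    h.right.image (hφ.mono h.right_subset) (hi.mono h.right_subset), by
    rw [← hi.image_inter h.left_subset h.right_subset, h.inter, image_pair], by
    rw [← image_union, h.union]⟩

/-- Moving the second end of a splitting. -/
theorem move (h : JordanSplit J A B u v) (hw : w ∈ A) (hu : w ≠ u) (hv : w ≠ v) :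
    ∃ A₁ A₂, A₁ ∪ A₂ = A ∧ A₁ ∩ A₂ = {w} ∧ JordanSplit J A₁ (B ∪ A₂) u w ∧
      JordanSplit J A₂ (B ∪ A₁) v w := by
  obtain ⟨A₁, A₂, h1, h2, hun, hin⟩ := h.left.split hw hu hv
  have hu1 : u ∉ A₂ := fun h => hu (by
    have : u ∈ A₁ ∩ A₂ := ⟨h1.left_mem, h⟩
    rw [hin] at this
    exact this.symm)
  have hv1 : v ∉ A₁ := fun h => hv (by
    have : v ∈ A₁ ∩ A₂ := ⟨h, h2.right_mem⟩
    rw [hin] at this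
    exact this.symm)
  have hA1 : A₁ ⊆ A := hun ▸ subset_union_left
  have hA2 : A₂ ⊆ A := hun ▸ subset_union_right
  have hB1 : A₁ ∩ B = {u} := by
    apply Subset.antisymm
    · intro z hz
      have : z ∈ A ∩ B := ⟨hA1 hz.1, hz.2⟩
      rw [h.inter] at this
      rcases this with rfl | rfl
      · rfl
      · exact absurd hz.1 hv1
    · rintro _ rfl
      exact ⟨h1.left_mem, h.right.left_mem⟩
  have hB2 : A₂ ∩ B = {v} := by
    apply Subset.antisymm
    · intro z hz
      have : z ∈ A ∩ B := ⟨hA2 hz.1, hz.2⟩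
      rw [h.inter] at this
      rcases this with rfl | rfl
      · exact absurd hz.1 hu1
      · rfl
    · rintro _ rfl
      exact ⟨h2.right_mem, h.right.right_mem⟩
  refine ⟨A₁, A₂, hun, hin, ⟨h1, ?_, ?_, ?_⟩, ⟨h2.symm, ?_, ?_, ?_⟩⟩
  · exact h.right.trans h2.symm (by rw [inter_comm, hB2])
  · rw [inter_union_distrib_left, hB1, hin, singleton_union]
  · rw [← h.union, ← hun, union_comm B, union_assoc]
  · exact h.right.symm.trans h1 (by rw [inter_comm, hB1])
  · rw [inter_union_distrib_left, hB2, inter_comm, hin, singleton_union]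
  · rw [← h.union, ← hun, union_comm B, ← union_assoc, union_comm A₂]

end JordanSplit

namespace IsJordan
variable {J : Set X} {u v : X}

theorem isCompact (h : IsJordan J) : IsCompact J := by
  obtain ⟨A, B, u, v, h⟩ := h
  exact h.union ▸ h.left.isCompact.union h.right.isCompact

theorem image (h : IsJordan J) {φ : X → Y} (hφ : ContinuousOn φ J) (hi : InjOn φ J) :
    IsJordan (φ '' J) := by
  obtain ⟨A, B, u, v, h⟩ := h
  exact (h.image hφ hi).isJordan

/-- A simple closed curve can be split at any two of its points. -/
theorem split (h : IsJordan J) (hu : u ∈ J) (hv : v ∈ J) (huv : u ≠ v) :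
    ∃ A B, JordanSplit J A B u v := by
  have step : ∀ {A B : Set X} {a b w : X}, JordanSplit J A B a b → w ∈ J → w ≠ a →
      ∃ A B, JordanSplit J A B a w := by
    intro A B a b w h hw hwa
    by_cases hwb : w = b
    · exact hwb ▸ ⟨A, B, h⟩
    rcases h.union ▸ hw with hw | hw
    · obtain ⟨A₁, A₂, -, -, h1, -⟩ := h.move hw hwa hwb
      exact ⟨_, _, h1⟩
    · obtain ⟨A₁, A₂, -, -, h1, -⟩ := h.swap.move hw hwa hwb
      exact ⟨_, _, h1⟩
  obtain ⟨A, B, a, b, h⟩ := h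
  by_cases hua : u = a
  · subst hua
    exact step h hv huv.symm
  · obtain ⟨A', B', h'⟩ := step h hu hua
    exact step h'.symm hv huv.symm

theorem exists_ne (h : IsJordan J) (x : X) : ∃ y ∈ J, y ≠ x := by
  obtain ⟨A, B, u, v, h⟩ := h
  by_cases hx : u = x
  · exact ⟨v, h.left_subset h.left.right_mem, fun hv => h.ne (hx.trans hv.symm)⟩
  · exact ⟨u, h.left_subset h.left.left_mem, hx⟩

/-- A small arc of a simple closed curve around one of its points. -/
theorem split_near (h : IsJordan J) {x : X} (hx : x ∈ J) {N : Set X} (hN : N ∈ 𝓝 x) :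
    ∃ A B u v, JordanSplit J A B u v ∧ x ∈ A ∧ x ≠ u ∧ x ≠ v ∧ A ⊆ N := by
  obtain ⟨p, hp, hpx⟩ := h.exists_ne x
  obtain ⟨A, B, hs⟩ := h.split hp hx hpx
  obtain ⟨w, A₁, A₂, hA1, hA2, hA, hAi, hAN⟩ := hs.left.split_near hN
  obtain ⟨w', B₁, B₂, hB1, hB2, hB, hBi, hBN⟩ := hs.right.split_near hN
  have sA1 : A₁ ⊆ A := hA ▸ subset_union_left
  have sA2 : A₂ ⊆ A := hA ▸ subset_union_right
  have sB1 : B₁ ⊆ B := hB ▸ subset_union_left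
  have sB2 : B₂ ⊆ B := hB ▸ subset_union_right
  have hmem : ∀ z, z ∈ A → z ∈ B → z = p ∨ z = x := fun z h1 h2 => by
    have : z ∈ A ∩ B := ⟨h1, h2⟩
    rwa [hs.inter] at this
  have hAw : ∀ z, z ∈ A₁ → z ∈ A₂ → z = w := fun z h1 h2 => by
    have : z ∈ A₁ ∩ A₂ := ⟨h1, h2⟩
    rwa [hAi] at this
  have hBw : ∀ z, z ∈ B₁ → z ∈ B₂ → z = w' := fun z h1 h2 => by
    have : z ∈ B₁ ∩ B₂ := ⟨h1, h2⟩
    rwa [hBi] at this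
  have hxw : x ≠ w := hA2.ne.symm
  have hxw' : x ≠ w' := hB2.ne.symm
  have hpw : p ≠ w := hA1.ne
  have hpw' : p ≠ w' := hB1.ne
  have hxA1 : x ∉ A₁ := fun h => hxw (hAw _ h hA2.right_mem)
  have hxB1 : x ∉ B₁ := fun h => hxw' (hBw _ h hB2.right_mem)
  have hpA2 : p ∉ A₂ := fun h => hpw (hAw _ hA1.left_mem h)
  have hpB2 : p ∉ B₂ := fun h => hpw' (hBw _ hB1.left_mem h)
  refine ⟨A₂ ∪ B₂, A₁ ∪ B₁, w, w', ⟨?_, ?_, ?_, ?_⟩, Or.inl hA2.right_mem, hxw, hxw',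
    union_subset hAN hBN⟩
  · refine hA2.trans hB2.symm (Subset.antisymm ?_ ?_)
    · rintro z ⟨h1, h2⟩
      rcases hmem z (sA2 h1) (sB2 h2) with rfl | rfl
      · exact absurd h1 hpA2
      · rfl
    · rintro _ rfl
      exact ⟨hA2.right_mem, hB2.right_mem⟩
  · refine hA1.symm.trans hB1 (Subset.antisymm ?_ ?_)
    · rintro z ⟨h1, h2⟩
      rcases hmem z (sA1 h1) (sB1 h2) with rfl | rfl
      · rfl
      · exact absurd h1 hxA1
    · rintro _ rfl
      exact ⟨hA1.left_mem, hB1.left_mem⟩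
  · apply Subset.antisymm
    · rintro z ⟨h1 | h1, h2 | h2⟩
      · exact Or.inl (hAw z h2 h1)
      · rcases hmem z (sA2 h1) (sB1 h2) with rfl | rfl
        · exact absurd h1 hpA2
        · exact absurd h2 hxB1
      · rcases hmem z (sA1 h2) (sB2 h1) with rfl | rfl
        · exact absurd h1 hpB2
        · exact absurd h2 hxA1
      · exact Or.inr (hBw z h2 h1)
    · rintro z (rfl | rfl)
      · exact ⟨Or.inl hA2.left_mem, Or.inl hA1.right_mem⟩
      · exact ⟨Or.inr hB2.left_mem, Or.inr hB1.right_mem⟩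
  · rw [← hs.union, ← hA, ← hB]
    ac_rfl

end IsJordan

/-- A splitting whose first arc is contained in a given arc of the curve. -/
theorem JordanSplit.split_subset {J A B : Set X} {u v a b : X} (h : JordanSplit J A B u v)
    (ha : a ∈ A) (hb : b ∈ A) (hab : a ≠ b) :
    ∃ A' B', JordanSplit J A' B' a b ∧ A' ⊆ A := by
  have first : ∀ {A B : Set X} {u v b : X}, JordanSplit J A B u v → b ∈ A → b ≠ u →
      ∃ A' B', JordanSplit J A' B' u b ∧ A' ⊆ A := by
    intro A B u v b h hb hbu
    by_cases hbv : b = v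
    · exact ⟨A, B, hbv ▸ h, Subset.rfl⟩
    · obtain ⟨A₁, A₂, hun, -, h1, -⟩ := h.move hb hbu hbv
      exact ⟨_, _, h1, hun ▸ subset_union_left⟩
  by_cases hau : a = u
  · subst hau
    exact first h hb hab.symm
  by_cases hav : a = v
  · subst hav
    exact first h.symm hb hab.symm
  obtain ⟨A₁, A₂, hun, -, h1, h2⟩ := h.move ha hau hav
  rcases hun ▸ hb with hb | hb
  · obtain ⟨A', B', h', hs⟩ := first h1.symm hb hab.symm
    exact ⟨A', B', h', hs.trans (hun ▸ subset_union_left)⟩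
  · obtain ⟨A', B', h', hs⟩ := first h2.symm hb hab.symm
    exact ⟨A', B', h', hs.trans (hun ▸ subset_union_right)⟩

end Whitney

namespace Whitney
open Set Filter Topology Metric

theorem inter_frontier_nonempty {X : Type*} [TopologicalSpace X] {S U : Set X}
    (hS : IsPreconnected S) {a b : X} (ha : a ∈ S) (haU : a ∈ U) (hb : b ∈ S) (hbU : b ∉ U) :
    (S ∩ frontier U).Nonempty := by
  by_contra h
  rw [not_nonempty_iff_eq_empty] at h
  have hcov : S ⊆ interior U ∪ (closure U)ᶜ := by
    intro z hz
    by_cases h1 : z ∈ interior U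
    · exact Or.inl h1
    · refine Or.inr fun h2 => ?_
      have : z ∈ S ∩ frontier U := ⟨hz, h2, h1⟩
      simp [h] at this
  have h1 : a ∈ interior U := (hcov ha).resolve_right fun h => h (subset_closure haU)
  have h2 : b ∈ (closure U)ᶜ := (hcov hb).resolve_left fun h => hbU (interior_subset h)
  obtain ⟨z, -, hz, hz'⟩ := hS _ _ isOpen_interior isClosed_closure.isOpen_compl hcov ⟨a, ha, h1⟩
    ⟨b, hb, h2⟩
  exact hz' (subset_closure (interior_subset hz))

theorem subset_of_frontier_inter {X : Type*} [TopologicalSpace X] {S U : Set X}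
    (hS : IsPreconnected S) {a : X} (ha : a ∈ S) (haU : a ∈ U) (h : S ∩ frontier U = ∅) :
    S ⊆ U := by
  intro b hb
  by_contra hbU
  exact (inter_frontier_nonempty hS ha haU hb hbU).ne_empty h

theorem Arc.hasLog {X : Type*} [TopologicalSpace X] [T2Space X] {A : Set X} {x y : X}
    (h : Arc A x y) {f : X → ℂ} (hf : ContinuousOn f A) (h0 : ∀ z ∈ A, f z ≠ 0) : HasLog A f := by
  obtain ⟨φ, hφ, hi, rfl, rfl, rfl⟩ := h
  obtain ⟨g, hg, hgf⟩ := hasLog_of_convex (convex_Icc 0 1) (hf.comp hφ (mapsTo_image _ _))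
    fun z hz => h0 _ (mem_image_of_mem _ hz)
  exact hasLog_image isCompact_Icc hφ hg hgf fun s hs t ht hst => by rw [hi hs ht hst]

theorem Arc.joinedIn {X : Type*} [TopologicalSpace X] {A : Set X} {x y : X} (h : Arc A x y) :
    JoinedIn A x y := by
  obtain ⟨φ, hφ, hi, rfl, rfl, rfl⟩ := h
  exact JoinedIn.ofLine hφ rfl rfl Subset.rfl

/-- An arc does not separate the plane. -/
theorem Arc.joinedIn_compl {A : Set ℂ} {u v : ℂ} (h : Arc A u v) {x y : ℂ} (hx : x ∉ A)
    (hy : y ∉ A) : JoinedIn Aᶜ x y := by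
  have hx' : ∀ z ∈ A, z - x ≠ 0 := fun z hz h0 => hx (sub_eq_zero.1 h0 ▸ hz)
  have hy' : ∀ z ∈ A, z - y ≠ 0 := fun z hz h0 => hy (sub_eq_zero.1 h0 ▸ hz)
  refine joinedIn_of_hasLog h.isCompact hx hy (h.hasLog ?_ ?_)
  · exact ContinuousOn.div (by fun_prop) (by fun_prop) hy'
  · exact fun z hz => div_ne_zero (hx' z hz) (hy' z hz)

theorem JordanSplit.not_isPreconnected_compl {J A B : Set ℂ} {p q : ℂ}
    (h : JordanSplit J A B p q) : ¬ IsPreconnected Jᶜ := by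
  intro hJ
  have hA : HasLog Aᶜ (fun z => (z - p) / (z - q)) :=
    hasLog_of_joinedIn (by rw [compl_compl]; exact h.left.joinedIn)
  have hB : HasLog Bᶜ (fun z => (z - p) / (z - q)) :=
    hasLog_of_joinedIn (by rw [compl_compl]; exact h.right.joinedIn)
  have hAB := HasLog.union_aux (by rwa [← compl_union, h.union]) hA hB fun g hg hg' =>
    hg.union_of_isOpen hg' h.left.isCompact.isClosed.isOpen_compl
      h.right.isCompact.isClosed.isOpen_compl
  rw [← compl_inter, h.inter] at hAB
  have hd : 0 < dist q p := dist_pos.2 h.ne.symm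
  have hs : sphere p (dist q p / 2) ⊆ {p, q}ᶜ := by
    rintro z hz (rfl | rfl)
    · simp only [mem_sphere, dist_self] at hz
      linarith
    · simp only [mem_sphere] at hz
      linarith
  have := zpow_eq_zero_of_hasLog (K := sphere p (dist q p / 2)) (U := ball p (dist q p / 2))
    isClosed_sphere isBounded_ball isOpen_ball (by rw [frontier_ball _ (by positivity)])
    (mem_ball_self (by positivity)) (y := q) (m := 1) (k := -1) (by
      intro hq
      have := closure_ball_subset_closedBall hq
      rw [mem_closedBall] at this
      linarith) ((hAB.mono hs).congr fun z _ => by simp [div_eq_mul_inv])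
  simp at this

theorem JordanSplit.exists_period {J A B : Set ℂ} {u v : ℂ} (h : JordanSplit J A B u v) :
    ∃ n : ℂ → ℤ, ∀ x y, x ∉ J → y ∉ J → ∀ a b : ℤ, a * n x + b * n y = 0 →
      HasLog J (fun z => (z - x) ^ a * (z - y) ^ b) := by
  classical
  have key : ∀ x, ∃ n : ℤ, x ∉ J → ∃ g g' : ℂ → ℂ, ContinuousOn g A ∧ ContinuousOn g' B ∧
      (∀ z ∈ A, Complex.exp (g z) = z - x) ∧ (∀ z ∈ B, Complex.exp (g' z) = z - x) ∧
      g u = g' u ∧ g v = g' v + n * (2 * Real.pi * Complex.I) := by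
    intro x
    by_cases hx : x ∈ J
    · exact ⟨0, fun h => absurd hx h⟩
    have hx' : ∀ z ∈ J, z - x ≠ 0 := fun z hz h0 => hx (sub_eq_zero.1 h0 ▸ hz)
    obtain ⟨g, hg, hgf⟩ := h.left.hasLog (f := fun z => z - x) (by fun_prop)
      fun z hz => hx' z (h.left_subset hz)
    obtain ⟨g', hg', hgf'⟩ := h.right.hasLog (f := fun z => z - x) (by fun_prop)
      fun z hz => hx' z (h.right_subset hz)
    have hu : Complex.exp (g u) = Complex.exp (g' u) :=
      (hgf u h.left.left_mem).trans (hgf' u h.right.left_mem).symm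
    have hv : Complex.exp (g v) = Complex.exp (g' v) :=
      (hgf v h.left.right_mem).trans (hgf' v h.right.right_mem).symm
    obtain ⟨k, hk⟩ := Complex.exp_eq_exp_iff_exists_int.1 hu
    obtain ⟨l, hl⟩ := Complex.exp_eq_exp_iff_exists_int.1 hv
    refine ⟨l - k, fun _ => ⟨g, fun z => g' z + k * (2 * Real.pi * Complex.I), hg,
      hg'.add continuousOn_const, hgf, fun z hz => ?_, hk, ?_⟩⟩
    · rw [Complex.exp_add, hgf' z hz, Complex.exp_int_mul_two_pi_mul_I, mul_one]
    · rw [hl]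
      push_cast
      ring
  choose n hn using key
  refine ⟨n, fun x y hx hy a b hab => ?_⟩
  obtain ⟨g₁, g₁', h1, h2, h3, h4, h5, h6⟩ := hn x hx
  obtain ⟨g₂, g₂', k1, k2, k3, k4, k5, k6⟩ := hn y hy
  let G : ℂ → ℂ := fun z => if z ∈ A then a * g₁ z + b * g₂ z else a * g₁' z + b * g₂' z
  have hGA : EqOn G (fun z => a * g₁ z + b * g₂ z) A := fun z hz => by simp [G, hz]
  have hGB : EqOn G (fun z => a * g₁' z + b * g₂' z) B := fun z hz => by
    by_cases hzA : z ∈ A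
    · have hz' : z ∈ A ∩ B := ⟨hzA, hz⟩
      rw [h.inter] at hz'
      simp only [G, hzA, if_true]
      rcases hz' with rfl | rfl
      · rw [h5, k5]
      · rw [h6, k6]
        have : (a : ℂ) * n x + b * n y = 0 := by exact_mod_cast hab
        linear_combination (2 * Real.pi * Complex.I) * this
    · simp [G, hzA]
  refine ⟨G, ?_, ?_⟩
  · rw [← h.union]
    refine ContinuousOn.union_of_isClosed ?_ ?_ h.left.isCompact.isClosed
      h.right.isCompact.isClosed
    · exact ((continuousOn_const.mul h1).add (continuousOn_const.mul k1)).congr hGA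
    · exact ((continuousOn_const.mul h2).add (continuousOn_const.mul k2)).congr hGB
  · intro z hz
    rcases h.union ▸ hz with hz | hz
    · rw [hGA hz, Complex.exp_add, Complex.exp_int_mul, Complex.exp_int_mul, h3 z hz, k3 z hz]
    · rw [hGB hz, Complex.exp_add, Complex.exp_int_mul, Complex.exp_int_mul, h4 z hz, k4 z hz]

/-- The bounded part of the complement of `J`. -/
def inside (J : Set ℂ) : Set ℂ :=
  {x | x ∉ J ∧ Bornology.IsBounded (connectedComponentIn Jᶜ x)}

/-- The unbounded part of the complement of `J`. -/
def outside (J : Set ℂ) : Set ℂ :=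
  {x | x ∉ J ∧ ¬ Bornology.IsBounded (connectedComponentIn Jᶜ x)}

theorem inside_union_outside (J : Set ℂ) : inside J ∪ outside J = Jᶜ := by
  ext x
  simp only [inside, outside, mem_union, mem_ofPred_eq, mem_compl_iff]
  tauto

theorem disjoint_inside (J : Set ℂ) : Disjoint (inside J) J :=
  disjoint_left.2 fun _ h h' => h.1 h'

theorem disjoint_outside (J : Set ℂ) : Disjoint (outside J) J :=
  disjoint_left.2 fun _ h h' => h.1 h'

theorem disjoint_inside_outside (J : Set ℂ) : Disjoint (inside J) (outside J) :=
  disjoint_left.2 fun _ h h' => h'.2 h.2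

theorem mem_inside_of_mem {J : Set ℂ} {x y : ℂ} (hx : x ∈ inside J)
    (hy : y ∈ connectedComponentIn Jᶜ x) : y ∈ inside J :=
  ⟨connectedComponentIn_subset _ _ hy, by rw [← connectedComponentIn_eq hy]; exact hx.2⟩

theorem mem_outside_of_mem {J : Set ℂ} {x y : ℂ} (hx : x ∈ outside J)
    (hy : y ∈ connectedComponentIn Jᶜ x) : y ∈ outside J :=
  ⟨connectedComponentIn_subset _ _ hy, by rw [← connectedComponentIn_eq hy]; exact hx.2⟩

theorem not_joinedIn_inside_outside {J : Set ℂ} (hJ : IsClosed J) {x y : ℂ} (hx : x ∈ inside J)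
    (hy : y ∈ outside J) : ¬ JoinedIn Jᶜ x y := fun h =>
  disjoint_left.1 (disjoint_inside_outside J)
    (mem_inside_of_mem hx ((joinedIn_iff_mem_connectedComponentIn hJ hx.1).1 h)) hy

theorem isOpen_inside {J : Set ℂ} (hJ : IsClosed J) : IsOpen (inside J) := by
  rw [isOpen_iff_mem_nhds]
  intro x hx
  exact mem_of_superset (hJ.isOpen_compl.connectedComponentIn.mem_nhds
    (mem_connectedComponentIn hx.1)) fun y hy => mem_inside_of_mem hx hy

theorem isOpen_outside {J : Set ℂ} (hJ : IsClosed J) : IsOpen (outside J) := by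
  rw [isOpen_iff_mem_nhds]
  intro x hx
  exact mem_of_superset (hJ.isOpen_compl.connectedComponentIn.mem_nhds
    (mem_connectedComponentIn hx.1)) fun y hy => mem_outside_of_mem hx hy

theorem inside_subset_closedBall {J : Set ℂ} {c : ℂ} {R : ℝ} (h : J ⊆ closedBall c R) :
    inside J ⊆ closedBall c R := by
  intro x hx
  by_contra hxR
  have h1 : (closedBall c R)ᶜ ⊆ connectedComponentIn Jᶜ x :=
    (isPreconnected_compl_closedBall c).subset_connectedComponentIn hxR (compl_subset_compl.2 h)
  have h2 : Bornology.IsBounded (univ : Set ℂ) := by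
    rw [← union_compl_self (closedBall c R)]
    exact isBounded_closedBall.union (hx.2.subset h1)
  exact NormedSpace.unbounded_univ ℝ ℂ h2

theorem isBounded_inside {J : Set ℂ} (hJ : IsCompact J) : Bornology.IsBounded (inside J) := by
  obtain ⟨R, hR⟩ := hJ.isBounded.subset_closedBall 0
  exact isBounded_closedBall.subset (inside_subset_closedBall hR)

theorem outside_nonempty {J : Set ℂ} (hJ : IsCompact J) : (outside J).Nonempty := by
  obtain ⟨R, hR⟩ := hJ.isBounded.subset_closedBall 0
  by_contra h
  rw [not_nonempty_iff_eq_empty] at h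
  have h1 := inside_union_outside J
  rw [h, union_empty] at h1
  have h2 : Bornology.IsBounded (univ : Set ℂ) := by
    rw [← union_compl_self J, ← h1]
    exact hJ.isBounded.union (isBounded_inside hJ)
  exact NormedSpace.unbounded_univ ℝ ℂ h2

theorem isPreconnected_outside {J : Set ℂ} (hJ : IsCompact J) : IsPreconnected (outside J) := by
  obtain ⟨x, hx⟩ := outside_nonempty hJ
  convert isPreconnected_connectedComponentIn (F := Jᶜ) (x := x)
  ext y
  refine ⟨fun hy => ?_, fun hy => mem_outside_of_mem hx hy⟩
  exact (joinedIn_iff_mem_connectedComponentIn hJ.isClosed hx.1).1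
    (joinedIn_of_not_isBounded hJ hx.2 hy.2)

namespace IsJordan
variable {J : Set ℂ}

theorem joinedIn_inside (h : IsJordan J) {x y : ℂ} (hx : x ∈ inside J) (hy : y ∈ inside J) :
    JoinedIn Jᶜ x y := by
  by_contra hn
  have hc := h.isCompact.isClosed
  obtain ⟨A, B, u, v, h⟩ := h
  obtain ⟨n, hn'⟩ := h.exists_period
  have h1 : n y = 0 := zpow_eq_zero_of_isBounded hc hx.1 hy.1 hx.2 hn
    (hn' x y hx.1 hy.1 (n y) (-n x) (by ring))
  have h2 : (1 : ℤ) = 0 := zpow_eq_zero_of_isBounded hc hy.1 hx.1 hy.2 (fun h => hn h.symm)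
    (hn' y x hy.1 hx.1 1 0 (by simp [h1]))
  simp at h2

theorem inside_eq (h : IsJordan J) {x : ℂ} (hx : x ∈ inside J) :
    inside J = connectedComponentIn Jᶜ x := by
  ext y
  refine ⟨fun hy => ?_, fun hy => mem_inside_of_mem hx hy⟩
  exact (joinedIn_iff_mem_connectedComponentIn h.isCompact.isClosed hx.1).1 (h.joinedIn_inside hx hy)

theorem isPreconnected_inside (h : IsJordan J) : IsPreconnected (inside J) := by
  rcases (inside J).eq_empty_or_nonempty with h0 | ⟨x, hx⟩
  · rw [h0]; exact isPreconnected_empty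
  · rw [h.inside_eq hx]; exact isPreconnected_connectedComponentIn

theorem inside_nonempty (h : IsJordan J) : (inside J).Nonempty := by
  by_contra h0
  rw [not_nonempty_iff_eq_empty] at h0
  have h1 := inside_union_outside J
  rw [h0, empty_union] at h1
  have h2 := isPreconnected_outside h.isCompact
  rw [h1] at h2
  obtain ⟨A, B, u, v, h⟩ := h
  exact h.not_isPreconnected_compl h2

theorem frontier_inside_subset (h : IsJordan J) : frontier (inside J) ⊆ J := by
  obtain ⟨x, hx⟩ := h.inside_nonempty
  rw [h.inside_eq hx]
  simpa using frontier_connectedComponentIn_subset h.isCompact.isClosed.isOpen_compl x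

theorem frontier_outside_subset (h : IsJordan J) : frontier (outside J) ⊆ J := by
  intro z hz
  by_contra hzJ
  rw [(isOpen_outside h.isCompact.isClosed).frontier_eq] at hz
  have : z ∈ inside J := by
    have : z ∈ inside J ∪ outside J := by rw [inside_union_outside]; exact hzJ
    exact this.resolve_right hz.2
  obtain ⟨w, hw1, hw2⟩ := mem_closure_iff.1 hz.1 _ (isOpen_inside h.isCompact.isClosed) this
  exact disjoint_left.1 (disjoint_inside_outside J) hw1 hw2

theorem subset_closure_of_frontier (h : IsJordan J) {U : Set ℂ} (hU : frontier U ⊆ J) {x y : ℂ}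
    (hx : x ∈ U) (hxJ : x ∉ J) (hy : y ∉ U) (hyJ : y ∉ J) : J ⊆ closure U := by
  intro p hp
  rw [← closure_closure, mem_closure_iff_nhds]
  intro N hN
  obtain ⟨A, B, u, v, hs, -, -, -, hAN⟩ := h.split_near hp hN
  obtain ⟨γ, hγ⟩ := hs.right.joinedIn_compl (fun h => hxJ (hs.right_subset h))
    (fun h => hyJ (hs.right_subset h))
  obtain ⟨z, ⟨t, rfl⟩, hz⟩ := inter_frontier_nonempty (isPreconnected_range γ.continuous)
    ⟨0, γ.source⟩ hx ⟨1, γ.target⟩ hy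
  have hzJ := hU hz
  rw [← hs.union] at hzJ
  exact ⟨γ t, hAN (hzJ.resolve_right (hγ t)), frontier_subset_closure hz⟩

theorem subset_closure_inside (h : IsJordan J) : J ⊆ closure (inside J) := by
  obtain ⟨x, hx⟩ := h.inside_nonempty
  obtain ⟨y, hy⟩ := outside_nonempty h.isCompact
  exact h.subset_closure_of_frontier h.frontier_inside_subset hx hx.1
    (fun h' => h'.2 |> hy.2) hy.1

theorem subset_closure_outside (h : IsJordan J) : J ⊆ closure (outside J) := by
  obtain ⟨x, hx⟩ := h.inside_nonempty
  obtain ⟨y, hy⟩ := outside_nonempty h.isCompact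
  exact h.subset_closure_of_frontier h.frontier_outside_subset hy hy.1
    (fun h' => h'.2 hx.2) hx.1

theorem frontier_inside (h : IsJordan J) : frontier (inside J) = J := by
  refine h.frontier_inside_subset.antisymm fun z hz => ?_
  rw [(isOpen_inside h.isCompact.isClosed).frontier_eq]
  exact ⟨h.subset_closure_inside hz, fun h' => h'.1 hz⟩

theorem closure_inside (h : IsJordan J) : closure (inside J) = inside J ∪ J := by
  rw [closure_eq_self_union_frontier, h.frontier_inside]

end IsJordan

end Whitney

namespace Whitney
open Set Filter Topology Metric

/-- A simple closed curve `J = A ∪ B` together with a crosscut `c`. -/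
structure Theta (J A B c : Set ℂ) (u v : ℂ) : Prop where
  split : JordanSplit J A B u v
  arc : Arc c u v
  subset : c \ {u, v} ⊆ inside J

namespace Theta
variable {J A B c : Set ℂ} {u v : ℂ}

theorem swap (h : Theta J A B c u v) : Theta J B A c u v := ⟨h.split.swap, h.arc, h.subset⟩

theorem mem_ends (h : Theta J A B c u v) {z : ℂ} (hz : z ∈ c) (hzJ : z ∈ J) : z = u ∨ z = v := by
  by_contra hn
  exact (h.subset ⟨hz, hn⟩).1 hzJ

theorem left (h : Theta J A B c u v) : JordanSplit (A ∪ c) A c u v := by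
  refine ⟨h.split.left, h.arc, Subset.antisymm ?_ ?_, rfl⟩
  · exact fun z hz => h.mem_ends hz.2 (h.split.left_subset hz.1)
  · rintro z (rfl | rfl)
    · exact ⟨h.split.left.left_mem, h.arc.left_mem⟩
    · exact ⟨h.split.left.right_mem, h.arc.right_mem⟩

theorem right (h : Theta J A B c u v) : JordanSplit (B ∪ c) B c u v := h.swap.left

theorem isJordan (h : Theta J A B c u v) : IsJordan J := h.split.isJordan
theorem isJordan_left (h : Theta J A B c u v) : IsJordan (A ∪ c) := h.left.isJordan
theorem isJordan_right (h : Theta J A B c u v) : IsJordan (B ∪ c) := h.right.isJordan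

theorem arc_subset (h : Theta J A B c u v) : c ⊆ inside J ∪ J := by
  intro z hz
  by_cases hz' : z = u ∨ z = v
  · right
    rcases hz' with rfl | rfl
    · exact h.split.left_subset h.split.left.left_mem
    · exact h.split.left_subset h.split.left.right_mem
  · exact Or.inl (h.subset ⟨hz, hz'⟩)

theorem outside_subset (h : Theta J A B c u v) : outside J ⊆ outside (A ∪ c) := by
  have hd : outside J ⊆ (A ∪ c)ᶜ := by
    rintro z hz (hz' | hz')
    · exact hz.1 (h.split.left_subset hz')
    · rcases h.arc_subset hz' with h' | h'
      · exact hz.2 h'.2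
      · exact hz.1 h'
  intro x hx
  refine ⟨hd hx, fun hb => hx.2 (hb.subset ?_)⟩
  have h1 : connectedComponentIn Jᶜ x ⊆ outside J := fun y hy => mem_outside_of_mem hx hy
  exact isPreconnected_connectedComponentIn.subset_connectedComponentIn
    (mem_connectedComponentIn hx.1) (h1.trans hd)

theorem right_diff_subset (h : Theta J A B c u v) : B \ {u, v} ⊆ outside (A ∪ c) := by
  intro z hz
  have hz1 : z ∉ A ∪ c := by
    rintro (h' | h')
    · have : z ∈ A ∩ B := ⟨h', hz.1⟩
      rw [h.split.inter] at this
      exact hz.2 this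
    · exact hz.2 (h.mem_ends h' (h.split.right_subset hz.1))
  by_contra hn
  have hzi : z ∈ inside (A ∪ c) := by
    have : z ∈ inside (A ∪ c) ∪ outside (A ∪ c) := by rw [inside_union_outside]; exact hz1
    exact this.resolve_right hn
  obtain ⟨w, hw1, hw2⟩ := mem_closure_iff.1 (h.isJordan.subset_closure_outside
    (h.split.right_subset hz.1)) _ (isOpen_inside h.isJordan_left.isCompact.isClosed) hzi
  exact disjoint_left.1 (disjoint_inside_outside _) hw1 (h.outside_subset hw2)

theorem inside_left_disjoint (h : Theta J A B c u v) : Disjoint (inside (A ∪ c)) (J ∪ c) := by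
  rw [disjoint_left]
  intro z hz hz'
  rw [← h.split.union] at hz'
  rcases hz' with (h' | h') | h'
  · exact hz.1 (Or.inl h')
  · by_cases hzu : z = u ∨ z = v
    · refine hz.1 (Or.inr ?_)
      rcases hzu with rfl | rfl
      · exact h.arc.left_mem
      · exact h.arc.right_mem
    · exact disjoint_left.1 (disjoint_inside_outside _) hz (h.right_diff_subset ⟨h', hzu⟩)
  · exact hz.1 (Or.inr h')

theorem inside_right_disjoint (h : Theta J A B c u v) : Disjoint (inside (B ∪ c)) (J ∪ c) :=
  h.swap.inside_left_disjoint

theorem inside_left_subset (h : Theta J A B c u v) : inside (A ∪ c) ⊆ inside J := by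
  intro z hz
  have h1 : z ∉ J := fun h' => disjoint_left.1 h.inside_left_disjoint hz (Or.inl h')
  have : z ∈ inside J ∪ outside J := by rw [inside_union_outside]; exact h1
  exact this.resolve_right fun h' =>
    disjoint_left.1 (disjoint_inside_outside _) hz (h.outside_subset h')

theorem inside_right_subset (h : Theta J A B c u v) : inside (B ∪ c) ⊆ inside J :=
  h.swap.inside_left_subset

theorem union_ne (h : Theta J A B c u v) : A ∪ c ≠ B ∪ c := by
  intro he
  obtain ⟨a, ha, ha'⟩ := h.split.left.diff_nonempty
  have : a ∈ B ∪ c := he ▸ Or.inl ha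
  rcases this with h1 | h1
  · have : a ∈ A ∩ B := ⟨ha, h1⟩
    rw [h.split.inter] at this
    exact ha' this
  · exact ha' (h.mem_ends h1 (h.split.left_subset ha))

theorem disjoint (h : Theta J A B c u v) : Disjoint (inside (A ∪ c)) (inside (B ∪ c)) := by
  rw [disjoint_left]
  intro x hx hx'
  have h1 : inside (A ∪ c) ⊆ inside (B ∪ c) := by
    refine subset_of_frontier_inter h.isJordan_left.isPreconnected_inside hx hx' ?_
    rw [h.isJordan_right.frontier_inside]
    exact (h.inside_left_disjoint.mono_right (union_subset_union_left _ h.split.right_subset)).inter_eq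
  have h2 : inside (B ∪ c) ⊆ inside (A ∪ c) := by
    refine subset_of_frontier_inter h.isJordan_right.isPreconnected_inside hx' hx ?_
    rw [h.isJordan_left.frontier_inside]
    exact (h.inside_right_disjoint.mono_right (union_subset_union_left _ h.split.left_subset)).inter_eq
  have h3 := h1.antisymm h2
  have h4 := h.isJordan_left.frontier_inside
  rw [h3, h.isJordan_right.frontier_inside] at h4
  exact h.union_ne h4.symm

theorem inside_subset (h : Theta J A B c u v) :
    inside J ⊆ inside (A ∪ c) ∪ inside (B ∪ c) ∪ c := by
  intro z hz
  by_contra hn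
  simp only [mem_union, not_or] at hn
  have hA : z ∈ outside (A ∪ c) := by
    have : z ∈ inside (A ∪ c) ∪ outside (A ∪ c) := by
      rw [inside_union_outside]
      rintro (h' | h')
      · exact hz.1 (h.split.left_subset h')
      · exact hn.2 h'
    exact this.resolve_left hn.1.1
  have hB : z ∈ outside (B ∪ c) := by
    have : z ∈ inside (B ∪ c) ∪ outside (B ∪ c) := by
      rw [inside_union_outside]
      rintro (h' | h')
      · exact hz.1 (h.split.right_subset h')
      · exact hn.2 h'
    exact this.resolve_left hn.1.2
  obtain ⟨y, hy⟩ := outside_nonempty h.isJordan.isCompact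
  have hyA := h.outside_subset hy
  have hyB := h.swap.outside_subset hy
  have key := janiszewski h.isJordan_left.isCompact h.isJordan_right.isCompact ?_
    (joinedIn_of_not_isBounded h.isJordan_left.isCompact hA.2 hyA.2)
    (joinedIn_of_not_isBounded h.isJordan_right.isCompact hB.2 hyB.2)
  · refine not_joinedIn_inside_outside h.isJordan.isCompact.isClosed hz hy (key.mono ?_)
    rw [compl_subset_compl, ← h.split.union]
    exact union_subset_union subset_union_left subset_union_left
  · rw [← inter_union_distrib_right, h.split.inter, union_eq_self_of_subset_left]
    · exact h.arc.isPreconnected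
    · rintro z (rfl | rfl)
      · exact h.arc.left_mem
      · exact h.arc.right_mem

theorem inside_diff (h : Theta J A B c u v) :
    inside J \ c = inside (A ∪ c) ∪ inside (B ∪ c) := by
  apply Subset.antisymm
  · exact fun z hz => (h.inside_subset hz.1).resolve_right hz.2
  · rintro z (hz | hz)
    · exact ⟨h.inside_left_subset hz, fun hzB => hz.1 (Or.inr hzB)⟩
    · exact ⟨h.inside_right_subset hz, fun hzB => hz.1 (Or.inr hzB)⟩

/-- A connected set avoiding the curve and the crosscut lies on one side. -/
theorem subset_or (h : Theta J A B c u v) {S : Set ℂ} (hS : IsPreconnected S)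
    (hSJ : S ⊆ inside J \ c) : S ⊆ inside (A ∪ c) ∨ S ⊆ inside (B ∪ c) := by
  rw [h.inside_diff] at hSJ
  exact hS.subset_or_subset (isOpen_inside h.isJordan_left.isCompact.isClosed)
    (isOpen_inside h.isJordan_right.isCompact.isClosed) h.disjoint hSJ

end Theta

end Whitney

namespace Whitney
open Set Filter Topology Metric

/-- `J` can be cut along finitely many crosscuts into curves satisfying `P`. -/
inductive Cuts (P : Set ℂ → Prop) : Set ℂ → Prop
  | leaf {J : Set ℂ} : IsJordan J → P J → Cuts P J
  | node {J A B c : Set ℂ} {u v : ℂ} : Theta J A B c u v → Cuts P (A ∪ c) → Cuts P (B ∪ c) →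
      Cuts P J

theorem Cuts.bind {P Q : Set ℂ → Prop} {J : Set ℂ} (h : Cuts P J)
    (hQ : ∀ K, IsJordan K → inside K ⊆ inside J → P K → Cuts Q K) : Cuts Q J := by
  induction h with
  | leaf hJ hP => exact hQ _ hJ Subset.rfl hP
  | node ht _ _ ih1 ih2 =>
    exact .node ht (ih1 fun K hK hs => hQ K hK (hs.trans ht.inside_left_subset))
      (ih2 fun K hK hs => hQ K hK (hs.trans ht.inside_right_subset))

theorem Cuts.imp {P Q : Set ℂ → Prop} {J : Set ℂ} (h : Cuts P J)
    (hQ : ∀ K, IsJordan K → inside K ⊆ inside J → P K → Q K) : Cuts Q J :=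
  h.bind fun K hK hs hP => .leaf hK (hQ K hK hs hP)

/-- `c` is a crosscut of `J`. -/
def Crosscut (J c : Set ℂ) : Prop :=
  ∃ u v, u ∈ J ∧ v ∈ J ∧ Arc c u v ∧ c \ {u, v} ⊆ inside J

theorem IsJordan.theta {J c : Set ℂ} (hJ : IsJordan J) (hc : Crosscut J c) :
    ∃ A B u v, Theta J A B c u v := by
  obtain ⟨u, v, hu, hv, ha, hs⟩ := hc
  obtain ⟨A, B, h⟩ := hJ.split hu hv ha.ne
  exact ⟨A, B, u, v, h, ha, hs⟩

/-- `c` separates `x` from `y` inside `J`. -/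
def SepBy (J c : Set ℂ) (x y : ℂ) : Prop :=
  ∀ S, IsPreconnected S → S ⊆ inside J \ c → x ∈ S → y ∈ S → False

theorem SepBy.symm {J c : Set ℂ} {x y : ℂ} (h : SepBy J c x y) : SepBy J c y x :=
  fun S hS hSJ hx hy => h S hS hSJ hy hx

theorem Theta.crosscut_left {J A B s c : Set ℂ} {u v x y : ℂ} (h : Theta J A B s u v)
    (hc : Crosscut J c) (hdisj : Disjoint (c ∩ inside J) (s ∩ inside J))
    (hx : x ∈ inside (A ∪ s)) (hy : y ∈ inside (A ∪ s)) (hsep : SepBy J c x y) :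
    Crosscut (A ∪ s) c ∧ SepBy (A ∪ s) c x y := by
  obtain ⟨a, b, ha, hb, harc, hsub⟩ := hc
  have h1 : c \ {a, b} ⊆ inside J \ s := fun z hz =>
    ⟨hsub hz, fun hzs => disjoint_left.1 hdisj ⟨hz.1, hsub hz⟩ ⟨hzs, hsub hz⟩⟩
  rcases h.subset_or harc.isPreconnected_diff h1 with h2 | h2
  · refine ⟨⟨a, b, ?_, ?_, harc, h2⟩, fun S hS hSJ => hsep S hS fun z hz =>
      ⟨h.inside_left_subset (hSJ hz).1, (hSJ hz).2⟩⟩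
    all_goals
      have hcl : c ⊆ inside (A ∪ s) ∪ (A ∪ s) := by
        rw [← h.isJordan_left.closure_inside]
        exact harc.subset_closure_diff.trans (closure_mono h2)
    · exact (hcl harc.left_mem).resolve_left fun h' => (h.inside_left_subset h').1 ha
    · exact (hcl harc.right_mem).resolve_left fun h' => (h.inside_left_subset h').1 hb
  · exfalso
    refine hsep _ h.isJordan_left.isPreconnected_inside (fun z hz => ?_) hx hy
    refine ⟨h.inside_left_subset hz, fun hzc => ?_⟩
    have hzJ := (h.inside_left_subset hz).1
    have : z ∈ c \ {a, b} := ⟨hzc, by rintro (rfl | rfl); exacts [hzJ ha, hzJ hb]⟩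
    exact disjoint_left.1 h.disjoint hz (h2 this)

/-- Cutting along a finite disjoint family of crosscuts. -/
theorem cuts_of_family (D : ℂ → ℂ → Prop) (n : ℕ) : ∀ (J : Set ℂ) (F : Finset (Set ℂ)),
    F.card = n → IsJordan J → (∀ c ∈ F, Crosscut J c) →
    (∀ c ∈ F, ∀ d ∈ F, c ≠ d → Disjoint (c ∩ inside J) (d ∩ inside J)) →
    (∀ x ∈ inside J, ∀ y ∈ inside J, D x y → ∃ c ∈ F, SepBy J c x y) →
    Cuts (fun K => ∀ x ∈ inside K, ∀ y ∈ inside K, ¬ D x y) J := by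
  classical
  induction n using Nat.strong_induction_on with
  | _ n ih =>
  intro J F hn hJ hF hdisj hsep
  rcases F.eq_empty_or_nonempty with rfl | ⟨s, hs⟩
  · refine .leaf hJ fun x hx y hy hD => ?_
    obtain ⟨c, hc, -⟩ := hsep x hx y hy hD
    simp at hc
  have step : ∀ {A B : Set ℂ} {u v : ℂ}, Theta J A B s u v →
      Cuts (fun K => ∀ x ∈ inside K, ∀ y ∈ inside K, ¬ D x y) (A ∪ s) := by
    intro A B u v ht
    refine ih ((F.erase s).filter fun c => Crosscut (A ∪ s) c).card ?_ _ _ rfl ht.isJordan_left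
      ?_ ?_ ?_
    · rw [← hn]
      exact (Finset.card_filter_le _ _).trans_lt (Finset.card_erase_lt_of_mem hs)
    · intro c hc
      exact (Finset.mem_filter.1 hc).2
    · intro c hc d hd hcd
      refine (hdisj c ?_ d ?_ hcd).mono (inter_subset_inter_right _ ht.inside_left_subset)
        (inter_subset_inter_right _ ht.inside_left_subset)
      · exact Finset.mem_of_mem_erase (Finset.mem_filter.1 hc).1
      · exact Finset.mem_of_mem_erase (Finset.mem_filter.1 hd).1
    · intro x hx y hy hD
      obtain ⟨c, hc, hcs⟩ := hsep x (ht.inside_left_subset hx) y (ht.inside_left_subset hy) hD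
      have hne : c ≠ s := by
        rintro rfl
        exact hcs _ ht.isJordan_left.isPreconnected_inside (fun z hz =>
          ⟨ht.inside_left_subset hz, fun hzB => hz.1 (Or.inr hzB)⟩) hx hy
      obtain ⟨h1, h2⟩ := ht.crosscut_left (hF c hc) (hdisj c hc s hs hne) hx hy hcs
      exact ⟨c, Finset.mem_filter.2 ⟨Finset.mem_erase.2 ⟨hne, hc⟩, h1⟩, h2⟩
  obtain ⟨A, B, u, v, ht⟩ := hJ.theta (hF s hs)
  exact .node ht (step ht) (step ht.swap)

/-- Close points of a simple closed curve bound a small arc of it. -/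
theorem IsJordan.exists_modulus {X : Type*} [PseudoMetricSpace X] [T2Space X] {J : Set X}
    (hJ : IsJordan J) {η : ℝ} (hη : 0 < η) :
    ∃ δ > 0, ∀ u ∈ J, ∀ v ∈ J, u ≠ v → dist u v < δ → ∃ A B, JordanSplit J A B u v ∧
      A ⊆ ball u η := by
  have key : ∀ p : J, ∃ A B u v, JordanSplit J A B u v ∧ (p : X) ∈ A ∧ (p : X) ≠ u ∧
      (p : X) ≠ v ∧ A ⊆ ball (p : X) (η / 2) := fun p =>
    hJ.split_near p.2 (ball_mem_nhds _ (by positivity))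
  choose A B a b hs hp ha hb hA using key
  obtain ⟨δ, hδ, hL⟩ := lebesgue_number_lemma_of_metric (c := fun p : J => (B p)ᶜ) hJ.isCompact
    (fun p => (hs p).right.isCompact.isClosed.isOpen_compl) (by
      intro z hz
      refine mem_iUnion.2 ⟨⟨z, hz⟩, fun h => ?_⟩
      have : z ∈ A ⟨z, hz⟩ ∩ B ⟨z, hz⟩ := ⟨hp _, h⟩
      rw [(hs _).inter] at this
      rcases this with h | h
      · exact ha ⟨z, hz⟩ h
      · exact hb ⟨z, hz⟩ h)
  refine ⟨δ, hδ, fun u hu v hv huv hd => ?_⟩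
  obtain ⟨p, hpB⟩ := hL u hu
  have hmem : ∀ z ∈ J, z ∈ ball u δ → z ∈ A p := fun z hz hzb => by
    rw [← (hs p).union] at hz
    exact hz.resolve_right (hpB hzb)
  have huA := hmem u hu (mem_ball_self hδ)
  have hvA := hmem v hv (by rwa [mem_ball, dist_comm])
  obtain ⟨A', B', h', hsub⟩ := (hs p).split_subset huA hvA huv
  refine ⟨A', B', h', fun z hz => ?_⟩
  have h1 := mem_ball.1 (hA p (hsub hz))
  have h2 := mem_ball.1 (hA p huA)
  rw [mem_ball]
  calc dist z u ≤ dist z p + dist u p := dist_triangle_right _ _ _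
    _ < η := by linarith

end Whitney

namespace Whitney
open Set Filter Topology Metric

theorem exists_maximal_Ioo {S : Set ℝ} (hS : IsOpen S) (hb : Bornology.IsBounded S) {t : ℝ}
    (ht : t ∈ S) : ∃ a b, a < t ∧ t < b ∧ Ioo a b ⊆ S ∧ a ∉ S ∧ b ∉ S := by
  obtain ⟨R, hR⟩ := hb.subset_ball 0
  have hR' : ∀ s, R ≤ |s| → s ∉ S := fun s hs h => by
    have := hR h
    rw [mem_ball_zero_iff, Real.norm_eq_abs] at this
    linarith
  have hcl : IsClosed (Sᶜ ∩ Ici t) := hS.isClosed_compl.inter isClosed_Ici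
  have hcl' : IsClosed (Sᶜ ∩ Iic t) := hS.isClosed_compl.inter isClosed_Iic
  have hne : (Sᶜ ∩ Ici t).Nonempty := by
    refine ⟨max t |R|, hR' _ ?_, mem_Ici.2 (le_max_left _ _)⟩
    exact (le_abs_self R).trans ((le_max_right t _).trans (le_abs_self _))
  have hne' : (Sᶜ ∩ Iic t).Nonempty := by
    refine ⟨min t (-|R|), hR' _ ?_, mem_Iic.2 (min_le_left _ _)⟩
    have := min_le_right t (-|R|)
    exact (le_abs_self R).trans (le_trans (by linarith) (neg_le_abs _))
  have hbb : BddBelow (Sᶜ ∩ Ici t) := ⟨t, fun s hs => hs.2⟩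
  have hba : BddAbove (Sᶜ ∩ Iic t) := ⟨t, fun s hs => hs.2⟩
  obtain ⟨h1, h2⟩ := hcl.csInf_mem hne hbb
  obtain ⟨h3, h4⟩ := hcl'.csSup_mem hne' hba
  refine ⟨sSup (Sᶜ ∩ Iic t), sInf (Sᶜ ∩ Ici t), lt_of_le_of_ne h4 ?_, lt_of_le_of_ne h2 ?_, ?_,
    h3, h1⟩
  · intro h; rw [h] at h3; exact h3 ht
  · intro h; rw [← h] at h1; exact h1 ht
  · intro s hs
    by_contra hn
    rcases le_total t s with h | h
    · exact absurd (csInf_le hbb ⟨hn, h⟩) (not_le.2 hs.2)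
    · exact absurd (le_csSup hba ⟨hn, h⟩) (not_le.2 hs.1)

/-- The part of the `k`-th line, in the coordinates `e`, between the heights `a` and `b`. -/
def lineSeg (e : ℂ ≃L[ℝ] ℝ × ℝ) (k a b : ℝ) : Set ℂ := (fun t => e.symm (k, t)) '' Icc a b

/-- The segment `lineSeg e k a b` is a crosscut of `J`. -/
structure IsCut (e : ℂ ≃L[ℝ] ℝ × ℝ) (J : Set ℂ) (k a b : ℝ) : Prop where
  lt : a < b
  inside : ∀ t ∈ Ioo a b, e.symm (k, t) ∈ inside J
  left : e.symm (k, a) ∈ J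
  right : e.symm (k, b) ∈ J

variable {e : ℂ ≃L[ℝ] ℝ × ℝ} {J : Set ℂ} {k a b : ℝ}

theorem mem_lineSeg {z : ℂ} : z ∈ lineSeg e k a b ↔ (e z).1 = k ∧ (e z).2 ∈ Icc a b := by
  constructor
  · rintro ⟨t, ht, rfl⟩
    simpa using ht
  · rintro ⟨h1, h2⟩
    exact ⟨_, h2, by simp [← h1]⟩

theorem arc_lineSeg (h : a < b) : Arc (lineSeg e k a b) (e.symm (k, a)) (e.symm (k, b)) := by
  refine arc_of_Icc h (by fun_prop) fun s _ t _ hst => ?_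
  simpa using hst

theorem IsCut.diff_subset (h : IsCut e J k a b) :
    lineSeg e k a b \ {e.symm (k, a), e.symm (k, b)} ⊆ Whitney.inside J := by
  rintro _ ⟨⟨t, ht, rfl⟩, hn⟩
  refine h.inside t ⟨lt_of_le_of_ne ht.1 ?_, lt_of_le_of_ne ht.2 ?_⟩
  · rintro rfl; exact hn (Or.inl rfl)
  · rintro rfl; exact hn (Or.inr rfl)

theorem IsCut.crosscut (h : IsCut e J k a b) : Crosscut J (lineSeg e k a b) :=
  ⟨_, _, h.left, h.right, arc_lineSeg h.lt, h.diff_subset⟩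

theorem IsCut.mem_Ioo (h : IsCut e J k a b) {z : ℂ} (hz : z ∈ lineSeg e k a b)
    (hzJ : z ∈ Whitney.inside J) : (e z).2 ∈ Ioo a b := by
  obtain ⟨t, ht, rfl⟩ := hz
  simp only [ContinuousLinearEquiv.apply_symm_apply]
  refine ⟨lt_of_le_of_ne ht.1 ?_, lt_of_le_of_ne ht.2 ?_⟩
  · rintro rfl; exact hzJ.1 h.left
  · rintro rfl; exact hzJ.1 h.right

theorem IsCut.eq_of_mem (h : IsCut e J k a b) {k' a' b' : ℝ} (h' : IsCut e J k' a' b') {z : ℂ}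
    (hz : z ∈ lineSeg e k a b) (hz' : z ∈ lineSeg e k' a' b') (hzJ : z ∈ Whitney.inside J) :
    k = k' ∧ a = a' ∧ b = b' := by
  have hk : k = k' := (mem_lineSeg.1 hz).1.symm.trans (mem_lineSeg.1 hz').1
  subst hk
  have h1 := h.mem_Ioo hz hzJ
  have h2 := h'.mem_Ioo hz' hzJ
  have key : ∀ {a b a' b' : ℝ}, IsCut e J k a b → IsCut e J k a' b' → (e z).2 ∈ Ioo a b →
      (e z).2 ∈ Ioo a' b' → a' ≤ a ∧ b ≤ b' := by
    intro a b a' b' h h' h1 h2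
    constructor
    · by_contra! hlt
      exact (h.inside a' ⟨hlt, h2.1.trans h1.2⟩).1 h'.left
    · by_contra! hlt
      exact (h.inside b' ⟨h1.1.trans h2.2, hlt⟩).1 h'.right
  obtain ⟨h3, h4⟩ := key h h' h1 h2
  obtain ⟨h5, h6⟩ := key h' h h2 h1
  exact ⟨rfl, le_antisymm h5 h3, le_antisymm h4 h6⟩

theorem exists_isCut (e : ℂ ≃L[ℝ] ℝ × ℝ) (hJ : IsJordan J) {q : ℂ} (hq : q ∈ inside J) :
    ∃ a b, IsCut e J (e q).1 a b ∧ (e q).2 ∈ Ioo a b := by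
  have hL : Continuous fun t : ℝ => e.symm ((e q).1, t) := by fun_prop
  have ho : IsOpen ((fun t : ℝ => e.symm ((e q).1, t)) ⁻¹' inside J) :=
    (isOpen_inside hJ.isCompact.isClosed).preimage hL
  have hbd : Bornology.IsBounded ((fun t : ℝ => e.symm ((e q).1, t)) ⁻¹' inside J) := by
    obtain ⟨R, hR⟩ := (isBounded_inside hJ.isCompact).subset_closedBall 0
    refine (isBounded_closedBall (x := (0 : ℝ)) (r := ‖(e : ℂ →L[ℝ] ℝ × ℝ)‖ * R)).subset
      fun t ht => ?_
    have h1 := mem_closedBall_zero_iff.1 (hR ht)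
    have h2 := (e : ℂ →L[ℝ] ℝ × ℝ).le_opNorm_of_le h1
    simp only [ContinuousLinearEquiv.coe_coe, ContinuousLinearEquiv.apply_symm_apply] at h2
    exact mem_closedBall_zero_iff.2 ((norm_snd_le _).trans h2)
  obtain ⟨a, b, ha, hb, hsub, han, hbn⟩ := exists_maximal_Ioo ho hbd
    (t := (e q).2) (by simpa using hq)
  have hcl : ∀ t ∈ Icc a b, e.symm ((e q).1, t) ∈ inside J ∪ J := by
    intro t ht
    rw [← hJ.closure_inside, ← closure_Ioo (ha.trans hb).ne] at *
    exact map_mem_closure (f := fun t : ℝ => e.symm ((e q).1, t)) hL ht hsub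
  exact ⟨a, b, ⟨ha.trans hb, fun t ht => hsub ht,
    (hcl a (left_mem_Icc.2 (ha.trans hb).le)).resolve_left han,
    (hcl b (right_mem_Icc.2 (ha.trans hb).le)).resolve_left hbn⟩, ha, hb⟩

theorem closure_halfPlane (e : ℂ ≃L[ℝ] ℝ × ℝ) (k : ℝ) :
    closure {z : ℂ | (e z).1 < k} = {z : ℂ | (e z).1 ≤ k} := by
  have ho : IsOpenMap fun z : ℂ => (e z).1 := isOpenMap_fst.comp e.toHomeomorph.isOpenMap
  have := ho.preimage_closure_eq_closure_preimage (by fun_prop) (Iio k)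
  rw [closure_Iio] at this
  exact this.symm

theorem convex_halfPlane (e : ℂ ≃L[ℝ] ℝ × ℝ) (k : ℝ) : Convex ℝ {z : ℂ | (e z).1 < k} :=
  convex_halfSpace_lt (f := fun z : ℂ => (e z).1)
    ((LinearMap.fst ℝ ℝ ℝ).comp (e : ℂ →ₗ[ℝ] ℝ × ℝ)).isLinear k

theorem convex_halfPlane_gt (e : ℂ ≃L[ℝ] ℝ × ℝ) (k : ℝ) : Convex ℝ {z : ℂ | k < (e z).1} :=
  convex_halfSpace_gt (f := fun z : ℂ => (e z).1)
    ((LinearMap.fst ℝ ℝ ℝ).comp (e : ℂ →ₗ[ℝ] ℝ × ℝ)).isLinear k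

theorem halfPlane_inter_subset_component {Ω W : Set ℂ} {x p : ℂ} (hW : IsOpen W)
    (hWc : Convex ℝ W) (hWΩ : W ⊆ Ω) (hp : p ∈ W)
    (hpU : p ∈ closure (connectedComponentIn (Ω ∩ {z | (e z).1 < k}) x)) :
    W ∩ {z | (e z).1 < k} ⊆ connectedComponentIn (Ω ∩ {z | (e z).1 < k}) x ∧
      W ∩ {z | (e z).1 ≤ k} ⊆ closure (connectedComponentIn (Ω ∩ {z | (e z).1 < k}) x) := by
  have h1 : W ∩ {z | (e z).1 < k} ⊆ connectedComponentIn (Ω ∩ {z | (e z).1 < k}) x := by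
    obtain ⟨z, hzW, hzU⟩ := mem_closure_iff.1 hpU W hW hp
    have hz := connectedComponentIn_subset _ _ hzU
    rw [connectedComponentIn_eq hzU]
    exact (hWc.inter (convex_halfPlane e k)).isPreconnected.subset_connectedComponentIn
      ⟨hzW, hz.2⟩ (inter_subset_inter_left _ hWΩ)
  refine ⟨h1, ?_⟩
  rw [← closure_halfPlane]
  exact hW.inter_closure.trans (closure_mono h1)

theorem exists_isCut_sepBy (e : ℂ ≃L[ℝ] ℝ × ℝ) (hJ : IsJordan J) {x y : ℂ} (hx : x ∈ inside J)
    (hy : y ∈ inside J) (hxk : (e x).1 < k) (hky : k < (e y).1) :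
    ∃ a b, IsCut e J k a b ∧ SepBy J (lineSeg e k a b) x y := by
  have hΩ := isOpen_inside hJ.isCompact.isClosed
  have he1 : Continuous fun z : ℂ => (e z).1 := by fun_prop
  have he2 : Continuous fun z : ℂ => (e z).2 := by fun_prop
  have hH : IsOpen {z : ℂ | (e z).1 < k} := isOpen_lt he1 continuous_const
  set U := connectedComponentIn (inside J ∩ {z | (e z).1 < k}) x with hU
  have hxU : x ∈ U := mem_connectedComponentIn ⟨hx, hxk⟩
  have hUsub : U ⊆ inside J ∩ {z | (e z).1 < k} := connectedComponentIn_subset _ _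
  have hclU : closure U ⊆ {z | (e z).1 ≤ k} := by
    rw [← closure_halfPlane]
    exact closure_mono (hUsub.trans inter_subset_right)
  have hpc : IsPathConnected (inside J) :=
    (hΩ.isConnected_iff_isPathConnected).1 ⟨hJ.inside_nonempty, hJ.isPreconnected_inside⟩
  obtain ⟨γ, hγ⟩ := hpc.joinedIn x hx y hy
  set f : ℝ → ℂ := fun t => γ.extend t with hf
  have hfc : Continuous f := γ.continuous_extend
  have hfΩ : ∀ t, f t ∈ inside J := by
    intro t
    have : f t ∈ range γ := by rw [← γ.extend_range]; exact mem_range_self t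
    obtain ⟨s, hs⟩ := this
    rw [← hs]; exact hγ s
  have hf0 : f 0 = x := γ.extend_zero
  have hf1 : f 1 = y := γ.extend_one
  have hT : IsCompact (Icc (0 : ℝ) 1 ∩ f ⁻¹' closure U) :=
    isCompact_Icc.inter_right (isClosed_closure.preimage hfc)
  obtain ⟨s, ⟨hs01, hsU⟩, hsmax⟩ := hT.exists_isGreatest
    ⟨0, by simp, by rw [mem_preimage, hf0]; exact subset_closure hxU⟩
  have hs1 : s < 1 := by
    refine lt_of_le_of_ne hs01.2 fun h => ?_
    have h1 := hclU hsU
    rw [h, hf1] at h1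
    exact absurd hky (not_lt.2 h1)
  have hafter : ∀ t, s < t → t ≤ 1 → f t ∉ closure U := fun t hst ht1 ht =>
    absurd (hsmax ⟨⟨hs01.1.trans hst.le, ht1⟩, ht⟩) (not_le.2 hst)
  have hnear : ∀ W : Set ℂ, IsOpen W → f s ∈ W → ∃ t, s < t ∧ t ≤ 1 ∧ f t ∈ W := by
    intro W hW hsW
    have h1 : ∀ᶠ t in 𝓝[>] s, f t ∈ W :=
      nhdsWithin_le_nhds (hfc.continuousAt.eventually_mem (hW.mem_nhds hsW))
    have h2 : ∀ᶠ t in 𝓝[>] s, t ∈ Ioo s 1 := Ioo_mem_nhdsGT hs1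
    obtain ⟨t, ht1, ht2⟩ := (h1.and h2).exists
    exact ⟨t, ht2.1, ht2.2.le, ht1⟩
  set p := f s with hp
  have hpΩ : p ∈ inside J := hfΩ s
  have hpk : (e p).1 = k := by
    refine le_antisymm (hclU hsU) ?_
    by_contra! hlt
    obtain ⟨r, hr, hb⟩ := Metric.isOpen_iff.1 (hΩ.inter hH) p ⟨hpΩ, hlt⟩
    obtain ⟨h1, -⟩ := halfPlane_inter_subset_component (e := e) (k := k) isOpen_ball
      (convex_ball p r) (hb.trans inter_subset_left) (mem_ball_self hr) hsU
    obtain ⟨t, hst, ht1, htb⟩ := hnear _ isOpen_ball (mem_ball_self hr)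
    exact hafter t hst ht1 (subset_closure (h1 ⟨htb, (hb htb).2⟩))
  obtain ⟨a, b, hcut, hpab⟩ := exists_isCut e hJ hpΩ
  rw [hpk] at hcut
  refine ⟨a, b, hcut, ?_⟩
  -- the open segment lies in the closure of `U`
  have hcU : ∀ z ∈ lineSeg e k a b, z ∈ inside J → z ∈ closure U := by
    intro z hz hzJ
    have hz' := hcut.mem_Ioo hz hzJ
    have hzk := (mem_lineSeg.1 hz).1
    have hsegE : ∀ w ∈ segment ℝ p z, w ∈ inside J := by
      intro w hw
      have hw1 : e w ∈ segment ℝ (e p) (e z) := by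
        rw [show segment ℝ (e p) (e z) = e '' segment ℝ p z from
          (image_segment ℝ (e : ℂ →ₗ[ℝ] ℝ × ℝ).toAffineMap p z).symm]
        exact mem_image_of_mem _ hw
      have hconv : Convex ℝ (({k} : Set ℝ) ×ˢ Ioo a b) := (convex_singleton k).prod (convex_Ioo a b)
      have hw2 := hconv.segment_subset (x := e p) (y := e z) ⟨hpk, hpab⟩ ⟨hzk, hz'⟩ hw1
      have := hcut.inside _ hw2.2
      rwa [← (show (e w).1 = k from hw2.1), Prod.mk.eta, e.symm_apply_apply] at this
    have hcomp : IsCompact (segment ℝ p z) := by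
      rw [segment_eq_image_lineMap]
      exact isCompact_Icc.image (by fun_prop)
    obtain ⟨r, hr, hsub⟩ := hcomp.exists_thickening_subset_open hΩ hsegE
    have hmem := self_subset_thickening hr (segment ℝ p z)
    obtain ⟨-, h2⟩ := halfPlane_inter_subset_component (e := e) (k := k) isOpen_thickening
      ((convex_segment p z).thickening r) hsub (hmem (left_mem_segment ℝ p z)) hsU
    exact h2 ⟨hmem (right_mem_segment ℝ p z), hzk.le⟩
  -- a small disc about `p`
  obtain ⟨r, hr, hball⟩ := Metric.isOpen_iff.1 (hΩ.inter (isOpen_Ioo.preimage he2)) p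
    ⟨hpΩ, hpab⟩
  obtain ⟨hDm, hDm'⟩ := halfPlane_inter_subset_component (e := e) (k := k) isOpen_ball
    (convex_ball p r) (hball.trans inter_subset_left) (mem_ball_self hr) hsU
  obtain ⟨t, hst, ht1, htb⟩ := hnear _ isOpen_ball (mem_ball_self hr)
  have htk : k < (e (f t)).1 := by
    by_contra! hle
    exact hafter t hst ht1 (hDm' ⟨htb, hle⟩)
  have hpc : p ∈ lineSeg e k a b := mem_lineSeg.2 ⟨hpk, Ioo_subset_Icc_self hpab⟩
  obtain ⟨A, B, hAB⟩ := hJ.split hcut.left hcut.right (arc_lineSeg hcut.lt).ne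
  have main : ∀ {A B : Set ℂ}, Theta J A B (lineSeg e k a b) (e.symm (k, a)) (e.symm (k, b)) →
      x ∈ inside (A ∪ lineSeg e k a b) → y ∈ inside (B ∪ lineSeg e k a b) := by
    intro A B ht hxA
    have hUP : U ⊆ inside (A ∪ lineSeg e k a b) := by
      have hsub : U ⊆ inside J \ lineSeg e k a b := fun z hz =>
        ⟨(hUsub hz).1, fun h => (hUsub hz).2.ne (mem_lineSeg.1 h).1⟩
      rcases ht.subset_or isPreconnected_connectedComponentIn hsub with h | h
      · exact h
      · exact absurd (h hxU) (disjoint_left.1 ht.disjoint hxA)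
    obtain ⟨w, hwb, hwB⟩ := mem_closure_iff.1 (ht.isJordan_right.subset_closure_inside
      (Or.inr hpc)) _ isOpen_ball (mem_ball_self hr)
    have hwk : k < (e w).1 := by
      by_contra! hle
      rcases hle.lt_or_eq with h | h
      · exact disjoint_left.1 ht.disjoint (hUP (hDm ⟨hwb, h⟩)) hwB
      · exact hwB.1 (Or.inr (mem_lineSeg.2 ⟨h, Ioo_subset_Icc_self (hball hwb).2⟩))
    have hD : ball p r ∩ {z | k < (e z).1} ⊆ inside (B ∪ lineSeg e k a b) := by
      rcases ht.subset_or (S := ball p r ∩ {z | k < (e z).1})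
        ((convex_ball p r).inter (convex_halfPlane_gt e k)).isPreconnected (fun z hz =>
          ⟨(hball hz.1).1, fun h => (show k < (e z).1 from hz.2).ne' (mem_lineSeg.1 h).1⟩) with h | h
      · exact absurd hwB (disjoint_left.1 ht.disjoint (h ⟨hwb, hwk⟩))
      · exact h
    have hpath : f '' Icc t 1 ⊆ inside J \ lineSeg e k a b := by
      rintro _ ⟨τ, hτ, rfl⟩
      exact ⟨hfΩ τ, fun h => hafter τ (hst.trans_le hτ.1) hτ.2 (hcU _ h (hfΩ τ))⟩
    rcases ht.subset_or (isPreconnected_Icc.image f hfc.continuousOn) hpath with h | h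
    · exact absurd (hD ⟨htb, htk⟩) (disjoint_left.1 ht.disjoint (h ⟨t, ⟨le_rfl, ht1⟩, rfl⟩))
    · exact h ⟨1, ⟨ht1, le_rfl⟩, hf1⟩
  have ht : Theta J A B (lineSeg e k a b) (e.symm (k, a)) (e.symm (k, b)) :=
    ⟨hAB, arc_lineSeg hcut.lt, hcut.diff_subset⟩
  intro S hS hSJ hxS hyS
  rcases ht.subset_or hS hSJ with h | h
  · exact disjoint_left.1 ht.disjoint (h hyS) (main ht (h hxS))
  · exact disjoint_left.1 ht.disjoint (main ht.swap (h hxS)) (h hyS)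

/-- Coordinates that do not increase distances along each axis. -/
structure Axes (e : ℂ ≃L[ℝ] ℝ × ℝ) : Prop where
  fst_le : ∀ z, |(e z).1| ≤ ‖z‖
  symm_le : ∀ t, ‖e.symm (0, t)‖ ≤ |t|

theorem Axes.dist_le (he : Axes e) (k s t : ℝ) :
    dist (e.symm (k, s)) (e.symm (k, t)) ≤ |s - t| := by
  rw [dist_eq_norm, ← map_sub]
  simpa using he.symm_le (s - t)

theorem length_le_of_sepBy (he : Axes e) (hJ : IsJordan J) {η : ℝ} (hη : 0 < η) :
    ∃ δ > 0, ∀ k a b x y, IsCut e J k a b → x ∈ inside J → y ∈ inside J →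
      SepBy J (lineSeg e k a b) x y → η < |(e x).1 - k| → η < |(e y).1 - k| → δ ≤ b - a := by
  obtain ⟨δ, hδ, h⟩ := hJ.exists_modulus hη
  refine ⟨min δ η, lt_min hδ hη, fun k a b x y hcut hx hy hsep hxk hyk => ?_⟩
  by_contra! hlt
  have hd : ∀ t ∈ Icc a b, dist (e.symm (k, t)) (e.symm (k, a)) ≤ b - a := fun t ht =>
    (he.dist_le k t a).trans (by rw [abs_of_nonneg (by linarith [ht.1])]; linarith [ht.2])
  obtain ⟨A, B, hs, hA⟩ := h _ hcut.left _ hcut.right (arc_lineSeg hcut.lt).ne (by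
    rw [dist_comm]
    exact (hd b (right_mem_Icc.2 hcut.lt.le)).trans_lt (hlt.trans_le (min_le_left _ _)))
  have ht : Theta J A B (lineSeg e k a b) (e.symm (k, a)) (e.symm (k, b)) :=
    ⟨hs, arc_lineSeg hcut.lt, hcut.diff_subset⟩
  have hsub : A ∪ lineSeg e k a b ⊆ closedBall (e.symm (k, a)) η := by
    refine union_subset (hA.trans ball_subset_closedBall) ?_
    rintro _ ⟨t, ht, rfl⟩
    exact (hd t ht).trans (hlt.le.trans (min_le_right _ _))
  have hfar : ∀ z, z ∈ inside J → η < |(e z).1 - k| → z ∈ inside (B ∪ lineSeg e k a b) := by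
    intro z hz hzk
    have h1 : z ∈ inside J \ lineSeg e k a b := ⟨hz, fun h => by
      rw [(mem_lineSeg.1 h).1] at hzk
      simp at hzk
      linarith⟩
    rw [ht.inside_diff] at h1
    refine h1.resolve_left fun h => ?_
    have h2 := mem_closedBall.1 (inside_subset_closedBall hsub h)
    have h3 := he.fst_le (z - e.symm (k, a))
    rw [← dist_eq_norm] at h3
    simp only [map_sub, ContinuousLinearEquiv.apply_symm_apply, Prod.fst_sub] at h3
    linarith
  exact hsep _ ht.isJordan_right.isPreconnected_inside
    (fun z hz => ⟨ht.inside_right_subset hz, fun h => hz.1 (Or.inr h)⟩) (hfar x hx hxk)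
    (hfar y hy hyk)

theorem finite_grid (e : ℂ ≃L[ℝ] ℝ × ℝ) {Ω : Set ℂ} (hΩ : Bornology.IsBounded Ω) {α β : ℝ}
    (hα : 0 < α) (hβ : 0 < β) :
    {z ∈ Ω | ∃ j i : ℤ, e z = (j * α, i * β)}.Finite := by
  obtain ⟨R, hR⟩ := hΩ.subset_closedBall 0
  set M := ‖(e : ℂ →L[ℝ] ℝ × ℝ)‖ * R
  have key : ∀ {α : ℝ} {j : ℤ}, 0 < α → |j * α| ≤ M → j ∈ Icc (-⌈M / α⌉) ⌈M / α⌉ := by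
    intro α j hα h
    rw [mem_Icc, ← abs_le]
    have h1 : |(j : ℝ)| ≤ M / α := by
      rw [le_div_iff₀ hα]
      rwa [abs_mul, abs_of_pos hα] at h
    have h2 := h1.trans (Int.le_ceil _)
    exact_mod_cast h2
  refine (((finite_Icc (-⌈M / α⌉) ⌈M / α⌉).prod (finite_Icc (-⌈M / β⌉) ⌈M / β⌉)).image
    fun q : ℤ × ℤ => e.symm ((q.1 : ℝ) * α, (q.2 : ℝ) * β)).subset ?_
  rintro z ⟨hz, j, i, hji⟩
  have h2 : ‖e z‖ ≤ M :=
    (e : ℂ →L[ℝ] ℝ × ℝ).le_opNorm_of_le (mem_closedBall_zero_iff.1 (hR hz))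
  rw [hji] at h2
  refine ⟨(j, i), ⟨key hα ((norm_fst_le _).trans h2), key hβ ((norm_snd_le _).trans h2)⟩, ?_⟩
  simp only
  rw [← hji, e.symm_apply_apply]

theorem cuts_fst (he : Axes e) (hJ : IsJordan J) {ε : ℝ} (hε : 0 < ε) :
    Cuts (fun K => ∀ x ∈ inside K, ∀ y ∈ inside K, ¬ ε < |(e x).1 - (e y).1|) J := by
  have hη : 0 < ε / 4 := by positivity
  obtain ⟨δ, hδ, hlen⟩ := length_le_of_sepBy he hJ hη
  have hδ2 : 0 < δ / 2 := by positivity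
  set 𝓕 : Set (Set ℂ) := {c | ∃ k a b, IsCut e J k a b ∧ c = lineSeg e k a b ∧
    (∃ j : ℤ, k = j * (ε / 4)) ∧ δ ≤ b - a} with h𝓕
  have hfin : 𝓕.Finite := by
    have hg := finite_grid e (isBounded_inside hJ.isCompact) hη hδ2
    choose! a b hab using fun q (hq : q ∈ inside J) => exists_isCut e hJ hq
    refine (hg.image fun q => lineSeg e (e q).1 (a q) (b q)).subset ?_
    rintro _ ⟨k, a', b', hcut, rfl, ⟨j, rfl⟩, hl⟩
    set i : ℤ := ⌊a' / (δ / 2)⌋ + 1 with hi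
    have h1 : a' < i * (δ / 2) := by
      rw [← div_lt_iff₀ hδ2, hi]; push_cast; exact Int.lt_floor_add_one _
    have h2 : (i : ℝ) * (δ / 2) ≤ a' + δ / 2 := by
      have := Int.floor_le (a' / (δ / 2))
      rw [le_div_iff₀ hδ2] at this
      rw [hi]; push_cast; linarith
    have hq := hcut.inside (i * (δ / 2)) ⟨h1, by linarith⟩
    refine ⟨_, ⟨hq, j, i, e.apply_symm_apply _⟩, ?_⟩
    obtain ⟨h3, h4⟩ := hab _ hq
    obtain ⟨h5, h6, h7⟩ := hcut.eq_of_mem h3 (z := e.symm (j * (ε / 4), i * (δ / 2)))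
      (mem_lineSeg.2 (by simp only [ContinuousLinearEquiv.apply_symm_apply]
                         exact ⟨trivial, h1.le, by linarith⟩))
      (mem_lineSeg.2 ⟨rfl, Ioo_subset_Icc_self h4⟩) hq
    simp only
    rw [← h5, ← h6, ← h7]
  refine cuts_of_family _ _ J hfin.toFinset rfl hJ ?_ ?_ ?_
  · intro c hc
    obtain ⟨k, a, b, hcut, rfl, -⟩ := hfin.mem_toFinset.1 hc
    exact hcut.crosscut
  · intro c hc d hd hcd
    obtain ⟨k, a, b, hcut, rfl, -⟩ := hfin.mem_toFinset.1 hc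
    obtain ⟨k', a', b', hcut', rfl, -⟩ := hfin.mem_toFinset.1 hd
    refine disjoint_left.2 fun z hz hz' => hcd ?_
    obtain ⟨rfl, rfl, rfl⟩ := hcut.eq_of_mem hcut' hz.1 hz'.1 hz.2
    rfl
  · have key : ∀ x ∈ inside J, ∀ y ∈ inside J, ε < (e y).1 - (e x).1 →
        ∃ c ∈ hfin.toFinset, SepBy J c x y := by
      intro x hx y hy hD
      set j : ℤ := ⌊(e x).1 / (ε / 4)⌋ + 2 with hj
      have h1 : (e x).1 + ε / 4 < j * (ε / 4) := by
        have := Int.lt_floor_add_one ((e x).1 / (ε / 4))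
        rw [div_lt_iff₀ hη] at this
        rw [hj]; push_cast; linarith
      have h2 : (j : ℝ) * (ε / 4) ≤ (e x).1 + 2 * (ε / 4) := by
        have := Int.floor_le ((e x).1 / (ε / 4))
        rw [le_div_iff₀ hη] at this
        rw [hj]; push_cast; linarith
      obtain ⟨a, b, hcut, hsep⟩ := exists_isCut_sepBy e hJ hx hy (k := j * (ε / 4))
        (by linarith) (by linarith)
      refine ⟨_, hfin.mem_toFinset.2 ⟨_, a, b, hcut, rfl, ⟨j, rfl⟩, ?_⟩, hsep⟩
      refine hlen _ a b x y hcut hx hy hsep ?_ ?_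
      · rw [abs_of_neg (by linarith)]; linarith
      · rw [abs_of_pos (by linarith)]; linarith
    intro x hx y hy hD
    rcases lt_abs.1 hD with h | h
    · obtain ⟨c, hc, hs⟩ := key y hy x hx h
      exact ⟨c, hc, hs.symm⟩
    · exact key x hx y hy (by linarith)

/-- A Jordan domain can be cut by finitely many crosscuts into arbitrarily small ones. -/
theorem cuts_dist {J : Set ℂ} (hJ : IsJordan J) {ε : ℝ} (hε : 0 < ε) :
    Cuts (fun K => ∀ x ∈ inside K, ∀ y ∈ inside K, dist x y ≤ ε) J := by
  have e1 : Axes Complex.equivRealProdCLM :=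
    ⟨fun z => by simpa using Complex.abs_re_le_norm z, fun t => by
      simp [Complex.equivRealProdCLM_symm_apply]⟩
  have e2 : Axes (Complex.equivRealProdCLM.trans (ContinuousLinearEquiv.prodComm ℝ ℝ ℝ)) :=
    ⟨fun z => by simpa using Complex.abs_im_le_norm z, fun t => by
      simp [Complex.equivRealProdCLM_symm_apply]⟩
  have hε2 : 0 < ε / 2 := by positivity
  refine (cuts_fst e1 hJ hε2).bind fun K hK _ h1 => (cuts_fst e2 hK hε2).imp
    fun L hL hLK h2 x hx y hy => ?_
  have h3 := not_lt.1 (h1 x (hLK hx) y (hLK hy))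
  have h4 := not_lt.1 (h2 x hx y hy)
  simp at h3 h4
  rw [dist_eq_norm]
  refine (Complex.norm_le_abs_re_add_abs_im _).trans ?_
  simp only [Complex.sub_re, Complex.sub_im]
  linarith

end Whitney

namespace Whitney
open Set Filter Topology Metric

theorem exists_gap {C : Set ℝ} (hC : IsClosed C) {s₀ m t₀ : ℝ} (hs₀ : s₀ ∈ C) (ht₀ : t₀ ∈ C)
    (h1 : s₀ < m) (h2 : m < t₀) (hm : m ∉ C) :
    ∃ s ∈ C, ∃ t ∈ C, s₀ ≤ s ∧ s < m ∧ m < t ∧ t ≤ t₀ ∧ Ioo s t ∩ C = ∅ := by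
  obtain ⟨a, b, ha, hb, hsub, han, hbn⟩ := exists_maximal_Ioo (S := Cᶜ ∩ Ioo s₀ t₀)
    (hC.isOpen_compl.inter isOpen_Ioo) (isBounded_Ioo _ _ |>.subset inter_subset_right)
    ⟨hm, h1, h2⟩
  have h3 : Ioo a b ⊆ Ioo s₀ t₀ := hsub.trans inter_subset_right
  obtain ⟨h4, h5⟩ := (Ioo_subset_Ioo_iff (ha.trans hb)).1 h3
  refine ⟨a, ?_, b, ?_, h4, ha, hb, h5, ?_⟩
  · rcases h4.eq_or_lt with rfl | h
    · exact hs₀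
    · by_contra hn; exact han ⟨hn, h, ha.trans h2⟩
  · rcases h5.eq_or_lt with rfl | h
    · exact ht₀
    · by_contra hn; exact hbn ⟨hn, h1.trans hb, h⟩
  · exact eq_empty_of_forall_notMem fun z hz => (hsub hz.1).1 hz.2

section PathToArc
variable {X : Type*} {f : ℝ → X}

/-- A closed set of times such that skipping its gaps leaves a path. -/
structure Skip (f : ℝ → X) (C : Set ℝ) : Prop where
  closed : IsClosed C
  subset : C ⊆ Icc 0 1
  zero : (0 : ℝ) ∈ C
  one : (1 : ℝ) ∈ C
  gap : ∀ s ∈ C, ∀ t ∈ C, s < t → Ioo s t ∩ C = ∅ → f s = f t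

theorem exists_minimal_skip [MetricSpace X] (hf : ContinuousOn f (Icc 0 1)) : ∃ C, Minimal (Skip f) C := by
  refine zorn_superset {C | Skip f C} fun c hc hchain => ?_
  rcases c.eq_empty_or_nonempty with rfl | ⟨C₀, hC₀⟩
  · refine ⟨Icc 0 1, ⟨isClosed_Icc, Subset.rfl, by simp, by simp, fun s hs t ht hst h => ?_⟩,
      by simp⟩
    exact absurd h (Nonempty.ne_empty ⟨(s + t) / 2, ⟨by linarith, by linarith⟩,
      by linarith [hs.1, ht.1], by linarith [hs.2, ht.2]⟩)
  refine ⟨⋂₀ c, ⟨isClosed_sInter fun C hC => (hc hC).closed,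
    (sInter_subset_of_mem hC₀).trans (hc hC₀).subset, fun C hC => (hc hC).zero,
    fun C hC => (hc hC).one, fun s hs t ht hst hgap => ?_⟩, fun C hC => sInter_subset_of_mem hC⟩
  by_contra hne
  have hd : 0 < dist (f s) (f t) / 2 := by
    have := dist_pos.2 hne
    positivity
  have hs01 := (hc hC₀).subset (hs _ hC₀)
  have ht01 := (hc hC₀).subset (ht _ hC₀)
  obtain ⟨δ₁, hδ₁, h1⟩ := Metric.continuousOn_iff.1 hf s hs01 _ hd
  obtain ⟨δ₂, hδ₂, h2⟩ := Metric.continuousOn_iff.1 hf t ht01 _ hd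
  obtain ⟨δ, hδ, hδ1, hδ2, hδ3⟩ : ∃ δ > 0, δ < δ₁ ∧ δ < δ₂ ∧ δ < (t - s) / 2 := by
    obtain ⟨δ, hδ, h⟩ := exists_between (show 0 < min δ₁ (min δ₂ ((t - s) / 2)) from
      lt_min hδ₁ (lt_min hδ₂ (by linarith)))
    simp only [lt_min_iff] at h
    exact ⟨δ, hδ, h⟩
  have : Nonempty c := ⟨⟨C₀, hC₀⟩⟩
  obtain ⟨⟨C, hC⟩, hCe⟩ := (isCompact_Icc (a := s + δ) (b := t - δ)).elim_directed_family_closed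
    (fun C : c => (C : Set ℝ)) (fun C => (hc C.2).closed) (by
      refine eq_empty_of_forall_notMem fun z hz => ?_
      have : z ∈ Ioo s t ∩ ⋂₀ c := ⟨⟨by linarith [hz.1.1], by linarith [hz.1.2]⟩, by
        rw [sInter_eq_iInter]; exact hz.2⟩
      rw [hgap] at this; exact this) (by
      rintro ⟨C, hC⟩ ⟨C', hC'⟩
      rcases hchain.total hC hC' with h | h
      · exact ⟨⟨C, hC⟩, Subset.rfl, h⟩
      · exact ⟨⟨C', hC'⟩, h, Subset.rfl⟩)
  have hnot : ∀ r ∈ C, s + δ ≤ r → r ≤ t - δ → False := fun r hr h3 h4 => by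
    have : r ∈ Icc (s + δ) (t - δ) ∩ C := ⟨⟨h3, h4⟩, hr⟩
    rw [show Icc (s + δ) (t - δ) ∩ C = ∅ from hCe] at this
    exact this
  obtain ⟨s', hs', t', ht', h3, h4, h5, h6, h7⟩ := exists_gap (hc hC).closed (hs _ hC) (ht _ hC)
    (m := (s + t) / 2) (by linarith) (by linarith)
    fun h => hnot _ h (by linarith) (by linarith)
  have h8 : s' < s + δ := by
    by_contra! h; exact hnot _ hs' h (by linarith)
  have h9 : t - δ < t' := by
    by_contra! h; exact hnot _ ht' (by linarith) h
  have h10 := (hc hC).gap s' hs' t' ht' (by linarith) h7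
  have h11 := h1 s' ((hc hC).subset hs') (by rw [Real.dist_eq, abs_lt]; constructor <;> linarith)
  have h12 := h2 t' ((hc hC).subset ht') (by rw [Real.dist_eq, abs_lt]; constructor <;> linarith)
  rw [dist_comm] at h11
  rw [← h10] at h12
  linarith [dist_triangle (f s) (f s') (f t)]

theorem gap_of_minimal_skip {C : Set ℝ} (hC : Minimal (Skip f) C) {s t : ℝ} (hs : s ∈ C)
    (ht : t ∈ C) (h : f s = f t) : Ioo s t ∩ C = ∅ := by
  have hS := hC.prop
  have hsk : Skip f (C \ Ioo s t) := by
    refine ⟨hS.closed.sdiff isOpen_Ioo, sdiff_subset.trans hS.subset,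
      ⟨hS.zero, fun h => absurd h.1 (not_lt.2 (hS.subset hs).1)⟩,
      ⟨hS.one, fun h => absurd h.2 (not_lt.2 (hS.subset ht).2)⟩, fun a ha b hb hab hgap => ?_⟩
    have hout : ∀ r ∈ C, a < r → r < b → s < r ∧ r < t := fun r hr h1 h2 => by
      by_contra hn
      have : r ∈ Ioo a b ∩ (C \ Ioo s t) := ⟨⟨h1, h2⟩, hr, hn⟩
      rw [hgap] at this; exact this
    by_cases hne : Ioo a b ∩ C = ∅
    · exact hS.gap a ha.1 b hb.1 hab hne
    · obtain ⟨r, hr, hrC⟩ := nonempty_iff_ne_empty.2 hne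
      have h1 := hout r hrC hr.1 hr.2
      have has : a = s := by
        rcases lt_trichotomy a s with h | h | h
        · exact absurd (hout s hs h (h1.1.trans hr.2)).1 (lt_irrefl _)
        · exact h
        · exact absurd ⟨h, hr.1.trans h1.2⟩ ha.2
      have hbt : b = t := by
        rcases lt_trichotomy b t with h | h | h
        · exact absurd ⟨h1.1.trans hr.2, h⟩ hb.2
        · exact h
        · exact absurd (hout t ht (hr.1.trans h1.2) h).2 (lt_irrefl _)
      rw [has, hbt, h]
  have := hC.le_of_le hsk sdiff_subset
  exact eq_empty_of_forall_notMem fun z hz => (this hz.2).2 hz.1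

/-- The running supremum of `g` along `C`. -/
def runSup (C : Set ℝ) (g : ℝ → ℝ) (s : ℝ) : ℝ := sSup (g '' (C ∩ Iic s))

theorem continuousOn_runSup {C : Set ℝ} (hC : IsCompact C) {g : ℝ → ℝ} (hg : ContinuousOn g C) :
    ContinuousOn (runSup C g) C := by
  have hbdd : ∀ s, BddAbove (g '' (C ∩ Iic s)) := fun s =>
    (hC.bddAbove_image hg).mono (image_mono inter_subset_left)
  refine Metric.continuousOn_iff.2 fun s hs ε hε => ?_
  have hu := hC.uniformContinuousOn_of_continuous hg
  rw [Metric.uniformContinuousOn_iff] at hu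
  obtain ⟨δ, hδ, h⟩ := hu (ε / 2) (by positivity)
  refine ⟨δ, hδ, fun t ht htd => ?_⟩
  have key : ∀ s ∈ C, ∀ t ∈ C, dist t s < δ → runSup C g t ≤ runSup C g s + ε / 2 := by
    intro s hs t ht hd
    refine csSup_le ⟨_, mem_image_of_mem _ ⟨ht, self_mem_Iic⟩⟩ ?_
    rintro _ ⟨r, ⟨hr, hrt⟩, rfl⟩
    rcases le_total r s with h1 | h1
    · have := le_csSup (hbdd s) (mem_image_of_mem g ⟨hr, h1⟩)
      unfold runSup; linarith
    · have h2 := le_csSup (hbdd s) (mem_image_of_mem g ⟨hs, self_mem_Iic⟩)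
      have hrt : r ≤ t := hrt
      have h3 := h r hr s hs (by
        rw [Real.dist_eq, abs_lt] at *; constructor <;> linarith)
      rw [Real.dist_eq, abs_lt] at h3
      unfold runSup; linarith
  have h1 := key s hs t ht htd
  have h2 := key t ht s hs (by rwa [dist_comm])
  rw [Real.dist_eq, abs_lt]
  constructor <;> linarith

theorem runSup_mem {C : Set ℝ} {g : ℝ → ℝ} (hg : ∀ r ∈ C, g r ∈ Icc (-1) 0) {s : ℝ}
    (hs : s ∈ C) : runSup C g s ∈ Icc (-1 : ℝ) 0 := by
  have hbdd : BddAbove (g '' (C ∩ Iic s)) :=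
    ⟨0, by rintro _ ⟨r, hr, rfl⟩; exact (hg r hr.1).2⟩
  refine ⟨(hg s hs).1.trans (le_csSup hbdd ⟨s, ⟨hs, self_mem_Iic⟩, rfl⟩),
    csSup_le ⟨_, ⟨s, ⟨hs, self_mem_Iic⟩, rfl⟩⟩ ?_⟩
  rintro _ ⟨r, hr, rfl⟩; exact (hg r hr.1).2

theorem runSup_mono {C : Set ℝ} {g : ℝ → ℝ} (hg : ∀ r ∈ C, g r ∈ Icc (-1) 0) {s t : ℝ}
    (hs : s ∈ C) (hst : s ≤ t) : runSup C g s ≤ runSup C g t := by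
  refine csSup_le_csSup ⟨0, by rintro _ ⟨r, hr, rfl⟩; exact (hg r hr.1).2⟩
    ⟨_, ⟨s, ⟨hs, self_mem_Iic⟩, rfl⟩⟩ (image_mono fun r hr => ⟨hr.1, le_trans hr.2 hst⟩)

/-- A path with distinct ends contains an arc with the same ends. -/
theorem exists_arc_of_path [MetricSpace X] [TopologicalSpace.SeparableSpace X] (hf : ContinuousOn f (Icc 0 1))
    (hne : f 0 ≠ f 1) : ∃ A ⊆ f '' Icc 0 1, Arc A (f 0) (f 1) := by
  obtain ⟨C, hC⟩ := exists_minimal_skip hf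
  have hS := hC.prop
  have hCc : IsCompact C := isCompact_Icc.of_isClosed_subset hS.closed hS.subset
  have hfC := hf.mono hS.subset
  have : Nonempty X := ⟨f 0⟩
  set d := TopologicalSpace.denseSeq X
  set g : ℕ → ℝ → ℝ := fun n r => -min 1 (dist (f r) (d n)) with hgdef
  have hg : ∀ n, ∀ r ∈ C, g n r ∈ Icc (-1 : ℝ) 0 := fun n r _ => by
    refine ⟨neg_le_neg (min_le_left _ _), neg_nonpos.2 (le_min zero_le_one dist_nonneg)⟩
  have hgc : ∀ n, ContinuousOn (g n) C := fun n =>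
    (show Continuous fun x => -min 1 (dist x (d n)) by fun_prop).comp_continuousOn hfC
  set L : ℝ → ℝ := fun s => ∑' n, (1 / 2 : ℝ) ^ n * runSup C (g n) s with hL
  have hsum2 : Summable fun n : ℕ => (1 / 2 : ℝ) ^ n := summable_geometric_two
  have hbound : ∀ n, ∀ s ∈ C, ‖(1 / 2 : ℝ) ^ n * runSup C (g n) s‖ ≤ (1 / 2 : ℝ) ^ n := by
    intro n s hs
    have := runSup_mem (hg n) hs
    rw [norm_mul, Real.norm_eq_abs, Real.norm_eq_abs, abs_of_pos (by positivity)]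
    exact mul_le_of_le_one_right (by positivity) (abs_le.2 ⟨this.1, by linarith [this.2]⟩)
  have hsum : ∀ s ∈ C, Summable fun n => (1 / 2 : ℝ) ^ n * runSup C (g n) s := fun s hs =>
    Summable.of_norm_bounded hsum2 fun n => hbound n s hs
  have hLc : ContinuousOn L C := continuousOn_tsum
    (fun n => continuousOn_const.mul (continuousOn_runSup hCc (hgc n))) hsum2 hbound
  have hmonoT : ∀ s ∈ C, ∀ t ∈ C, s ≤ t → ∀ n,
      (1 / 2 : ℝ) ^ n * runSup C (g n) s ≤ (1 / 2 : ℝ) ^ n * runSup C (g n) t :=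
    fun s hs t ht hst n => mul_le_mul_of_nonneg_left (runSup_mono (hg n) hs hst) (by positivity)
  have hLmono : ∀ s ∈ C, ∀ t ∈ C, s ≤ t → L s ≤ L t := fun s hs t ht hst =>
    Summable.tsum_le_tsum (hmonoT s hs t ht hst) (hsum s hs) (hsum t ht)
  have hLlt : ∀ s ∈ C, ∀ t ∈ C, s < t → f s ≠ f t → L s < L t := by
    intro s hs t ht hst hne
    have hnot : f t ∉ f '' (C ∩ Iic s) := by
      rintro ⟨r, ⟨hr, hrs⟩, hrt⟩
      have hrs : r ≤ s := hrs
      have hg := gap_of_minimal_skip hC hr ht hrt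
      rcases hrs.eq_or_lt with rfl | hlt
      · exact hne hrt
      · have : s ∈ Ioo r t ∩ C := ⟨⟨hlt, hst⟩, hs⟩
        rw [hg] at this; exact this
    have hK : IsClosed (f '' (C ∩ Iic s)) :=
      ((hCc.inter_right isClosed_Iic).image_of_continuousOn (hfC.mono inter_subset_left)).isClosed
    obtain ⟨ρ, hρ, hball⟩ := Metric.isOpen_iff.1 hK.isOpen_compl _ hnot
    set η := min (ρ / 2) 1 with hη
    have hηpos : 0 < η := lt_min (by positivity) one_pos
    obtain ⟨n, hn⟩ := (TopologicalSpace.denseRange_denseSeq X).exists_dist_lt (f t) hηpos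
    refine Summable.tsum_lt_tsum (i := n) (hmonoT s hs t ht hst.le) ?_ (hsum s hs) (hsum t ht)
    refine mul_lt_mul_of_pos_left ?_ (by positivity)
    have h1 : runSup C (g n) s ≤ -η := by
      refine csSup_le ⟨_, ⟨s, ⟨hs, self_mem_Iic⟩, rfl⟩⟩ ?_
      rintro _ ⟨r, hr, rfl⟩
      refine neg_le_neg (le_min (min_le_right _ _) ?_)
      have h2 : ρ ≤ dist (f r) (f t) := by
        by_contra! h
        exact hball h ⟨r, hr, rfl⟩
      have h3 := dist_triangle (f r) (d n) (f t)
      rw [dist_comm (d n)] at h3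
      have h4 : η ≤ ρ / 2 := min_le_left _ _
      linarith
    have h5 : g n t ≤ runSup C (g n) t :=
      le_csSup ⟨0, by rintro _ ⟨r, hr, rfl⟩; exact (hg n r hr.1).2⟩ ⟨t, ⟨ht, self_mem_Iic⟩, rfl⟩
    have h6 : -η < g n t := neg_lt_neg ((min_le_right _ _).trans_lt hn)
    linarith
  have hLeq : ∀ s ∈ C, ∀ t ∈ C, s < t → f s = f t → L s = L t := by
    intro s hs t ht hst hfe
    have hg' := gap_of_minimal_skip hC hs ht hfe
    simp only [hL]
    congr 1
    ext n
    congr 1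
    refine le_antisymm (runSup_mono (hg n) hs hst.le) (csSup_le ⟨_, ⟨t, ⟨ht, self_mem_Iic⟩, rfl⟩⟩ ?_)
    rintro _ ⟨r, ⟨hr, hrt⟩, rfl⟩
    have hbdd : BddAbove (g n '' (C ∩ Iic s)) :=
      ⟨0, by rintro _ ⟨r, hr, rfl⟩; exact (hg n r hr.1).2⟩
    rcases le_or_gt r s with h | h
    · exact le_csSup hbdd ⟨r, ⟨hr, h⟩, rfl⟩
    · rcases (show r ≤ t from hrt).eq_or_lt with rfl | h'
      · rw [show g n r = g n s by simp only [hgdef, hfe]]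
        exact le_csSup hbdd ⟨s, ⟨hs, self_mem_Iic⟩, rfl⟩
      · have : r ∈ Ioo s t ∩ C := ⟨⟨h, h'⟩, hr⟩
        rw [hg'] at this; exact this.elim
  have hiff : ∀ s ∈ C, ∀ t ∈ C, (L s = L t ↔ f s = f t) := by
    intro s hs t ht
    rcases lt_trichotomy s t with h | rfl | h
    · exact ⟨fun h' => by_contra fun hn => (hLlt s hs t ht h hn).ne h', hLeq s hs t ht h⟩
    · simp
    · exact ⟨fun h' => by_contra fun hn => (hLlt t ht s hs h (Ne.symm hn)).ne h'.symm,
        fun h' => (hLeq t ht s hs h h'.symm).symm⟩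
  have h01 : L 0 < L 1 := hLlt 0 hS.zero 1 hS.one one_pos hne
  have himg : L '' C = Icc (L 0) (L 1) := by
    refine Subset.antisymm ?_ fun y hy => ?_
    · rintro _ ⟨s, hs, rfl⟩
      exact ⟨hLmono 0 hS.zero s hs (hS.subset hs).1, hLmono s hs 1 hS.one (hS.subset hs).2⟩
    · by_contra hn
      have hLcl : IsClosed (L '' C) := (hCc.image_of_continuousOn hLc).isClosed
      have hne0 : L 0 ≠ y := fun h => hn ⟨0, hS.zero, h⟩
      have hne1 : L 1 ≠ y := fun h => hn ⟨1, hS.one, h⟩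
      have hK0 : IsCompact (C ∩ L ⁻¹' Iic y) :=
        hCc.of_isClosed_subset (hLc.preimage_isClosed_of_isClosed hS.closed isClosed_Iic)
          inter_subset_left
      have hK1 : IsCompact (C ∩ L ⁻¹' Ici y) :=
        hCc.of_isClosed_subset (hLc.preimage_isClosed_of_isClosed hS.closed isClosed_Ici)
          inter_subset_left
      obtain ⟨s, ⟨hsC, hsy⟩, hsmax⟩ := hK0.exists_isGreatest ⟨0, hS.zero, hy.1⟩
      obtain ⟨t, ⟨htC, hty⟩, htmin⟩ := hK1.exists_isLeast ⟨1, hS.one, hy.2⟩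
      have hsy' : L s < y := lt_of_le_of_ne hsy fun h => hn ⟨s, hsC, h⟩
      have hty' : y < L t := lt_of_le_of_ne hty fun h => hn ⟨t, htC, h.symm⟩
      have hst : s < t := by
        by_contra! h
        linarith [hLmono t htC s hsC h]
      have := hLeq s hsC t htC hst (hS.gap s hsC t htC hst
        (eq_empty_of_forall_notMem fun r hr => by
          rcases le_total (L r) y with h | h
          · exact absurd (hsmax ⟨hr.2, h⟩) (not_le.2 hr.1.1)
          · exact absurd (htmin ⟨hr.2, h⟩) (not_le.2 hr.1.2)))
      linarith
  set G : ℝ → X := fun y => f (Function.invFunOn L C y) with hG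
  have hGL : ∀ s ∈ C, G (L s) = f s := fun s hs => by
    have h1 : L s ∈ L '' C := ⟨s, hs, rfl⟩
    exact (hiff _ (Function.invFunOn_mem h1) s hs).1 (Function.invFunOn_eq h1)
  have hGc : ContinuousOn G (Icc (L 0) (L 1)) := by
    rw [← himg]
    exact continuousOn_image_of_comp hCc hLc (hfC.congr fun s hs => hGL s hs)
  have hGi : InjOn G (Icc (L 0) (L 1)) := by
    rw [← himg]
    rintro _ ⟨s, hs, rfl⟩ _ ⟨t, ht, rfl⟩ h
    rw [hGL s hs, hGL t ht] at h
    exact (hiff s hs t ht).2 h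
  have harc := arc_of_Icc h01 hGc hGi
  rw [hGL 0 hS.zero, hGL 1 hS.one] at harc
  refine ⟨_, ?_, harc⟩
  rw [← himg]
  rintro _ ⟨_, ⟨s, hs, rfl⟩, rfl⟩
  exact ⟨s, hS.subset hs, (hGL s hs).symm⟩

end PathToArc
end Whitney

namespace Whitney
open Set Filter Topology Metric

theorem Cuts.exists_mem {P : Set ℂ → Prop} {J : Set ℂ} (h : Cuts P J) {b : ℂ} (hb : b ∈ J) :
    ∃ K, IsJordan K ∧ P K ∧ inside K ⊆ inside J ∧ b ∈ K := by
  induction h with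
  | leaf hJ hP => exact ⟨_, hJ, hP, Subset.rfl, hb⟩
  | node ht _ _ ih1 ih2 =>
    rw [← ht.split.union] at hb
    rcases hb with hb | hb
    · obtain ⟨K, h1, h2, h3, h4⟩ := ih1 (Or.inl hb)
      exact ⟨K, h1, h2, h3.trans ht.inside_left_subset, h4⟩
    · obtain ⟨K, h1, h2, h3, h4⟩ := ih2 (Or.inl hb)
      exact ⟨K, h1, h2, h3.trans ht.inside_right_subset, h4⟩

theorem exists_concat {X : Type*} [TopologicalSpace X] {γ : ℕ → ℝ → X}
    (hγ : ∀ n, Continuous (γ n)) (h : ∀ n, γ n 1 = γ (n + 1) 0) :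
    ∃ F : ℝ → X, ContinuousOn F (Ici 0) ∧ ∀ n : ℕ, ∀ t ∈ Icc (n : ℝ) (n + 1), F t = γ n (t - n) := by
  set F : ℝ → X := fun t => γ ⌊t⌋₊ (t - ⌊t⌋₊) with hF
  have hFn : ∀ n : ℕ, ∀ t ∈ Icc (n : ℝ) (n + 1), F t = γ n (t - n) := by
    intro n t ht
    rcases ht.2.eq_or_lt with rfl | hlt
    · have : ⌊(n : ℝ) + 1⌋₊ = n + 1 := by
        rw [Nat.floor_add_one (by positivity), Nat.floor_natCast]
      simp only [hF, this]
      push_cast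
      simp [h n]
    · have : ⌊t⌋₊ = n := (Nat.floor_eq_iff (le_trans (by positivity) ht.1)).2 ⟨ht.1, hlt⟩
      simp only [hF, this]
  have hc : ∀ n : ℕ, ContinuousOn F (Icc 0 n) := by
    intro n
    induction n with
    | zero => simp
    | succ n ih =>
      rw [← Icc_union_Icc_eq_Icc (b := (n : ℝ)) (by positivity) (by push_cast; linarith)]
      refine ih.union_of_isClosed ?_ isClosed_Icc isClosed_Icc
      have : ContinuousOn (fun t : ℝ => γ n (t - n)) (Icc n (n + 1 : ℕ)) :=
        ((hγ n).comp (continuous_id.sub continuous_const)).continuousOn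
      exact this.congr fun t ht => hFn n t (by push_cast at ht; exact ht)
  refine ⟨F, fun t ht => ?_, hFn⟩
  obtain ⟨n, hn⟩ := exists_nat_gt t
  refine (hc n t ⟨ht, hn.le⟩).mono_of_mem_nhdsWithin ?_
  filter_upwards [self_mem_nhdsWithin, mem_nhdsWithin_of_mem_nhds (Iio_mem_nhds hn)] with s h1 h2
  exact ⟨h1, le_of_lt h2⟩

/-- Every boundary point of a Jordan domain is accessible. -/
theorem IsJordan.accessible {J : Set ℂ} (hJ : IsJordan J) {x b : ℂ} (hx : x ∈ inside J)
    (hb : b ∈ J) : ∃ f : ℝ → ℂ, ContinuousOn f (Icc 0 1) ∧ f 0 = x ∧ f 1 = b ∧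
      ∀ t ∈ Ico (0 : ℝ) 1, f t ∈ inside J := by
  have step : ∀ (n : ℕ) (K : {K : Set ℂ // IsJordan K ∧ b ∈ K}),
      ∃ K' : {K : Set ℂ // IsJordan K ∧ b ∈ K}, inside K'.1 ⊆ inside K.1 ∧
        ∀ x ∈ inside K'.1, ∀ y ∈ inside K'.1, dist x y ≤ 1 / ((n : ℝ) + 1) := by
    rintro n ⟨K, hK, hbK⟩
    obtain ⟨K', h1, h2, h3, h4⟩ := (cuts_dist hK (ε := 1 / ((n : ℝ) + 1)) (by positivity)).exists_mem hbK
    exact ⟨⟨K', h1, h4⟩, h3, h2⟩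
  choose g hg1 hg2 using step
  let K : ℕ → {K : Set ℂ // IsJordan K ∧ b ∈ K} := fun n => Nat.rec ⟨J, hJ, hb⟩ (fun n k => g n k) n
  have hK1 : ∀ n, inside (K (n + 1)).1 ⊆ inside (K n).1 := fun n => hg1 n (K n)
  have hK2 : ∀ n, ∀ x ∈ inside (K (n + 1)).1, ∀ y ∈ inside (K (n + 1)).1,
    dist x y ≤ 1 / ((n : ℝ) + 1) := fun n => hg2 n (K n)
  have hanti : Antitone fun n => inside (K n).1 := antitone_nat_of_succ_le hK1
  have hbd : ∀ n, ∀ z ∈ inside (K (n + 1)).1, dist z b ≤ 1 / ((n : ℝ) + 1) := by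
    intro n z hz
    have hcl : b ∈ closure (inside (K (n + 1)).1) :=
      (K (n + 1)).2.1.subset_closure_inside (K (n + 1)).2.2
    have : closure (inside (K (n + 1)).1) ⊆ closedBall z (1 / ((n : ℝ) + 1)) :=
      closure_minimal (fun w hw => hK2 n w hw z hz) isClosed_closedBall
    rw [dist_comm]
    exact this hcl
  have hpt : ∀ n : ℕ, ∃ p, p ∈ inside (K n).1 ∧ (n = 0 → p = x) := by
    intro n
    rcases n with _ | n
    · exact ⟨x, hx, fun _ => rfl⟩
    · obtain ⟨p, hp⟩ := (K (n + 1)).2.1.inside_nonempty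
      exact ⟨p, hp, by simp⟩
  choose p hp hp0 using hpt
  have hγ : ∀ n, ∃ γ : ℝ → ℂ, Continuous γ ∧ γ 0 = p n ∧ γ 1 = p (n + 1) ∧
      ∀ t, γ t ∈ inside (K n).1 := by
    intro n
    have hpc : IsPathConnected (inside (K n).1) :=
      ((isOpen_inside (K n).2.1.isCompact.isClosed).isConnected_iff_isPathConnected).1
        ⟨(K n).2.1.inside_nonempty, (K n).2.1.isPreconnected_inside⟩
    obtain ⟨γ, hγ⟩ := hpc.joinedIn _ (hp n) _ (hK1 n (hp (n + 1)))
    refine ⟨fun t => γ.extend t, γ.continuous_extend, γ.extend_zero, γ.extend_one, fun t => ?_⟩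
    have : γ.extend t ∈ range γ := by rw [← γ.extend_range]; exact mem_range_self t
    obtain ⟨s, hs⟩ := this
    simp only [← hs]; exact hγ s
  choose γ hγc hγ0 hγ1 hγm using hγ
  obtain ⟨F, hFc, hF⟩ := exists_concat hγc fun n => (hγ1 n).trans (hγ0 (n + 1)).symm
  have hFm : ∀ n : ℕ, ∀ t : ℝ, (n : ℝ) ≤ t → F t ∈ inside (K n).1 := by
    intro n t ht
    have ht0 : 0 ≤ t := le_trans (by positivity) ht
    rw [hF ⌊t⌋₊ t ⟨Nat.floor_le ht0, (Nat.lt_floor_add_one t).le⟩]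
    exact hanti (Nat.le_floor ht) (hγm _ _)
  have hq : ∀ s ∈ Ico (0 : ℝ) 1, 0 ≤ s / (1 - s) := fun s hs =>
    div_nonneg hs.1 (by linarith [hs.2])
  refine ⟨fun s => if s = 1 then b else F (s / (1 - s)), ?_, ?_, by simp, ?_⟩
  · intro s hs
    rcases hs.2.eq_or_lt with rfl | hs1
    · rw [Metric.continuousWithinAt_iff]
      intro ε hε
      obtain ⟨n, hn⟩ := exists_nat_one_div_lt hε
      refine ⟨1 / ((n : ℝ) + 2), by positivity, fun {r} hr hrd => ?_⟩
      simp only [if_true]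
      split_ifs with h
      · simpa using hε
      · have hr1 : r < 1 := lt_of_le_of_ne hr.2 h
        have h1 : 1 - r < 1 / ((n : ℝ) + 2) := by
          rw [Real.dist_eq, abs_lt] at hrd; linarith
        have h2 : ((n + 1 : ℕ) : ℝ) ≤ r / (1 - r) := by
          rw [le_div_iff₀ (by linarith)]
          rw [lt_div_iff₀ (by positivity)] at h1
          push_cast
          nlinarith
        exact (hbd n _ (hFm (n + 1) _ h2)).trans_lt hn
    · have h1 : ContinuousWithinAt (fun s : ℝ => F (s / (1 - s))) (Ico 0 1) s := by
        refine (hFc _ (hq s ⟨hs.1, hs1⟩)).comp (t := Ici 0) ?_ fun r hr => hq r hr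
        exact (continuousAt_id.div (continuousAt_const.sub continuousAt_id)
          (sub_ne_zero.2 hs1.ne')).continuousWithinAt
      have h2 : ContinuousWithinAt (fun s : ℝ => F (s / (1 - s))) (Icc 0 1) s := by
        refine h1.mono_of_mem_nhdsWithin ?_
        filter_upwards [self_mem_nhdsWithin, mem_nhdsWithin_of_mem_nhds (Iio_mem_nhds hs1)]
          with r h3 h4
        exact ⟨h3.1, h4⟩
      refine h2.congr_of_eventuallyEq ?_ (by simp [hs1.ne])
      filter_upwards [mem_nhdsWithin_of_mem_nhds (Iio_mem_nhds hs1)] with r hr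
      simp [(show r < 1 from hr).ne]
  · have := hF 0 0 (by simp)
    simp [this, hγ0, hp0]
  · intro t ht
    simp only [ht.2.ne, if_false]
    exact hFm 0 _ (by simpa using hq t ht)

/-- Any two points of a simple closed curve are joined by a crosscut. -/
theorem IsJordan.exists_crosscut {J : Set ℂ} (hJ : IsJordan J) {u v : ℂ} (hu : u ∈ J)
    (hv : v ∈ J) (huv : u ≠ v) : ∃ c, Arc c u v ∧ c \ {u, v} ⊆ inside J := by
  obtain ⟨x, hx⟩ := hJ.inside_nonempty
  obtain ⟨f, hf, hf0, hf1, hfm⟩ := hJ.accessible hx hu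
  obtain ⟨g, hg, hg0, hg1, hgm⟩ := hJ.accessible hx hv
  set k : ℝ → ℂ := fun t => if t ≤ 1 / 2 then f (1 - 2 * t) else g (2 * t - 1) with hk
  have hkc : ContinuousOn k (Icc 0 1) := by
    rw [← Icc_union_Icc_eq_Icc (a := (0 : ℝ)) (b := 1 / 2) (c := 1) (by norm_num) (by norm_num)]
    refine ContinuousOn.union_of_isClosed ?_ ?_ isClosed_Icc isClosed_Icc
    · refine ContinuousOn.congr (f := fun t => f (1 - 2 * t)) ?_ fun t ht => if_pos ht.2
      refine hf.comp (by fun_prop) fun t ht => ⟨by linarith [ht.2], by linarith [ht.1]⟩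
    · refine ContinuousOn.congr (f := fun t => g (2 * t - 1)) ?_ fun t ht => ?_
      · refine hg.comp (by fun_prop) fun t ht => ⟨by linarith [ht.1], by linarith [ht.2]⟩
      · simp only [hk]
        split_ifs with h
        · have : t = 1 / 2 := le_antisymm h ht.1
          subst this
          norm_num [hf0, hg0]
        · rfl
  have hk0 : k 0 = u := by simp [hk, hf1]
  have hk1 : k 1 = v := by
    simp only [hk]
    rw [if_neg (by norm_num)]
    norm_num [hg1]
  obtain ⟨A, hA, harc⟩ := exists_arc_of_path hkc (by rwa [hk0, hk1])
  rw [hk0, hk1] at harc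
  refine ⟨A, harc, fun z hz => ?_⟩
  obtain ⟨t, ht, rfl⟩ := hA hz.1
  have ht0 : t ≠ 0 := by rintro rfl; exact hz.2 (Or.inl hk0)
  have ht1 : t ≠ 1 := by rintro rfl; exact hz.2 (Or.inr hk1)
  have ht0' := lt_of_le_of_ne ht.1 (Ne.symm ht0)
  have ht1' := lt_of_le_of_ne ht.2 ht1
  simp only [hk]
  split_ifs with h
  · exact hfm _ ⟨by linarith, by linarith⟩
  · exact hgm _ ⟨by linarith, by linarith⟩

end Whitney

namespace Whitney
open Set Filter Topology Metric

/-- The sets `T γ`, `γ ∈ 𝒞`, are simple closed curves whose interior domains tile that of `J`. -/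
structure Tiles {ι : Type*} (J : Set ℂ) (𝒞 : Set ι) (T : ι → Set ℂ) : Prop where
  jordan : ∀ γ ∈ 𝒞, IsJordan (T γ)
  subset : ∀ γ ∈ 𝒞, inside (T γ) ⊆ inside J
  disjoint : ∀ γ ∈ 𝒞, ∀ δ ∈ 𝒞, γ ≠ δ → Disjoint (inside (T γ)) (inside (T δ) ∪ T δ)
  cover : ∀ x ∈ inside J, ∃ γ ∈ 𝒞, x ∈ inside (T γ) ∪ T γ

/-- A compact matching of two simple closed curves. -/
structure Cell (Γ : Set (ℂ × ℂ)) : Prop where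
  compact : IsCompact Γ
  fst : IsJordan (Prod.fst '' Γ)
  snd : IsJordan (Prod.snd '' Γ)
  inj : ∀ p ∈ Γ, ∀ q ∈ Γ, p.1 = q.1 ↔ p.2 = q.2

/-- Matched tilings of the two Jordan domains of a cell. -/
structure Subdiv (Γ : Set (ℂ × ℂ)) (𝒞 : Set (Set (ℂ × ℂ))) : Prop where
  finite : 𝒞.Finite
  compact : ∀ γ ∈ 𝒞, IsCompact γ
  compat : ∀ γ ∈ 𝒞, ∀ δ ∈ 𝒞, ∀ p ∈ γ, ∀ q ∈ δ, p.1 = q.1 ↔ p.2 = q.2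
  boundary : Γ ⊆ ⋃₀ 𝒞
  fst : Tiles (Prod.fst '' Γ) 𝒞 (fun γ => Prod.fst '' γ)
  snd : Tiles (Prod.snd '' Γ) 𝒞 (fun γ => Prod.snd '' γ)

theorem Tiles.closed_subset {ι : Type*} {J : Set ℂ} {𝒞 : Set ι} {T : ι → Set ℂ}
    (h : Tiles J 𝒞 T) (hJ : IsJordan J) {γ : ι} (hγ : γ ∈ 𝒞) :
    inside (T γ) ∪ T γ ⊆ inside J ∪ J := by
  rw [← hJ.closure_inside, ← (h.jordan γ hγ).closure_inside]
  exact closure_mono (h.subset γ hγ)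

theorem Tiles.mem_of_mem {ι : Type*} {J : Set ℂ} {𝒞 : Set ι} {T : ι → Set ℂ}
    (h : Tiles J 𝒞 T) {γ δ : ι} (hγ : γ ∈ 𝒞) (hδ : δ ∈ 𝒞) (hne : γ ≠ δ) {x : ℂ}
    (hx : x ∈ inside (T γ) ∪ T γ) (hx' : x ∈ inside (T δ) ∪ T δ) : x ∈ T γ :=
  hx.resolve_left fun h' => disjoint_left.1 (h.disjoint γ hγ δ hδ hne) h' hx'

theorem Cell.swap {Γ : Set (ℂ × ℂ)} (h : Cell Γ) : Cell (Prod.swap '' Γ) where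
  compact := h.compact.image continuous_swap
  fst := by rw [image_image]; exact h.snd
  snd := by rw [image_image]; exact h.fst
  inj := by
    rintro _ ⟨p, hp, rfl⟩ _ ⟨q, hq, rfl⟩
    exact (h.inj p hp q hq).symm

theorem Cell.exists_map {Γ : Set (ℂ × ℂ)} (h : Cell Γ) :
    ∃ f : ℂ → ℂ, ContinuousOn f (Prod.fst '' Γ) ∧ InjOn f (Prod.fst '' Γ) ∧
      (∀ p ∈ Γ, p.2 = f p.1) := by
  have : ∀ x, ∃ y, x ∈ Prod.fst '' Γ → (x, y) ∈ Γ := fun x => by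
    by_cases hx : x ∈ Prod.fst '' Γ
    · obtain ⟨p, hp, rfl⟩ := hx
      exact ⟨p.2, fun _ => hp⟩
    · exact ⟨0, fun h => absurd h hx⟩
  choose f hf using this
  have hfp : ∀ p ∈ Γ, p.2 = f p.1 := fun p hp =>
    (h.inj p hp (p.1, f p.1) (hf _ ⟨p, hp, rfl⟩)).1 rfl
  refine ⟨f, ?_, ?_, hfp⟩
  · exact continuousOn_image_of_comp h.compact continuous_fst.continuousOn
      (continuous_snd.continuousOn.congr fun p hp => (hfp p hp).symm)
  · rintro _ ⟨p, hp, rfl⟩ _ ⟨q, hq, rfl⟩ he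
    rw [← hfp p hp, ← hfp q hq] at he
    exact (h.inj p hp q hq).2 he

namespace Subdiv
variable {Γ : Set (ℂ × ℂ)} {𝒞 : Set (Set (ℂ × ℂ))}

theorem cell (h : Subdiv Γ 𝒞) {γ : Set (ℂ × ℂ)} (hγ : γ ∈ 𝒞) : Cell γ :=
  ⟨h.compact γ hγ, h.fst.jordan γ hγ, h.snd.jordan γ hγ, h.compat γ hγ γ hγ⟩

theorem refl (h : Cell Γ) : Subdiv Γ {Γ} := by
  have ht : ∀ {T : Set (ℂ × ℂ) → Set ℂ}, IsJordan (T Γ) → Tiles (T Γ) {Γ} T := fun hT =>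
    ⟨by rintro _ rfl; exact hT, by rintro _ rfl; exact Subset.rfl,
      by rintro _ rfl _ rfl hn; exact absurd rfl hn, fun x hx => ⟨Γ, rfl, Or.inl hx⟩⟩
  exact ⟨finite_singleton _, by rintro _ rfl; exact h.compact,
    by rintro _ rfl _ rfl; exact h.inj, by simp, ht (T := fun γ => Prod.fst '' γ) h.fst,
    ht (T := fun γ => Prod.snd '' γ) h.snd⟩

theorem swap (h : Subdiv Γ 𝒞) :
    Subdiv (Prod.swap '' Γ) ((fun γ => Prod.swap '' γ) '' 𝒞) := by
  have ht : ∀ {J : Set ℂ} {T T' : Set (ℂ × ℂ) → Set ℂ}, Tiles J 𝒞 T →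
      (∀ γ, T' (Prod.swap '' γ) = T γ) → Tiles J ((fun γ => Prod.swap '' γ) '' 𝒞) T' := by
    intro J T T' h hT
    refine ⟨?_, ?_, ?_, fun x hx => ?_⟩
    · rintro _ ⟨γ, hγ, rfl⟩; simp only [hT]; exact h.jordan γ hγ
    · rintro _ ⟨γ, hγ, rfl⟩; simp only [hT]; exact h.subset γ hγ
    · rintro _ ⟨γ, hγ, rfl⟩ _ ⟨δ, hδ, rfl⟩ hne
      simp only [hT]
      exact h.disjoint γ hγ δ hδ fun h => hne (by rw [h])
    · obtain ⟨γ, hγ, hx⟩ := h.cover x hx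
      exact ⟨_, ⟨γ, hγ, rfl⟩, by simp only [hT]; exact hx⟩
  refine ⟨h.finite.image _, ?_, ?_, ?_, ?_, ?_⟩
  · rintro _ ⟨γ, hγ, rfl⟩; exact (h.compact γ hγ).image continuous_swap
  · rintro _ ⟨γ, hγ, rfl⟩ _ ⟨δ, hδ, rfl⟩ _ ⟨p, hp, rfl⟩ _ ⟨q, hq, rfl⟩
    exact (h.compat γ hγ δ hδ p hp q hq).symm
  · rintro _ ⟨p, hp, rfl⟩
    obtain ⟨γ, hγ, hpγ⟩ := h.boundary hp
    exact ⟨_, ⟨γ, hγ, rfl⟩, p, hpγ, rfl⟩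
  · rw [image_image]; exact ht h.snd fun γ => by simp only [image_image]; rfl
  · rw [image_image]; exact ht h.fst fun γ => by simp only [image_image]; rfl

theorem of_swap (h : Subdiv (Prod.swap '' Γ) 𝒞) :
    Subdiv Γ ((fun γ => Prod.swap '' γ) '' 𝒞) := by
  have := h.swap
  rwa [image_image, show (fun x : ℂ × ℂ => x.swap.swap) = id from rfl, image_id] at this

/-- A point of a finer tile lying on the coarse curve belongs to the coarse matching. -/
theorem mem_of_fst (h : Subdiv Γ 𝒞) {γ : Set (ℂ × ℂ)} (hγ : γ ∈ 𝒞) {p : ℂ × ℂ} (hp : p ∈ γ)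
    (hpΓ : p.1 ∈ Prod.fst '' Γ) : p ∈ Γ := by
  obtain ⟨q, hq, hqp⟩ := hpΓ
  obtain ⟨δ, hδ, hqδ⟩ := h.boundary hq
  rwa [← Prod.ext hqp ((h.compat δ hδ γ hγ q hqδ p hp).1 hqp)]

theorem mem_of_snd (h : Subdiv Γ 𝒞) {γ : Set (ℂ × ℂ)} (hγ : γ ∈ 𝒞) {p : ℂ × ℂ} (hp : p ∈ γ)
    (hpΓ : p.2 ∈ Prod.snd '' Γ) : p ∈ Γ := by
  obtain ⟨q, hq, hqp⟩ := hpΓ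
  obtain ⟨δ, hδ, hqδ⟩ := h.boundary hq
  rwa [← Prod.ext ((h.compat δ hδ γ hγ q hqδ p hp).2 hqp) hqp]

theorem trans (h : Subdiv Γ 𝒞) {𝒟 : Set (ℂ × ℂ) → Set (Set (ℂ × ℂ))}
    (hD : ∀ γ ∈ 𝒞, Subdiv γ (𝒟 γ)) : Subdiv Γ (⋃ γ ∈ 𝒞, 𝒟 γ) := by
  have hb : ∀ γ ∈ 𝒞, ∀ p ∈ γ, ∃ δ ∈ ⋃ γ ∈ 𝒞, 𝒟 γ, p ∈ δ := by
    intro γ hγ p hp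
    obtain ⟨δ, hδ, hpδ⟩ := (hD γ hγ).boundary hp
    exact ⟨δ, mem_biUnion hγ hδ, hpδ⟩
  have ht : ∀ {J : Set ℂ} (f : ℂ × ℂ → ℂ), Tiles J 𝒞 (fun γ => f '' γ) →
      (∀ γ ∈ 𝒞, Tiles (f '' γ) (𝒟 γ) (fun γ => f '' γ)) →
      Tiles J (⋃ γ ∈ 𝒞, 𝒟 γ) (fun γ => f '' γ) := by
    intro J f h hD
    refine ⟨fun δ hδ => ?_, fun δ hδ => ?_, fun δ hδ δ' hδ' hne => ?_, fun x hx => ?_⟩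
    · obtain ⟨γ, hγ, hδ⟩ := mem_iUnion₂.1 hδ
      exact (hD γ hγ).jordan δ hδ
    · obtain ⟨γ, hγ, hδ⟩ := mem_iUnion₂.1 hδ
      exact ((hD γ hγ).subset δ hδ).trans (h.subset γ hγ)
    · obtain ⟨γ, hγ, hδ⟩ := mem_iUnion₂.1 hδ
      obtain ⟨γ', hγ', hδ'⟩ := mem_iUnion₂.1 hδ'
      by_cases hγγ : γ = γ'
      · subst hγγ
        exact (hD γ hγ).disjoint δ hδ δ' hδ' hne
      · exact (h.disjoint γ hγ γ' hγ' hγγ).mono ((hD γ hγ).subset δ hδ)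
          ((hD γ' hγ').closed_subset (h.jordan γ' hγ') hδ')
    · obtain ⟨γ, hγ, hx | ⟨p, hp, rfl⟩⟩ := h.cover x hx
      · obtain ⟨δ, hδ, hx⟩ := (hD γ hγ).cover x hx
        exact ⟨δ, mem_biUnion hγ hδ, hx⟩
      · obtain ⟨δ, hδ, hpδ⟩ := hb γ hγ p hp
        exact ⟨δ, hδ, Or.inr ⟨p, hpδ, rfl⟩⟩
  refine ⟨h.finite.biUnion fun γ hγ => (hD γ hγ).finite, ?_, ?_, ?_,
    ht _ h.fst fun γ hγ => (hD γ hγ).fst, ht _ h.snd fun γ hγ => (hD γ hγ).snd⟩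
  · intro δ hδ
    obtain ⟨γ, hγ, hδ⟩ := mem_iUnion₂.1 hδ
    exact (hD γ hγ).compact δ hδ
  · intro δ hδ δ' hδ' p hp q hq
    obtain ⟨γ, hγ, hδ⟩ := mem_iUnion₂.1 hδ
    obtain ⟨γ', hγ', hδ'⟩ := mem_iUnion₂.1 hδ'
    by_cases hγγ : γ = γ'
    · subst hγγ
      exact (hD γ hγ).compat δ hδ δ' hδ' p hp q hq
    have hp1 := (hD γ hγ).fst.closed_subset (h.fst.jordan γ hγ) hδ (Or.inr ⟨p, hp, rfl⟩)
    have hq1 := (hD γ' hγ').fst.closed_subset (h.fst.jordan γ' hγ') hδ' (Or.inr ⟨q, hq, rfl⟩)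
    have hp2 := (hD γ hγ).snd.closed_subset (h.snd.jordan γ hγ) hδ (Or.inr ⟨p, hp, rfl⟩)
    have hq2 := (hD γ' hγ').snd.closed_subset (h.snd.jordan γ' hγ') hδ' (Or.inr ⟨q, hq, rfl⟩)
    constructor
    · intro he
      have hpγ : p ∈ γ := (hD γ hγ).mem_of_fst hδ hp
        (h.fst.mem_of_mem hγ hγ' hγγ hp1 (by rw [he]; exact hq1))
      have hqγ : q ∈ γ' := (hD γ' hγ').mem_of_fst hδ' hq
        (h.fst.mem_of_mem hγ' hγ (Ne.symm hγγ) hq1 (by rw [← he]; exact hp1))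
      exact (h.compat γ hγ γ' hγ' p hpγ q hqγ).1 he
    · intro he
      have hpγ : p ∈ γ := (hD γ hγ).mem_of_snd hδ hp
        (h.snd.mem_of_mem hγ hγ' hγγ hp2 (by rw [he]; exact hq2))
      have hqγ : q ∈ γ' := (hD γ' hγ').mem_of_snd hδ' hq
        (h.snd.mem_of_mem hγ' hγ (Ne.symm hγγ) hq2 (by rw [← he]; exact hp2))
      exact (h.compat γ hγ γ' hγ' p hpγ q hqγ).2 he
  · intro p hp
    obtain ⟨γ, hγ, hpγ⟩ := h.boundary hp
    exact hb γ hγ p hpγ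

end Subdiv

theorem Theta.tiles {ι : Type*} {J A B c : Set ℂ} {u v : ℂ} (h : Theta J A B c u v)
    {T : ι → Set ℂ} {γ δ : ι} (h1 : T γ = A ∪ c) (h2 : T δ = B ∪ c) : Tiles J {γ, δ} T := by
  have hd : ∀ {A B : Set ℂ}, Theta J A B c u v →
      Disjoint (inside (A ∪ c)) (inside (B ∪ c) ∪ (B ∪ c)) := fun h =>
    h.disjoint.union_right (h.inside_left_disjoint.mono_right
      (union_subset_union_left _ h.split.right_subset))
  refine ⟨?_, ?_, ?_, fun x hx => ?_⟩
  · rintro _ (rfl | rfl)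
    · rw [h1]; exact h.isJordan_left
    · rw [h2]; exact h.isJordan_right
  · rintro _ (rfl | rfl)
    · rw [h1]; exact h.inside_left_subset
    · rw [h2]; exact h.inside_right_subset
  · rintro _ (rfl | rfl) _ (rfl | rfl) hne
    · exact absurd rfl hne
    · rw [h1, h2]; exact hd h
    · rw [h1, h2]; exact hd h.swap
    · exact absurd rfl hne
  · by_cases hxc : x ∈ c
    · exact ⟨γ, Or.inl rfl, by rw [h1]; exact Or.inr (Or.inr hxc)⟩
    · have : x ∈ inside J \ c := ⟨hx, hxc⟩
      rw [h.inside_diff] at this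
      rcases this with h' | h'
      · exact ⟨γ, Or.inl rfl, by rw [h1]; exact Or.inl h'⟩
      · exact ⟨δ, Or.inr rfl, by rw [h2]; exact Or.inl h'⟩

theorem Cell.theta {Γ : Set (ℂ × ℂ)} (hΓ : Cell Γ) {A B c : Set ℂ} {u v : ℂ}
    (h : Theta (Prod.fst '' Γ) A B c u v) :
    ∃ γ δ, Subdiv Γ {γ, δ} ∧ Prod.fst '' γ = A ∪ c ∧ Prod.fst '' δ = B ∪ c := by
  obtain ⟨g, hgc, hgi, hgΓ⟩ := hΓ.exists_map
  set J := Prod.fst '' Γ with hJ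
  have hJ' : Prod.snd '' Γ = g '' J := by
    rw [hJ, image_image]
    exact image_congr hgΓ
  have hs' := h.split.image hgc hgi
  have hsJ := hs'.isJordan
  obtain ⟨c', hc', hcs'⟩ := hsJ.exists_crosscut (hs'.left_subset hs'.left.left_mem)
    (hs'.left_subset hs'.left.right_mem) hs'.ne
  have h' : Theta (g '' J) (g '' A) (g '' B) c' (g u) (g v) := ⟨hs', hc', hcs'⟩
  obtain ⟨f, hfc, hfi, hf0, hf1, hfi'⟩ := h.arc
  obtain ⟨f', hfc', hfi'', hf0', hf1', hfim'⟩ := hc'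
  set G : Set (ℂ × ℂ) := (fun t => (f t, f' t)) '' Icc 0 1 with hG
  have hAJ := h.split.left_subset
  have hBJ := h.split.right_subset
  have fstG : Prod.fst '' G = c := by rw [hG, image_image]; exact hfi'
  have sndG : Prod.snd '' G = c' := by rw [hG, image_image]; exact hfim'
  have hGc : IsCompact G := isCompact_Icc.image_of_continuousOn (hfc.prodMk hfc')
  have fstA : ∀ S : Set ℂ, Prod.fst '' ((fun x => (x, g x)) '' S ∪ G) = S ∪ c := fun S => by
    rw [image_union, fstG, image_image]; simp
  have sndA : ∀ S : Set ℂ, Prod.snd '' ((fun x => (x, g x)) '' S ∪ G) = g '' S ∪ c' := fun S => by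
    rw [image_union, sndG, image_image]
  have hcpt : ∀ S ⊆ J, IsCompact S → IsCompact ((fun x => (x, g x)) '' S ∪ G) := fun S hS hSc =>
    (hSc.image_of_continuousOn (continuousOn_id.prodMk (hgc.mono hS))).union hGc
  have hmix : ∀ x ∈ J, ∀ t ∈ Icc (0 : ℝ) 1, (x = f t ↔ g x = f' t) := by
    intro x hx t ht
    have huJ : u ∈ J := hAJ h.split.left.left_mem
    have hvJ : v ∈ J := hAJ h.split.left.right_mem
    constructor
    · intro he
      rcases h.mem_ends (z := x) (by rw [← hfi', he]; exact ⟨t, ht, rfl⟩) hx with rfl | rfl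
      · rw [hfi ht (by simp) (he.symm.trans hf0.symm), hf0']
      · rw [hfi ht (by simp) (he.symm.trans hf1.symm), hf1']
    · intro he
      rcases h'.mem_ends (z := g x) (by rw [← hfim', he]; exact ⟨t, ht, rfl⟩) ⟨x, hx, rfl⟩
        with h1 | h1
      · rw [hfi'' ht (by simp) ((he.symm.trans h1).trans hf0'.symm), hf0]
        exact hgi hx huJ h1
      · rw [hfi'' ht (by simp) ((he.symm.trans h1).trans hf1'.symm), hf1]
        exact hgi hx hvJ h1
  have hcompat : ∀ p ∈ (fun x => (x, g x)) '' J ∪ G, ∀ q ∈ (fun x => (x, g x)) '' J ∪ G,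
      (p.1 = q.1 ↔ p.2 = q.2) := by
    rintro _ (⟨x, hx, rfl⟩ | ⟨s, hs, rfl⟩) _ (⟨y, hy, rfl⟩ | ⟨t, ht, rfl⟩)
    · exact ⟨fun h => congrArg g h, fun h => hgi hx hy h⟩
    · exact hmix x hx t ht
    · have := hmix y hy s hs
      exact ⟨fun h => (this.1 h.symm).symm, fun h => (this.2 h.symm).symm⟩
    · exact ⟨fun h => congrArg f' (hfi hs ht h), fun h => congrArg f (hfi'' hs ht h)⟩
  have hsub : ∀ S ⊆ J, (fun x => (x, g x)) '' S ∪ G ⊆ (fun x => (x, g x)) '' J ∪ G := fun S hS =>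
    union_subset_union_left _ (image_mono hS)
  refine ⟨(fun x => (x, g x)) '' A ∪ G, (fun x => (x, g x)) '' B ∪ G,
    ⟨by simp, ?_, ?_, ?_, h.tiles (fstA A) (fstA B), ?_⟩, fstA A, fstA B⟩
  · rintro _ (rfl | rfl)
    · exact hcpt A hAJ h.split.left.isCompact
    · exact hcpt B hBJ h.split.right.isCompact
  · rintro _ (rfl | rfl) _ (rfl | rfl) p hp q hq
    · exact hcompat p (hsub A hAJ hp) q (hsub A hAJ hq)
    · exact hcompat p (hsub A hAJ hp) q (hsub B hBJ hq)
    · exact hcompat p (hsub B hBJ hp) q (hsub A hAJ hq)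
    · exact hcompat p (hsub B hBJ hp) q (hsub B hBJ hq)
  · intro p hp
    have hpJ : p.1 ∈ A ∪ B := by rw [h.split.union]; exact ⟨p, hp, rfl⟩
    have hpe : (p.1, g p.1) = p := by rw [← hgΓ p hp]
    rcases hpJ with hp' | hp'
    · exact ⟨_, Or.inl rfl, Or.inl ⟨p.1, hp', hpe⟩⟩
    · exact ⟨_, Or.inr rfl, Or.inl ⟨p.1, hp', hpe⟩⟩
  · rw [hJ']
    exact h'.tiles (sndA A) (sndA B)

theorem Cell.exists_subdiv {P : Set ℂ → Prop} {J : Set ℂ} (hcut : Cuts P J) :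
    ∀ {Γ : Set (ℂ × ℂ)}, Cell Γ → Prod.fst '' Γ = J →
      ∃ 𝒞, Subdiv Γ 𝒞 ∧ ∀ γ ∈ 𝒞, P (Prod.fst '' γ) := by
  induction hcut with
  | leaf hJ hP =>
    intro Γ hΓ h
    exact ⟨{Γ}, .refl hΓ, by rintro _ rfl; rwa [h]⟩
  | node ht _ _ ih1 ih2 =>
    intro Γ hΓ h
    subst h
    obtain ⟨γ, δ, hs, h1, h2⟩ := hΓ.theta ht
    have : ∀ η ∈ ({γ, δ} : Set (Set (ℂ × ℂ))), ∃ 𝒞, Subdiv η 𝒞 ∧ ∀ γ ∈ 𝒞, P (Prod.fst '' γ) := by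
      intro η hη
      have hc := hs.cell hη
      rcases hη with rfl | rfl
      · exact ih1 hc h1
      · exact ih2 hc h2
    choose! 𝒟 hD hP using this
    refine ⟨_, hs.trans hD, fun η hη => ?_⟩
    obtain ⟨γ', hγ', hη⟩ := mem_iUnion₂.1 hη
    exact hP γ' hγ' η hη

/-- All points of `S` are within `ε` of each other. -/
def Small (ε : ℝ) (S : Set ℂ) : Prop := ∀ x ∈ S, ∀ y ∈ S, dist x y ≤ ε

theorem Cell.exists_small {Γ : Set (ℂ × ℂ)} (hΓ : Cell Γ) {ε : ℝ} (hε : 0 < ε) :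
    ∃ 𝒞, Subdiv Γ 𝒞 ∧ ∀ γ ∈ 𝒞, Small ε (inside (Prod.fst '' γ)) ∧
      Small ε (inside (Prod.snd '' γ)) := by
  obtain ⟨𝒞, hC, hCs⟩ := Cell.exists_subdiv (cuts_dist hΓ.fst hε) hΓ rfl
  have : ∀ γ ∈ 𝒞, ∃ 𝒟, Subdiv γ 𝒟 ∧ ∀ δ ∈ 𝒟, Small ε (inside (Prod.snd '' δ)) := by
    intro γ hγ
    have hsw := (hC.cell hγ).swap
    obtain ⟨𝒟, hD, hDs⟩ := Cell.exists_subdiv (cuts_dist hsw.fst hε) hsw rfl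
    refine ⟨_, hD.of_swap, ?_⟩
    rintro _ ⟨δ, hδ, rfl⟩
    have := hDs δ hδ
    rw [image_image]
    exact this
  choose! 𝒟 hD hDs using this
  refine ⟨_, hC.trans hD, fun δ hδ => ?_⟩
  obtain ⟨γ, hγ, hδ⟩ := mem_iUnion₂.1 hδ
  have h1 := (hD γ hγ).fst.subset δ hδ
  exact ⟨fun x hx y hy => hCs γ hγ x (h1 hx) y (h1 hy), hDs γ hγ δ hδ⟩

theorem Subdiv.exists_refine {Γ : Set (ℂ × ℂ)} {𝒞 : Set (Set (ℂ × ℂ))} (h : Subdiv Γ 𝒞) {ε : ℝ}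
    (hε : 0 < ε) : ∃ 𝒟, Subdiv Γ 𝒟 ∧ (∀ δ ∈ 𝒟, Small ε (inside (Prod.fst '' δ)) ∧
      Small ε (inside (Prod.snd '' δ))) ∧
      ∀ δ ∈ 𝒟, ∃ γ ∈ 𝒞, inside (Prod.fst '' δ) ⊆ inside (Prod.fst '' γ) ∧
        inside (Prod.snd '' δ) ⊆ inside (Prod.snd '' γ) := by
  choose! 𝒟 hD hDs using fun γ (hγ : γ ∈ 𝒞) => (h.cell hγ).exists_small hε
  refine ⟨_, h.trans hD, fun δ hδ => ?_, fun δ hδ => ?_⟩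
  · obtain ⟨γ, hγ, hδ⟩ := mem_iUnion₂.1 hδ
    exact hDs γ hγ δ hδ
  · obtain ⟨γ, hγ, hδ⟩ := mem_iUnion₂.1 hδ
    exact ⟨γ, hγ, (hD γ hγ).fst.subset δ hδ, (hD γ hγ).snd.subset δ hδ⟩

/-- The relation given by matched closed tiles. -/
def tileRel (𝒞 : Set (Set (ℂ × ℂ))) : Set (ℂ × ℂ) :=
  ⋃ γ ∈ 𝒞, closure (inside (Prod.fst '' γ)) ×ˢ closure (inside (Prod.snd '' γ))

theorem Small.closure {ε : ℝ} {S : Set ℂ} (h : Small ε S) : Small ε (closure S) := by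
  intro x hx y hy
  have h1 : ∀ z ∈ S, dist x z ≤ ε := fun z hz =>
    closure_minimal (fun w hw => h w hw z hz) isClosed_closedBall hx
  have h2 := closure_minimal (fun w hw => by rw [mem_closedBall, dist_comm]; exact h1 w hw)
    isClosed_closedBall hy
  rw [dist_comm]
  exact h2

theorem Subdiv.dist_le {Γ : Set (ℂ × ℂ)} {𝒞 : Set (Set (ℂ × ℂ))} (h : Subdiv Γ 𝒞) {ε : ℝ}
    (hs : ∀ γ ∈ 𝒞, Small ε (inside (Prod.snd '' γ))) {x y z : ℂ}
    (hy : (x, y) ∈ tileRel 𝒞) (hz : (x, z) ∈ tileRel 𝒞) : dist y z ≤ ε + ε := by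
  obtain ⟨γ, hγ, hxγ, hyγ⟩ := mem_iUnion₂.1 hy
  obtain ⟨δ, hδ, hxδ, hzδ⟩ := mem_iUnion₂.1 hz
  have hγs := (hs γ hγ).closure
  have hδs := (hs δ hδ).closure
  by_cases hne : γ = δ
  · subst hne
    have := hγs y hyγ z hzδ
    linarith [dist_nonneg (x := y) (y := z)]
  · simp only at hxγ hxδ
    rw [(h.fst.jordan γ hγ).closure_inside] at hxγ
    rw [(h.fst.jordan δ hδ).closure_inside] at hxδ
    obtain ⟨p, hp, hpx⟩ := h.fst.mem_of_mem hγ hδ hne hxγ hxδ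
    obtain ⟨q, hq, hqx⟩ := h.fst.mem_of_mem hδ hγ (Ne.symm hne) hxδ hxγ
    have hpq := (h.compat γ hγ δ hδ p hp q hq).1 (hpx.trans hqx.symm)
    have h1 := hγs y hyγ p.2 ((h.snd.jordan γ hγ).subset_closure_inside ⟨p, hp, rfl⟩)
    have h2 := hδs q.2 ((h.snd.jordan δ hδ).subset_closure_inside ⟨q, hq, rfl⟩) z hzδ
    rw [← hpq] at h2
    linarith [dist_triangle y p.2 z]

theorem tileRel_swap (𝒞 : Set (Set (ℂ × ℂ))) {x y : ℂ} :
    (y, x) ∈ tileRel ((fun γ => Prod.swap '' γ) '' 𝒞) ↔ (x, y) ∈ tileRel 𝒞 := by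
  simp only [tileRel, mem_iUnion, exists_prop, exists_mem_image, image_image, mem_prod,
    Prod.fst_swap, Prod.snd_swap]
  exact exists_congr fun γ => and_congr_right fun _ => and_comm

theorem Subdiv.isClosed_fiber {Γ : Set (ℂ × ℂ)} {𝒞 : Set (Set (ℂ × ℂ))} (h : Subdiv Γ 𝒞) :
    IsCompact (tileRel 𝒞) := by
  refine h.finite.isCompact_biUnion fun γ hγ => ?_
  exact (isBounded_inside (h.fst.jordan γ hγ).isCompact).isCompact_closure.prod
    (isBounded_inside (h.snd.jordan γ hγ).isCompact).isCompact_closure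

theorem Subdiv.exists_mem {Γ : Set (ℂ × ℂ)} {𝒞 : Set (Set (ℂ × ℂ))} (h : Subdiv Γ 𝒞) {x : ℂ}
    (hx : x ∈ inside (Prod.fst '' Γ) ∪ Prod.fst '' Γ) : ∃ y, (x, y) ∈ tileRel 𝒞 := by
  have key : ∃ γ ∈ 𝒞, x ∈ inside (Prod.fst '' γ) ∪ Prod.fst '' γ := by
    rcases hx with hx | ⟨p, hp, rfl⟩
    · exact h.fst.cover x hx
    · obtain ⟨γ, hγ, hpγ⟩ := h.boundary hp
      exact ⟨γ, hγ, Or.inr ⟨p, hpγ, rfl⟩⟩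
  obtain ⟨γ, hγ, hx⟩ := key
  obtain ⟨y, hy⟩ := (h.snd.jordan γ hγ).inside_nonempty
  exact ⟨y, mem_biUnion hγ ⟨by rwa [(h.fst.jordan γ hγ).closure_inside], subset_closure hy⟩⟩

theorem Subdiv.fst_mem {Γ : Set (ℂ × ℂ)} {𝒞 : Set (Set (ℂ × ℂ))} (h : Subdiv Γ 𝒞) (hΓ : Cell Γ)
    {p : ℂ × ℂ} (hp : p ∈ tileRel 𝒞) : p.1 ∈ inside (Prod.fst '' Γ) ∪ Prod.fst '' Γ := by
  obtain ⟨γ, hγ, h1, -⟩ := mem_iUnion₂.1 hp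
  rw [(h.fst.jordan γ hγ).closure_inside] at h1
  exact h.fst.closed_subset hΓ.fst hγ h1

theorem exists_limit {𝒞 : ℕ → Set (ℂ × ℂ)} (hc : ∀ n, IsCompact (𝒞 n)) (hanti : Antitone 𝒞) {x : ℂ}
    (h : ∀ n, ∃ y, (x, y) ∈ 𝒞 n) : ∃ y, ∀ n, (x, y) ∈ 𝒞 n := by
  have hcf : ∀ n, IsCompact (𝒞 n ∩ {p : ℂ × ℂ | p.1 = x}) := fun n =>
    (hc n).inter_right (isClosed_singleton.preimage continuous_fst)
  obtain ⟨p, hp⟩ := IsCompact.nonempty_iInter_of_sequence_nonempty_isCompact_isClosed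
    (fun n => 𝒞 n ∩ {p : ℂ × ℂ | p.1 = x})
    (fun n => inter_subset_inter_left _ (hanti (Nat.le_succ n)))
    (fun n => by obtain ⟨y, hy⟩ := h n; exact ⟨(x, y), hy, rfl⟩) (hcf 0)
    (fun n => (hcf n).isClosed)
  have hpx : p.1 = x := (mem_iInter.1 hp 0).2
  exact ⟨p.2, fun n => by rw [← hpx]; exact (mem_iInter.1 hp n).1⟩

theorem Cell.exists_extension {Γ : Set (ℂ × ℂ)} (hΓ : Cell Γ) :
    ∃ R : Set (ℂ × ℂ), IsCompact R ∧ Γ ⊆ R ∧ (∀ p ∈ R, ∀ q ∈ R, p.1 = q.1 ↔ p.2 = q.2) ∧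
      Prod.fst '' R = inside (Prod.fst '' Γ) ∪ Prod.fst '' Γ ∧
      Prod.snd '' R = inside (Prod.snd '' Γ) ∪ Prod.snd '' Γ := by
  choose! g hg1 hg2 hg3 using fun (n : ℕ) (𝒞 : Set (Set (ℂ × ℂ))) (h : Subdiv Γ 𝒞) =>
    h.exists_refine (ε := 1 / ((n : ℝ) + 1)) (by positivity)
  let C : ℕ → Set (Set (ℂ × ℂ)) := fun n => Nat.rec {Γ} (fun n 𝒞 => g n 𝒞) n
  have hC : ∀ n, Subdiv Γ (C n) := by
    intro n
    induction n with
    | zero => exact .refl hΓ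
    | succ n ih => exact hg1 n _ ih
  have hs : ∀ n, ∀ δ ∈ C (n + 1), Small (1 / ((n : ℝ) + 1)) (inside (Prod.fst '' δ)) ∧
      Small (1 / ((n : ℝ) + 1)) (inside (Prod.snd '' δ)) := fun n => hg2 n _ (hC n)
  have hanti : Antitone fun n => tileRel (C n) := by
    refine antitone_nat_of_succ_le fun n p hp => ?_
    obtain ⟨δ, hδ, h1, h2⟩ := mem_iUnion₂.1 hp
    obtain ⟨γ, hγ, h3, h4⟩ := hg3 n _ (hC n) δ hδ
    exact mem_biUnion hγ ⟨closure_mono h3 h1, closure_mono h4 h2⟩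
  have hcpt : ∀ n, IsCompact (tileRel (C n)) := fun n => (hC n).isClosed_fiber
  have hzero : ∀ {d : ℝ}, 0 ≤ d → (∀ n : ℕ, d ≤ 1 / ((n : ℝ) + 1) + 1 / ((n : ℝ) + 1)) → d = 0 := by
    intro d hd h
    by_contra hne
    obtain ⟨n, hn⟩ := exists_nat_one_div_lt (show 0 < d / 2 by
      have := lt_of_le_of_ne hd (Ne.symm hne); positivity)
    linarith [h n]
  refine ⟨⋂ n, tileRel (C n), (hcpt 0).of_isClosed_subset
    (isClosed_iInter fun n => (hcpt n).isClosed) (iInter_subset _ 0), ?_, ?_, ?_, ?_⟩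
  · intro p hp
    refine mem_iInter.2 fun n => ?_
    obtain ⟨γ, hγ, hpγ⟩ := (hC n).boundary hp
    exact mem_biUnion hγ ⟨((hC n).fst.jordan γ hγ).subset_closure_inside ⟨p, hpγ, rfl⟩,
      ((hC n).snd.jordan γ hγ).subset_closure_inside ⟨p, hpγ, rfl⟩⟩
  · rintro ⟨x, y⟩ hp ⟨x', y'⟩ hq
    rw [mem_iInter] at hp hq
    simp only
    constructor
    · rintro rfl
      refine dist_eq_zero.1 (hzero dist_nonneg fun n => ?_)
      exact (hC (n + 1)).dist_le (fun γ hγ => (hs n γ hγ).2) (hp (n + 1)) (hq (n + 1))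
    · rintro rfl
      refine dist_eq_zero.1 (hzero dist_nonneg fun n => ?_)
      refine (hC (n + 1)).swap.dist_le (x := y) ?_ ((tileRel_swap _).2 (hp (n + 1)))
        ((tileRel_swap _).2 (hq (n + 1)))
      rintro _ ⟨γ, hγ, rfl⟩
      rw [image_image]
      exact (hs n γ hγ).1
  · refine Subset.antisymm ?_ fun x hx => ?_
    · rintro _ ⟨p, hp, rfl⟩
      exact (hC 0).fst_mem hΓ (mem_iInter.1 hp 0)
    · obtain ⟨y, hy⟩ := exists_limit hcpt hanti fun n => (hC n).exists_mem hx
      exact ⟨(x, y), mem_iInter.2 hy, rfl⟩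
  · refine Subset.antisymm ?_ fun y hy => ?_
    · rintro _ ⟨p, hp, rfl⟩
      have := (hC 0).swap.fst_mem hΓ.swap ((tileRel_swap (C 0)).2 (mem_iInter.1 hp 0))
      rw [image_image] at this
      exact this
    · have hanti' : Antitone fun n => tileRel ((fun γ => Prod.swap '' γ) '' C n) := by
        intro m n hmn p hp
        exact (tileRel_swap (C m)).2 (hanti hmn ((tileRel_swap (C n)).1 hp))
      obtain ⟨x, hx⟩ := exists_limit (fun n => (hC n).swap.isClosed_fiber) hanti' fun n =>
        (hC n).swap.exists_mem (x := y) (by rw [image_image]; exact hy)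
      exact ⟨(x, y), mem_iInter.2 fun n => (tileRel_swap _).1 (hx n), rfl⟩

/-- **Schoenflies theorem**: a homeomorphism between plane Jordan curves extends to the closed
interior domains. -/
theorem schoenflies_plane {J : Set ℂ} (hJ : IsJordan J) {h : ℂ → ℂ} (hc : ContinuousOn h J)
    (hi : InjOn h J) : ∃ Φ : ℂ → ℂ, ContinuousOn Φ (inside J ∪ J) ∧
      BijOn Φ (inside J ∪ J) (inside (h '' J) ∪ h '' J) ∧ EqOn Φ h J := by
  set Γ : Set (ℂ × ℂ) := (fun x => (x, h x)) '' J with hΓ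
  have h1 : Prod.fst '' Γ = J := by rw [hΓ, image_image]; simp
  have h2 : Prod.snd '' Γ = h '' J := by rw [hΓ, image_image]
  have hcell : Cell Γ := by
    refine ⟨hJ.isCompact.image_of_continuousOn (continuousOn_id.prodMk hc), by rwa [h1], ?_, ?_⟩
    · rw [h2]; exact hJ.image hc hi
    · rintro _ ⟨x, hx, rfl⟩ _ ⟨y, hy, rfl⟩
      exact (hi.eq_iff hx hy).symm
  obtain ⟨R, hR, hΓR, hinj, hf, hs⟩ := hcell.exists_extension
  rw [h1] at hf
  rw [h2] at hs
  have hex : ∀ x, ∃ y, x ∈ inside J ∪ J → (x, y) ∈ R := fun x => by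
    by_cases hx : x ∈ inside J ∪ J
    · rw [← hf] at hx
      obtain ⟨p, hp, rfl⟩ := hx
      exact ⟨p.2, fun _ => hp⟩
    · exact ⟨0, fun h => absurd h hx⟩
  choose Φ hΦ using hex
  have hmem : ∀ p ∈ R, p.1 ∈ inside J ∪ J := fun p hp => hf ▸ ⟨p, hp, rfl⟩
  have hΦp : ∀ p ∈ R, Φ p.1 = p.2 := fun p hp =>
    (hinj (p.1, Φ p.1) (hΦ _ (hmem p hp)) p hp).1 rfl
  refine ⟨Φ, ?_, ⟨?_, ?_, ?_⟩, ?_⟩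
  · rw [← hf]
    exact continuousOn_image_of_comp hR continuous_fst.continuousOn
      (continuous_snd.continuousOn.congr hΦp)
  · intro x hx
    rw [← hs]
    exact ⟨_, hΦ x hx, rfl⟩
  · intro x hx y hy he
    exact (hinj _ (hΦ x hx) _ (hΦ y hy)).2 he
  · intro y hy
    rw [← hs] at hy
    obtain ⟨p, hp, rfl⟩ := hy
    exact ⟨p.1, hmem p hp, hΦp p hp⟩
  · intro x hx
    exact hΦp (x, h x) (hΓR ⟨x, hx, rfl⟩)

end Whitney

namespace Whitney
open Set Filter Topology Metric

/-- Points near a point of a Jordan curve on the same side of the curve can be joined near it. -/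
theorem IsJordan.joinedIn_near {J : Set ℂ} (hJ : IsJordan J) {x : ℂ} (hx : x ∈ J) {N : Set ℂ}
    (hN : N ∈ 𝓝 x) :
    ∃ N' ∈ 𝓝 x, ∀ z ∈ N', ∀ w ∈ N', JoinedIn Jᶜ z w → JoinedIn (N \ J) z w := by
  obtain ⟨ε, hε, hεN⟩ := Metric.mem_nhds_iff.1 hN
  obtain ⟨A, B, u, v, hs, hxA, hxu, hxv, hAN⟩ := hJ.split_near hx (ball_mem_nhds x hε)
  have hxB : x ∉ B := fun h => by
    have h2 : x ∈ A ∩ B := ⟨hxA, h⟩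
    rw [hs.inter] at h2
    exact h2.elim hxu hxv
  obtain ⟨δ, hδ, hδB⟩ := Metric.mem_nhds_iff.1
    (inter_mem (hs.right.isCompact.isClosed.isOpen_compl.mem_nhds hxB) (ball_mem_nhds x hε))
  refine ⟨ball x δ, ball_mem_nhds x hδ, fun z hz w hw hzw => ?_⟩
  let K : Set ℂ := (closedBall x (ε + 1) \ ball x ε) ∪ B
  have hK : IsCompact K :=
    ((isCompact_closedBall x (ε + 1)).diff isOpen_ball).union hs.right.isCompact
  have hKJ : K ∩ J = B := by
    refine Subset.antisymm ?_ fun y hy => ⟨Or.inr hy, hs.right_subset hy⟩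
    rintro y ⟨hy | hy, hyJ⟩
    · rw [← hs.union] at hyJ
      exact hyJ.resolve_left fun h => hy.2 (hAN h)
    · exact hy
  have h1 : JoinedIn Kᶜ z w := by
    refine ((convex_ball x δ).isPathConnected ⟨x, mem_ball_self hδ⟩).joinedIn z hz w hw |>.mono ?_
    rintro y hy (h | h)
    · exact h.2 (hδB hy).2
    · exact (hδB hy).1 h
  have hj := janiszewski hK hJ.isCompact (by rw [hKJ]; exact hs.right.isPreconnected) h1 hzw
  obtain ⟨γ, hγ⟩ := hj
  refine ⟨γ, fun t => ⟨hεN ?_, fun h => hγ t (Or.inr h)⟩⟩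
  have hsub : range γ ⊆ ball x ε := by
    refine subset_of_frontier_inter (isPreconnected_range γ.continuous) (a := z) ⟨0, γ.source⟩
      (hδB hz).2 ?_
    rw [eq_empty_iff_forall_notMem]
    rintro y ⟨⟨s, rfl⟩, hy⟩
    rw [frontier_ball x hε.ne'] at hy
    refine hγ s (Or.inl (Or.inl ⟨?_, ?_⟩))
    · rw [mem_closedBall, mem_sphere.1 hy]; linarith
    · rw [mem_ball, mem_sphere.1 hy]; exact lt_irrefl _
  exact hsub ⟨t, rfl⟩

instance fact_finrank : Fact (Module.finrank ℝ (EuclideanSpace ℝ (Fin 3)) = 2 + 1) :=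
  ⟨finrank_euclideanSpace_fin⟩

/-- The inverse of the stereographic projection from `n`. -/
def unproj (n : Sphere2) (z : ℂ) : Sphere2 :=
  (stereographic' 2 n).symm (Complex.orthonormalBasisOneI.repr z)

/-- The stereographic projection from `n`. -/
def proj (n x : Sphere2) : ℂ :=
  Complex.orthonormalBasisOneI.repr.symm (stereographic' 2 n x)

theorem proj_unproj (n : Sphere2) (z : ℂ) : proj n (unproj n z) = z := by
  simp only [proj, unproj]
  rw [(stereographic' 2 n).right_inv (by simp)]
  simp

theorem unproj_proj {n x : Sphere2} (h : x ≠ n) : unproj n (proj n x) = x := by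
  simp only [proj, unproj]
  rw [LinearIsometryEquiv.apply_symm_apply]
  exact (stereographic' 2 n).left_inv (by simpa using h)

theorem unproj_ne (n : Sphere2) (z : ℂ) : unproj n z ≠ n := by
  have h := (stereographic' 2 n).map_target (x := Complex.orthonormalBasisOneI.repr z) (by simp)
  simpa [unproj] using h

theorem continuous_unproj (n : Sphere2) : Continuous (unproj n) := by
  have h := (stereographic' 2 n).continuousOn_symm
  rw [stereographic'_target, continuousOn_univ] at h
  exact h.comp Complex.orthonormalBasisOneI.repr.continuous

theorem continuousOn_proj (n : Sphere2) : ContinuousOn (proj n) {n}ᶜ := by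
  have h := (stereographic' 2 n).continuousOn
  rw [stereographic'_source] at h
  exact Complex.orthonormalBasisOneI.repr.symm.continuous.comp_continuousOn h

theorem injective_unproj (n : Sphere2) : Function.Injective (unproj n) :=
  Function.LeftInverse.injective (proj_unproj n)

theorem injOn_proj (n : Sphere2) : InjOn (proj n) {n}ᶜ := fun x hx y hy h => by
  rw [← unproj_proj hx, ← unproj_proj hy, h]

theorem image_unproj (n : Sphere2) (S : Set ℂ) : unproj n '' S = {n}ᶜ ∩ proj n ⁻¹' S := by
  ext x
  constructor
  · rintro ⟨z, hz, rfl⟩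
    exact ⟨unproj_ne n z, by rwa [mem_preimage, proj_unproj]⟩
  · rintro ⟨hx, hxS⟩
    exact ⟨_, hxS, unproj_proj hx⟩

theorem isOpen_image_unproj (n : Sphere2) {S : Set ℂ} (hS : IsOpen S) : IsOpen (unproj n '' S) := by
  rw [image_unproj]
  exact (continuousOn_proj n).isOpen_inter_preimage isOpen_compl_singleton hS

theorem image_proj {n : Sphere2} {C : Set Sphere2} (hn : n ∉ C) : unproj n '' (proj n '' C) = C := by
  ext x
  constructor
  · rintro ⟨_, ⟨y, hy, rfl⟩, rfl⟩
    rwa [unproj_proj (ne_of_mem_of_not_mem hy hn)]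
  · exact fun hx => ⟨_, ⟨x, hx, rfl⟩, unproj_proj (ne_of_mem_of_not_mem hx hn)⟩

theorem isJordan_proj {n : Sphere2} {C : Set Sphere2} (hC : IsJordan C) (hn : n ∉ C) :
    IsJordan (proj n '' C) :=
  hC.image ((continuousOn_proj n).mono fun _ hx => ne_of_mem_of_not_mem hx hn)
    ((injOn_proj n).mono fun _ hx => ne_of_mem_of_not_mem hx hn)

theorem isPreconnected_compl_of_finite {S : Set Sphere2} (hS : S.Finite) {n : Sphere2}
    (hn : n ∈ S) : IsPreconnected Sᶜ := by
  have h1 : IsPreconnected (proj n '' (S \ {n}))ᶜ :=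
    (((hS.sdiff).image _).countable.isConnected_compl_of_one_lt_rank (by simp)).isPreconnected
  convert! h1.image _ (continuous_unproj n).continuousOn using 1
  ext x
  constructor
  · intro hx
    have hxn : x ≠ n := fun h => hx (h ▸ hn)
    refine ⟨proj n x, ?_, unproj_proj hxn⟩
    rintro ⟨y, hy, hyx⟩
    exact hx (injOn_proj n hy.2 hxn hyx ▸ hy.1)
  · rintro ⟨z, hz, rfl⟩ hzS
    exact hz ⟨_, ⟨hzS, unproj_ne n z⟩, proj_unproj n z⟩

/-- The face of the curve `C` that does not contain `n`. -/
def face (n : Sphere2) (C : Set Sphere2) : Set Sphere2 :=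
  unproj n '' inside (proj n '' C)

section face

variable {n : Sphere2} {C : Set Sphere2}

theorem isOpen_face (hC : IsJordan C) (hn : n ∉ C) : IsOpen (face n C) :=
  isOpen_image_unproj n (isOpen_inside (isJordan_proj hC hn).isCompact.isClosed)

theorem isPreconnected_face (hC : IsJordan C) (hn : n ∉ C) : IsPreconnected (face n C) :=
  (isJordan_proj hC hn).isPreconnected_inside.image _ (continuous_unproj n).continuousOn

theorem face_nonempty (hC : IsJordan C) (hn : n ∉ C) : (face n C).Nonempty :=
  (isJordan_proj hC hn).inside_nonempty.image _

theorem notMem_face : n ∉ face n C := by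
  rintro ⟨z, -, hz⟩
  exact unproj_ne n z hz

theorem face_union (hn : n ∉ C) :
    face n C ∪ C = unproj n '' (inside (proj n '' C) ∪ proj n '' C) := by
  rw [image_union, image_proj hn, face]

theorem disjoint_face (hn : n ∉ C) : Disjoint (face n C) C := by
  conv_rhs => rw [← image_proj hn]
  exact (disjoint_image_iff (injective_unproj n)).2 (disjoint_inside _)

theorem isCompact_face_union (hC : IsJordan C) (hn : n ∉ C) : IsCompact (face n C ∪ C) := by
  have hJ := isJordan_proj hC hn
  rw [face_union hn, ← hJ.closure_inside]
  exact (isBounded_inside hJ.isCompact).isCompact_closure.image (continuous_unproj n)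

theorem closure_face (hC : IsJordan C) (hn : n ∉ C) : closure (face n C) = face n C ∪ C := by
  refine Subset.antisymm
    (closure_minimal subset_union_left (isCompact_face_union hC hn).isClosed) ?_
  rw [face_union hn, ← (isJordan_proj hC hn).closure_inside]
  exact image_closure_subset_closure_image (continuous_unproj n)

theorem frontier_face (hC : IsJordan C) (hn : n ∉ C) : frontier (face n C) = C := by
  rw [frontier, (isOpen_face hC hn).interior_eq, closure_face hC hn, union_sdiff_left]
  exact (disjoint_face hn).symm.sdiff_eq_left

theorem disjoint_face_of_isPreconnected (hC : IsJordan C) (hn : n ∉ C) {S : Set Sphere2}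
    (hS : IsPreconnected S) (hSC : Disjoint S C) (hnS : n ∈ S) : Disjoint S (face n C) := by
  rw [disjoint_left]
  intro x hx hxF
  refine notMem_face (subset_of_frontier_inter hS hx hxF ?_ hnS)
  rw [frontier_face hC hn]
  exact hSC.inter_eq

/-- Points near a point of a Jordan curve in the sphere on the side of `n` can be joined near it. -/
theorem exists_isPreconnected_near (hC : IsJordan C) (hn : n ∉ C) {x : Sphere2} (hx : x ∈ C)
    {N : Set Sphere2} (hN : N ∈ 𝓝 x) :
    ∃ N' ∈ 𝓝 x, ∀ z ∈ N', ∀ w ∈ N', z ∉ face n C ∪ C → w ∉ face n C ∪ C →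
      ∃ P ⊆ N \ C, IsPreconnected P ∧ z ∈ P ∧ w ∈ P := by
  have hJ := isJordan_proj hC hn
  have hxn : x ≠ n := ne_of_mem_of_not_mem hx hn
  have hN1 : unproj n ⁻¹' N ∈ 𝓝 (proj n x) :=
    (continuous_unproj n).continuousAt.preimage_mem_nhds (by rwa [unproj_proj hxn])
  obtain ⟨M, hM, hMj⟩ := hJ.joinedIn_near (mem_image_of_mem _ hx) hN1
  have hcn : {n}ᶜ ∈ 𝓝 x := isOpen_compl_singleton.mem_nhds hxn
  refine ⟨proj n ⁻¹' M ∩ {n}ᶜ,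
    inter_mem (((continuousOn_proj n).continuousAt hcn).preimage_mem_nhds hM) hcn, ?_⟩
  rintro z ⟨hz, hzn⟩ w ⟨hw, hwn⟩ hzC hwC
  have hout : ∀ y, y ≠ n → y ∉ face n C ∪ C → proj n y ∈ outside (proj n '' C) := by
    intro y hy hyC
    have h1 : proj n y ∉ inside (proj n '' C) ∪ proj n '' C := fun h => hyC (by
      rw [face_union hn]; exact ⟨_, h, unproj_proj hy⟩)
    have h2 : proj n y ∈ (proj n '' C)ᶜ := fun h => h1 (Or.inr h)
    rw [← inside_union_outside] at h2
    exact h2.resolve_left fun h => h1 (Or.inl h)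
  have hj : JoinedIn (proj n '' C)ᶜ (proj n z) (proj n w) :=
    joinedIn_of_isPreconnected hJ.isCompact.isClosed (isPreconnected_outside hJ.isCompact)
      (disjoint_outside _).subset_compl_right (hout z hzn hzC) (hout w hwn hwC)
  obtain ⟨γ, hγ⟩ := hMj _ hz _ hw hj
  refine ⟨range fun t => unproj n (γ t), ?_,
    isPreconnected_range ((continuous_unproj n).comp γ.continuous), ⟨0, ?_⟩, ⟨1, ?_⟩⟩
  · rintro _ ⟨t, rfl⟩
    refine ⟨(hγ t).1, fun h => (hγ t).2 ⟨_, h, proj_unproj n _⟩⟩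
  · simp only [γ.source]; exact unproj_proj hzn
  · simp only [γ.target]; exact unproj_proj hwn

/-- Homeomorphisms of Jordan curves in the sphere extend to the closed faces. -/
theorem exists_extension_face (hC : IsJordan C) (hn : n ∉ C) {h : Sphere2 → Sphere2}
    (hc : ContinuousOn h C) (hi : InjOn h C) {m : Sphere2} (hm : m ∉ h '' C) :
    ∃ Φ : Sphere2 → Sphere2, ContinuousOn Φ (face n C ∪ C) ∧
      BijOn Φ (face n C) (face m (h '' C)) ∧ EqOn Φ h C := by
  have hJ := isJordan_proj hC hn
  let g : ℂ → ℂ := fun z => proj m (h (unproj n z))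
  have hu : MapsTo (unproj n) (proj n '' C) C := by
    rintro _ ⟨x, hx, rfl⟩
    rwa [unproj_proj (ne_of_mem_of_not_mem hx hn)]
  have hgJ : g '' (proj n '' C) = proj m '' (h '' C) := by
    rw [image_image, image_image]
    refine image_congr fun x hx => ?_
    simp only [g]
    rw [unproj_proj (ne_of_mem_of_not_mem hx hn)]
  have hgc : ContinuousOn g (proj n '' C) :=
    (continuousOn_proj m).comp (hc.comp (continuous_unproj n).continuousOn hu)
      fun z hz => ne_of_mem_of_not_mem (mem_image_of_mem h (hu hz)) hm
  have hgi : InjOn g (proj n '' C) := by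
    refine (injOn_proj m).comp (hi.comp (injective_unproj n).injOn hu) ?_
    exact fun z hz => ne_of_mem_of_not_mem (mem_image_of_mem h (hu hz)) hm
  obtain ⟨Ψ, hΨc, hΨb, hΨe⟩ := schoenflies_plane hJ hgc hgi
  rw [hgJ] at hΨb
  have hΨi : BijOn Ψ (inside (proj n '' C)) (inside (proj m '' (h '' C))) := by
    have hJb : Ψ '' (proj n '' C) = proj m '' (h '' C) := by rw [← hgJ]; exact image_congr hΨe
    refine ⟨fun z hz => ?_, hΨb.injOn.mono subset_union_left, fun w hw => ?_⟩
    · refine (hΨb.mapsTo (Or.inl hz)).resolve_right fun h1 => ?_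
      rw [← hJb] at h1
      obtain ⟨y, hy, hyz⟩ := h1
      have := hΨb.injOn (Or.inr hy) (Or.inl hz) hyz
      exact (disjoint_inside _).le_bot ⟨hz, this ▸ hy⟩
    · obtain ⟨z, hz, rfl⟩ := hΨb.surjOn (Or.inl hw)
      refine ⟨z, hz.resolve_right fun h1 => ?_, rfl⟩
      exact (disjoint_inside _).le_bot ⟨hw, hJb ▸ mem_image_of_mem Ψ h1⟩
  refine ⟨fun x => unproj m (Ψ (proj n x)), ?_, ⟨?_, ?_, ?_⟩, fun x hx => ?_⟩
  · refine (continuous_unproj m).comp_continuousOn (hΨc.comp ((continuousOn_proj n).mono ?_) ?_)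
    · rintro x (hx | hx)
      · exact ne_of_mem_of_not_mem hx notMem_face
      · exact ne_of_mem_of_not_mem hx hn
    · rw [face_union hn]
      rintro _ ⟨z, hz, rfl⟩
      rwa [proj_unproj]
  · rintro _ ⟨z, hz, rfl⟩
    simp only [proj_unproj]
    exact mem_image_of_mem _ (hΨi.mapsTo hz)
  · rintro _ ⟨z, hz, rfl⟩ _ ⟨w, hw, rfl⟩ he
    simp only [proj_unproj] at he
    rw [hΨi.injOn hz hw (injective_unproj m he)]
  · rintro _ ⟨w, hw, rfl⟩
    obtain ⟨z, hz, rfl⟩ := hΨi.surjOn hw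
    exact ⟨unproj n z, mem_image_of_mem _ hz, by simp only [proj_unproj]⟩
  · simp only
    rw [hΨe (mem_image_of_mem _ hx)]
    simp only [g]
    rw [unproj_proj (ne_of_mem_of_not_mem hx hn),
      unproj_proj (ne_of_mem_of_not_mem (mem_image_of_mem h hx) hm)]

end face

end Whitney

namespace Whitney
open Set

section graph

variable {V : Type*} {G : SimpleGraph V}

/-- `C` is the edge set of an induced cycle that misses `b` and whose complement is connected. -/
def IsPeripheral (G : SimpleGraph V) (C : Set (Sym2 V)) (b : V) : Prop :=
  ∃ (u v : V) (p : G.Walk u v), G.Adj u v ∧ p.IsPath ∧ s(u, v) ∉ p.edges ∧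
    C = insert s(u, v) {e | e ∈ p.edges} ∧ b ∉ p.support ∧
    (∀ x ∈ p.support, ∀ y ∈ p.support, G.Adj x y → s(x, y) ∈ C) ∧
    ∀ x ∉ p.support, Relation.ReflTransGen (fun y z => G.Adj y z ∧ z ∉ p.support) b x

theorem reflTransGen_of_threeConnected [Fintype V] (h3 : ThreeConnected G) {s : Set V}
    (hs : s.ncard ≤ 2) {x y : V} (hx : x ∉ s) (hy : y ∉ s) :
    Relation.ReflTransGen (fun a b => G.Adj a b ∧ b ∉ s) x y := by
  have hc := (h3.2 s hs).preconnected ⟨x, by simpa using hx⟩ ⟨y, by simpa using hy⟩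
  rw [SimpleGraph.reachable_iff_reflTransGen] at hc
  refine hc.lift (fun a => a.1) fun a b hab => ?_
  have h1 : G.Adj a.1 b.1 := (SimpleGraph.Subgraph.coe_adj_sub _ a b hab)
  exact ⟨h1, by simpa using b.2⟩

/-- The graph obtained from `G` by deleting an edge and a set of vertices. -/
def avoid (G : SimpleGraph V) (e : Sym2 V) (S : Set V) : SimpleGraph V where
  Adj x y := G.Adj x y ∧ x ∉ S ∧ y ∉ S ∧ s(x, y) ≠ e
  symm := ⟨fun _ _ h => ⟨h.1.symm, h.2.2.1, h.2.1, Sym2.eq_swap ▸ h.2.2.2⟩⟩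
  loopless := ⟨fun _ h => h.1.ne rfl⟩

theorem avoid_le (G : SimpleGraph V) (e : Sym2 V) (S : Set V) : avoid G e S ≤ G :=
  fun _ _ h => h.1

section reroute

variable {e : Sym2 V} {B : Set V} {u v z : V} (p : (avoid G e B).Walk u v)

theorem avoid_adj_getVert {i : ℕ} (hi : i < p.length) (h1 : p.getVert i ≠ z)
    (h2 : p.getVert (i + 1) ≠ z) :
    (avoid G e (insert z B)).Adj (p.getVert i) (p.getVert (i + 1)) := by
  obtain ⟨ha, hb, hc, hd⟩ := p.adj_getVert_succ hi
  exact ⟨ha, fun h => h.elim h1 hb, fun h => h.elim h2 hc, hd⟩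

theorem reachable_getVert : ∀ {i : ℕ}, i ≤ p.length → (∀ k ≤ i, p.getVert k ≠ z) →
    (avoid G e (insert z B)).Reachable u (p.getVert i)
  | 0, _, _ => by simp
  | i + 1, hi, hz =>
    (reachable_getVert (by omega) fun k hk => hz k (by omega)).trans
      (avoid_adj_getVert p (by omega) (hz i (by omega)) (hz _ le_rfl)).reachable

theorem getVert_reachable : ∀ {d : ℕ}, d ≤ p.length →
    (∀ k ≤ p.length, p.length - d ≤ k → p.getVert k ≠ z) →
    (avoid G e (insert z B)).Reachable (p.getVert (p.length - d)) v
  | 0, _, _ => by simp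
  | d + 1, hd, hz => by
    have h1 := getVert_reachable (d := d) (by omega) fun k hk hk2 => hz k hk (by omega)
    have h2 := avoid_adj_getVert p (i := p.length - (d + 1)) (z := z) (by omega)
      (hz _ (by omega) le_rfl) (hz _ (by omega) (by omega))
    rw [show p.length - (d + 1) + 1 = p.length - d by omega] at h2
    exact h2.reachable.trans h1

theorem reachable_of_bypass (hp : p.IsPath) {i j l : ℕ} (hij : i < j) (hjl : j < l)
    (hl : l ≤ p.length)
    (h : (avoid G e (insert (p.getVert j) B)).Reachable (p.getVert i) (p.getVert l)) :
    (avoid G e (insert (p.getVert j) B)).Reachable u v := by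
  have hne : ∀ k ≤ p.length, k ≠ j → p.getVert k ≠ p.getVert j := fun k hk hkj he =>
    hkj (hp.getVert_injOn hk (show j ≤ p.length by omega) he)
  refine (reachable_getVert p (by omega) fun k hk => hne k (by omega) (by omega)).trans
    (h.trans ?_)
  have := getVert_reachable p (z := p.getVert j) (d := p.length - l) (by omega)
    fun k hk hk2 => hne k hk (by omega)
  rwa [show p.length - (p.length - l) = l by omega] at this

end reroute

theorem reachable_avoid_singleton [Fintype V] (h3 : ThreeConnected G) {u v w : V} (huv : G.Adj u v)
    (hwu : w ≠ u) (hwv : w ≠ v) : (avoid G s(u, v) {w}).Reachable u v := by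
  classical
  obtain ⟨x, hx⟩ : ∃ x, x ∉ ({u, v, w} : Finset V) := by
    by_contra! h
    have h1 : Finset.univ ⊆ ({u, v, w} : Finset V) := fun x _ => h x
    have h2 := (Finset.card_le_card h1).trans Finset.card_le_three
    have h4 := h3.1
    rw [Finset.card_univ] at h2
    omega
  simp only [Finset.mem_insert, Finset.mem_singleton, not_or] at hx
  obtain ⟨hxu, hxv, hxw⟩ := hx
  have key : ∀ a b : V, w ≠ a → w ≠ b → x ≠ b → a ≠ b → s(a, b) = s(u, v) →
      (avoid G s(u, v) {w}).Reachable x a := by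
    intro a b hwa hwb hxb hab he
    have h := reflTransGen_of_threeConnected h3 (s := {w, b})
      ((ncard_insert_le _ _).trans (by rw [ncard_singleton])) (x := x) (y := a)
      (by simp [hxw, hxb]) (by simp [hwa.symm, hab])
    have h' : ∀ c, Relation.ReflTransGen (fun y z => G.Adj y z ∧ z ∉ ({w, b} : Set V)) x c →
        (avoid G s(u, v) {w}).Reachable x c ∧ c ∉ ({w, b} : Set V) := by
      intro c hc
      induction hc with
      | refl => exact ⟨SimpleGraph.Reachable.refl _, by simp [hxw, hxb]⟩
      | tail _ hcd ih =>
        refine ⟨ih.1.trans (SimpleGraph.Adj.reachable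
          ⟨hcd.1, fun h => ih.2 (Or.inl h), fun h => hcd.2 (Or.inl h), fun h => ?_⟩), hcd.2⟩
        have hb : b ∈ s(u, v) := he ▸ Sym2.mem_mk_right a b
        rw [← h] at hb
        rcases Sym2.mem_iff.1 hb with rfl | rfl
        · exact ih.2 (Or.inr rfl)
        · exact hcd.2 (Or.inr rfl)
    exact (h' a h).1
  exact (key u v hwu hwv hxv huv.ne rfl).symm.trans (key v u hwv hwu hxu huv.ne' Sym2.eq_swap)

theorem exists_isPeripheral [Fintype V] (h3 : ThreeConnected G) {u v w : V} (huv : G.Adj u v)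
    (hwu : w ≠ u) (hwv : w ≠ v) :
    ∃ C, IsPeripheral G C w ∧ s(u, v) ∈ C ∧ (∀ e ∈ C, w ∉ e) ∧
      ∃ x, x ≠ u ∧ x ≠ v ∧ ∃ e ∈ C, x ∈ e := by
  classical
  let Good : Set V → Prop := fun B => w ∈ B ∧ u ∉ B ∧ v ∉ B ∧
    (∀ b ∈ B, Relation.ReflTransGen (fun x y => G.Adj x y ∧ y ∈ B) w b) ∧
    (avoid G s(u, v) B).Reachable u v
  have hG : Good {w} := by
    refine ⟨rfl, hwu.symm, hwv.symm, ?_, reachable_avoid_singleton h3 huv hwu hwv⟩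
    rintro b rfl
    exact .refl
  obtain ⟨B, hB⟩ : ∃ B, Maximal Good B :=
    let ⟨B, _, hB⟩ := (toFinite {B | Good B}).exists_le_maximal hG
    ⟨B, hB⟩
  obtain ⟨hwB, huB, hvB, hBc, hreach⟩ := hB.prop
  have hcut : ∀ z ∉ B, z ≠ u → z ≠ v → ∀ b ∈ B, G.Adj b z →
      ¬ (avoid G s(u, v) (insert z B)).Reachable u v := by
    intro z hz hzu hzv b hb hbz hr
    refine hz (hB.le_of_ge (y := insert z B) ⟨Or.inr hwB, ?_, ?_, ?_, hr⟩ (subset_insert z B)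
      (mem_insert z B))
    · exact fun h => h.elim (fun h => hzu h.symm) huB
    · exact fun h => h.elim (fun h => hzv h.symm) hvB
    · have h1 : ∀ b ∈ B, Relation.ReflTransGen (fun x y => G.Adj x y ∧ y ∈ insert z B) w b :=
        fun b hb => (hBc b hb).lift id fun x y h => ⟨h.1, Or.inr h.2⟩
      rintro c (rfl | hc)
      · exact (h1 b hb).tail ⟨hbz, mem_insert _ _⟩
      · exact h1 c hc
  obtain ⟨p, hp⟩ := hreach.exists_isPath
  have hinj : ∀ {i j}, i ≤ p.length → j ≤ p.length → p.getVert i = p.getVert j → i = j :=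
    fun hi hj h => hp.getVert_injOn hi hj h
  have hpB : ∀ i ≤ p.length, p.getVert i ∉ B := by
    rintro (_ | i) hi
    · simpa using huB
    · exact (p.adj_getVert_succ hi).2.2.1
  let Z : Set V := {z | z ∉ B ∧ (z = u ∨ z = v ∨ ∃ b ∈ B, G.Adj b z)}
  have hZp : ∀ z ∈ Z, ∃ i, p.getVert i = z ∧ i ≤ p.length := by
    rintro z ⟨hz, hz'⟩
    by_contra! h
    have hne : ∀ k ≤ p.length, p.getVert k ≠ z := fun k hk he => by
      have := h k he; omega
    have hzu : z ≠ u := fun he => hne 0 (by omega) (by simp [he])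
    have hzv : z ≠ v := fun he => hne p.length le_rfl (by simp [he])
    obtain ⟨b, hb, hbz⟩ := (hz'.resolve_left hzu).resolve_left hzv
    refine hcut z hz hzu hzv b hb hbz ?_
    simpa using reachable_getVert p le_rfl hne
  have hmid : ∀ {i j l}, i < j → j < l → l ≤ p.length → p.getVert j ∈ Z →
      ¬ (avoid G s(u, v) (insert (p.getVert j) B)).Reachable (p.getVert i) (p.getVert l) := by
    intro i j l hij hjl hl hZ hr
    have hju : p.getVert j ≠ u := fun h => by
      have := hinj (i := j) (j := 0) (by omega) (by omega) (by simpa using h)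
      omega
    have hjv : p.getVert j ≠ v := fun h => by
      have := hinj (i := j) (j := p.length) (by omega) le_rfl (by simpa using h)
      omega
    obtain ⟨b, hb, hbz⟩ := (hZ.2.resolve_left hju).resolve_left hjv
    exact hcut _ hZ.1 hju hjv b hb hbz (reachable_of_bypass p hp hij hjl hl hr)
  have hall : ∀ y ∉ B, y ∈ Z := by
    intro y hyB
    by_contra hyZ
    let K : Set V := {x | Relation.ReflTransGen (fun a c => G.Adj a c ∧ c ∉ B ∧ c ∉ Z) y x}
    have hK : ∀ x ∈ K, x ∉ B ∧ x ∉ Z := by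
      intro x hx
      rcases Relation.ReflTransGen.cases_tail hx with rfl | ⟨c, -, hc⟩
      · exact ⟨hyB, hyZ⟩
      · exact hc.2
    have huZ : u ∈ Z := ⟨huB, Or.inl rfl⟩
    have hvZ : v ∈ Z := ⟨hvB, Or.inr (Or.inl rfl)⟩
    have hKe : ∀ x ∈ K, ∀ c, s(x, c) ≠ s(u, v) := by
      intro x hx c he
      have : x ∈ s(u, v) := he ▸ Sym2.mem_mk_left x c
      rcases Sym2.mem_iff.1 this with rfl | rfl
      · exact (hK _ hx).2 huZ
      · exact (hK _ hx).2 hvZ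
    let N : Set V := {z | z ∈ Z ∧ ∃ x ∈ K, G.Adj x z}
    have hN : 2 < N.ncard := by
      by_contra! hN
      have h := reflTransGen_of_threeConnected h3 hN (x := y) (y := w) (fun h => hyZ h.1)
        (fun h => h.1.1 hwB)
      have hsub : ∀ c, Relation.ReflTransGen (fun a b => G.Adj a b ∧ b ∉ N) y c → c ∈ K := by
        intro c hc
        induction hc with
        | refl => exact Relation.ReflTransGen.refl
        | @tail a b _ hab ih =>
          refine Relation.ReflTransGen.tail ih ⟨hab.1, fun hb => ?_, fun hb => ?_⟩
          · exact (hK a ih).2 ⟨(hK a ih).1, Or.inr (Or.inr ⟨b, hb, hab.1.symm⟩)⟩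
          · exact hab.2 ⟨hb, a, ih, hab.1⟩
      exact (hK w (hsub w h)).1 hwB
    have hKr : ∀ z ∈ Z, ∀ x ∈ K, (avoid G s(u, v) (insert z B)).Reachable y x := by
      intro z hz x hx
      induction hx with
      | refl => exact SimpleGraph.Reachable.refl _
      | tail hb hbc ih =>
        refine ih.trans (SimpleGraph.Adj.reachable ⟨hbc.1, ?_, ?_, hKe _ hb _⟩)
        · exact fun h => h.elim (fun h => (hK _ hb).2 (h ▸ hz)) (hK _ hb).1
        · exact fun h => h.elim (fun h => hbc.2.2 (h ▸ hz)) hbc.2.1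
    have hNr : ∀ z ∈ Z, ∀ x ∈ N, x ≠ z → (avoid G s(u, v) (insert z B)).Reachable y x := by
      rintro z hz x ⟨hxZ, k, hk, hkx⟩ hxz
      refine (hKr z hz k hk).trans (SimpleGraph.Adj.reachable ⟨hkx, ?_, ?_, hKe _ hk _⟩)
      · exact fun h => h.elim (fun h => (hK _ hk).2 (h ▸ hz)) (hK _ hk).1
      · exact fun h => h.elim hxz hxZ.1
    have hbad : ∀ i j l, i < j → j < l → l ≤ p.length → p.getVert i ∈ N → p.getVert j ∈ N →
        p.getVert l ∈ N → False := by
      intro i j l hij hjl hl hi hj hl'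
      refine hmid hij hjl hl hj.1 ((hNr _ hj.1 _ hi fun h => ?_).symm.trans
        (hNr _ hj.1 _ hl' fun h => ?_))
      · have := hinj (by omega) (by omega) h; omega
      · have := hinj (by omega) (by omega) h; omega
    obtain ⟨a, b, c, ha, hb, hc, hab, hac, hbc⟩ := (two_lt_ncard_iff (toFinite N)).1 hN
    obtain ⟨i, rfl, hi⟩ := hZp a ha.1
    obtain ⟨j, rfl, hj⟩ := hZp b hb.1
    obtain ⟨l, rfl, hl⟩ := hZp c hc.1
    have hij : i ≠ j := fun h => hab (by rw [h])
    have hil : i ≠ l := fun h => hac (by rw [h])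
    have hjl : j ≠ l := fun h => hbc (by rw [h])
    rcases lt_or_gt_of_ne hij with h1 | h1 <;> rcases lt_or_gt_of_ne hil with h2 | h2 <;>
      rcases lt_or_gt_of_ne hjl with h4 | h4
    · exact hbad i j l h1 h4 hl ha hb hc
    · exact hbad i l j h2 h4 hj ha hc hb
    · omega
    · exact hbad l i j h2 h1 hj hc ha hb
    · exact hbad j i l h1 h2 hl hb ha hc
    · omega
    · exact hbad j l i h4 h2 hi hb hc ha
    · exact hbad l j i h4 h1 hi hc hb ha
  have hsupp : ∀ x, x ∈ p.support ↔ x ∉ B := by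
    intro x
    rw [SimpleGraph.Walk.mem_support_iff_exists_getVert]
    constructor
    · rintro ⟨i, rfl, hi⟩
      exact hpB i hi
    · exact fun hx => hZp x (hall x hx)
  have hind : ∀ i l, i < l → l ≤ p.length → G.Adj (p.getVert i) (p.getVert l) →
      s(p.getVert i, p.getVert l) ≠ s(u, v) → s(p.getVert i, p.getVert l) ∈ p.edges := by
    intro i l hil hl hadj hne
    by_cases hl1 : l = i + 1
    · subst hl1
      rw [SimpleGraph.Walk.mk_mem_edges_iff_exists]
      exact ⟨i, hl, rfl⟩
    · exfalso
      refine hmid (i := i) (j := i + 1) (l := l) (by omega) (by omega) hl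
        (hall _ (hpB _ (by omega))) (SimpleGraph.Adj.reachable ⟨hadj, ?_, ?_, hne⟩)
      · refine fun h => h.elim (fun h => ?_) (hpB i (by omega))
        have := hinj (by omega) (by omega) h; omega
      · refine fun h => h.elim (fun h => ?_) (hpB l hl)
        have := hinj (by omega) (by omega) h; omega
  have hpe : s(u, v) ∉ p.edges := fun h => (p.adj_of_mem_edges h).2.2.2 rfl
  refine ⟨insert s(u, v) {e | e ∈ p.edges}, ⟨u, v, p.mapLe (avoid_le _ _ _), huv,
    (SimpleGraph.Walk.isPath_mapLe _).2 hp, ?_, ?_, ?_, ?_, ?_⟩, mem_insert _ _, ?_, ?_⟩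
  · rwa [SimpleGraph.Walk.edges_mapLe_eq_edges]
  · rw [SimpleGraph.Walk.edges_mapLe_eq_edges]
  · rw [SimpleGraph.Walk.support_mapLe_eq_support, hsupp]
    exact fun h => h hwB
  · rw [SimpleGraph.Walk.support_mapLe_eq_support]
    intro x hx y hy hxy
    by_cases he : s(x, y) = s(u, v)
    · exact Or.inl he
    refine Or.inr ?_
    obtain ⟨i, rfl, hi⟩ := SimpleGraph.Walk.mem_support_iff_exists_getVert.1 hx
    obtain ⟨j, rfl, hj⟩ := SimpleGraph.Walk.mem_support_iff_exists_getVert.1 hy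
    rcases lt_trichotomy i j with h | h | h
    · exact hind i j h hj hxy he
    · exact absurd (by rw [h]) hxy.ne
    · rw [Sym2.eq_swap] at he
      rw [mem_ofPred_eq, Sym2.eq_swap (a := p.getVert i)]
      exact hind j i h hi hxy.symm he
  · rw [SimpleGraph.Walk.support_mapLe_eq_support]
    intro x hx
    rw [hsupp, not_not] at hx
    exact (hBc x hx).lift id
      fun a b h => ⟨h.1, fun h' => (hsupp b).1 h' h.2⟩
  · rintro e (rfl | he) hwe
    · rcases Sym2.mem_iff.1 hwe with h | h
      · exact hwu h
      · exact hwv h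
    · have := p.mem_support_of_mem_edges he hwe
      rw [hsupp] at this
      exact this hwB
  · have hlen : 0 < p.length := by
      rw [Nat.pos_iff_ne_zero]
      exact fun h => huv.ne (SimpleGraph.Walk.eq_of_length_eq_zero h)
    have hmem : s(u, p.getVert 1) ∈ p.edges := by
      rw [SimpleGraph.Walk.mk_mem_edges_iff_exists]
      exact ⟨0, hlen, by simp⟩
    refine ⟨p.getVert 1, ?_, ?_, _, Or.inr hmem, Sym2.mem_mk_right _ _⟩
    · exact (p.adj_of_mem_edges hmem).1.ne'
    · exact fun h => (p.adj_of_mem_edges hmem).2.2.2 (by rw [h])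

/-- Every edge of a 3-connected graph lies on two peripheral cycles. -/
theorem exists_two_isPeripheral [Fintype V] (h3 : ThreeConnected G) {e : Sym2 V}
    (he : e ∈ G.edgeSet) :
    ∃ C₁ C₂ b₁ b₂, C₁ ≠ C₂ ∧ IsPeripheral G C₁ b₁ ∧ IsPeripheral G C₂ b₂ ∧ e ∈ C₁ ∧ e ∈ C₂ := by
  classical
  induction e with
  | h u v =>
    obtain ⟨w, hw⟩ : ∃ x, x ∉ ({u, v} : Finset V) := by
      by_contra! h
      have h1 : Finset.univ ⊆ ({u, v} : Finset V) := fun x _ => h x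
      have h2 := (Finset.card_le_card h1).trans Finset.card_le_two
      have h4 := h3.1
      rw [Finset.card_univ] at h2
      omega
    simp only [Finset.mem_insert, Finset.mem_singleton, not_or] at hw
    obtain ⟨C₁, h1, he1, -, x, hxu, hxv, f, hf, hxf⟩ := exists_isPeripheral h3 he hw.1 hw.2
    obtain ⟨C₂, h2, he2, hx, -⟩ := exists_isPeripheral h3 he hxu hxv
    exact ⟨C₁, C₂, w, x, fun h => hx f (h ▸ hf) hxf, h1, h2, he1, he2⟩

theorem exists_adj_of_threeConnected [Fintype V] (h3 : ThreeConnected G) (x : V) :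
    ∃ y, G.Adj x y := by
  have : Nontrivial V := Fintype.one_lt_card_iff_nontrivial.1 (by have := h3.1; omega)
  obtain ⟨y, hy⟩ := exists_ne x
  have h := reflTransGen_of_threeConnected h3 (s := ∅) (by simp) (x := x) (y := y)
    (by simp) (by simp)
  rcases Relation.ReflTransGen.cases_head h with h | ⟨c, hc, -⟩
  · exact absurd h.symm hy
  · exact ⟨c, hc.1⟩

end graph

end Whitney

namespace Whitney
open Set Filter Topology Metric

theorem Arc.isPreconnected_diff_right {X : Type*} [TopologicalSpace X] {A : Set X}
    {x y : X} (h : Arc A x y) : IsPreconnected (A \ {y}) :=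
  h.isPreconnected_diff.subset_closure
    (fun _ hz => ⟨hz.1, fun h => hz.2 (Or.inr h)⟩) fun _ hz => h.subset_closure_diff hz.1

theorem Arc.exists_map {X Y : Type*} [TopologicalSpace X] [T2Space X] [TopologicalSpace Y]
    {A : Set X} {B : Set Y} {x y : X} {x' y' : Y} (hA : Arc A x y) (hB : Arc B x' y') :
    ∃ g : X → Y, ContinuousOn g A ∧ BijOn g A B ∧ g x = x' ∧ g y = y' := by
  obtain ⟨f, hf, hfi, rfl, rfl, rfl⟩ := hA
  obtain ⟨k, hk, hki, rfl, rfl, rfl⟩ := hB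
  let g : X → Y := fun z => k (Function.invFunOn f (Icc 0 1) z)
  have hg : ∀ t ∈ Icc (0 : ℝ) 1, g (f t) = k t := fun t ht => by
    simp only [g]; rw [hfi.leftInvOn_invFunOn ht]
  refine ⟨g, ?_, ⟨?_, ?_, ?_⟩, hg 0 (by simp), hg 1 (by simp)⟩
  · exact continuousOn_image_of_comp isCompact_Icc hf (hk.congr hg)
  · rintro _ ⟨t, ht, rfl⟩
    exact ⟨t, ht, (hg t ht).symm⟩
  · rintro _ ⟨t, ht, rfl⟩ _ ⟨s, hs, rfl⟩ he
    rw [hg t ht, hg s hs] at he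
    rw [hki ht hs he]
  · rintro _ ⟨t, ht, rfl⟩
    exact ⟨f t, mem_image_of_mem f ht, hg t ht⟩

section drawing

variable {V : Type*} {G : SimpleGraph V} (D : SphereEmbedding G)

/-- The union of the arcs of a set of edges. -/
def curve (C : Set (Sym2 V)) : Set Sphere2 := ⋃ e ∈ C, D.arc e

variable {D}

theorem mem_curve {C : Set (Sym2 V)} {x : Sphere2} : x ∈ curve D C ↔ ∃ e ∈ C, x ∈ D.arc e := by
  simp [curve]

theorem curve_mono {C C' : Set (Sym2 V)} (h : C ⊆ C') : curve D C ⊆ curve D C' :=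
  biUnion_subset_biUnion_left h

theorem arc_of_adj {u v : V} (h : G.Adj u v) : Arc (D.arc s(u, v)) (D.pos u) (D.pos v) :=
  D.arc_isArc _ h u v rfl

theorem pos_mem_arc {e : Sym2 V} (he : e ∈ G.edgeSet) {v : V} (hv : v ∈ e) :
    D.pos v ∈ D.arc e := by
  obtain ⟨w, rfl⟩ := hv
  exact (arc_of_adj (D := D) he).left_mem

theorem isCompact_arc {e : Sym2 V} (he : e ∈ G.edgeSet) : IsCompact (D.arc e) := by
  induction e with
  | h u v => exact (arc_of_adj (D := D) he).isCompact

theorem exists_mem_of_mem_curve {C : Set (Sym2 V)} (hC : C ⊆ G.edgeSet) {f : Sym2 V}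
    (hf : f ∈ G.edgeSet) (hfC : f ∉ C) {x : Sphere2} (hx : x ∈ D.arc f) (hxC : x ∈ curve D C) :
    ∃ a ∈ f, (∃ e ∈ C, a ∈ e) ∧ x = D.pos a := by
  obtain ⟨e, he, hxe⟩ := mem_curve.1 hxC
  obtain ⟨a, haf, hae, rfl⟩ := D.arc_inter f hf e (hC he) (fun h => hfC (h ▸ he)) ⟨hx, hxe⟩
  exact ⟨a, haf, ⟨e, he, hae⟩, rfl⟩

theorem pos_mem_curve_iff {C : Set (Sym2 V)} (hC : C ⊆ G.edgeSet) {x : V} :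
    D.pos x ∈ curve D C ↔ ∃ e ∈ C, x ∈ e := by
  rw [mem_curve]
  exact ⟨fun ⟨e, he, h⟩ => ⟨e, he, D.arc_vertex e (hC he) x h⟩,
    fun ⟨e, he, h⟩ => ⟨e, he, pos_mem_arc (hC he) h⟩⟩

theorem arc_of_isPath {u v : V} (p : G.Walk u v) (hp : p.IsPath) (huv : u ≠ v) :
    Arc (curve D {e | e ∈ p.edges}) (D.pos u) (D.pos v) := by
  induction p with
  | nil => exact absurd rfl huv
  | @cons u w v h q ih =>
    rw [SimpleGraph.Walk.cons_isPath_iff] at hp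
    have hcons : curve D {e | e ∈ (SimpleGraph.Walk.cons h q).edges} =
        D.arc s(u, w) ∪ curve D {e | e ∈ q.edges} := by
      ext x
      simp [mem_curve]
    rw [hcons]
    by_cases hwv : w = v
    · subst hwv
      rw [(SimpleGraph.Walk.isPath_iff_nil.1 hp.1).eq_nil]
      simpa [curve] using arc_of_adj h
    · refine (arc_of_adj h).trans (ih hp.1 hwv) (Subset.antisymm ?_ ?_)
      · rintro x ⟨hx, hxq⟩
        have hu : ∀ e ∈ q.edges, u ∉ e := fun e he hue =>
          hp.2 (q.mem_support_of_mem_edges he hue)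
        obtain ⟨a, ha, ⟨e, he, hae⟩, rfl⟩ := exists_mem_of_mem_curve
          (fun e he => q.edges_subset_edgeSet he) h
          (fun h' => hu _ h' (Sym2.mem_mk_left _ _)) hx hxq
        rcases Sym2.mem_iff.1 ha with rfl | rfl
        · exact absurd hae (hu e he)
        · rfl
      · rintro _ rfl
        exact ⟨(arc_of_adj h).right_mem, (ih hp.1 hwv).left_mem⟩

section peripheral

variable {C : Set (Sym2 V)} {b : V}

theorem IsPeripheral.subset_edgeSet (h : IsPeripheral G C b) : C ⊆ G.edgeSet := by
  obtain ⟨u, v, p, huv, -, -, rfl, -⟩ := h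
  rintro e (rfl | he)
  · exact huv
  · exact p.edges_subset_edgeSet he

/-- The vertices of a peripheral cycle. -/
theorem IsPeripheral.vertices (h : IsPeripheral G C b) :
    (¬ ∃ e ∈ C, b ∈ e) ∧
    (∀ x y, (∃ e ∈ C, x ∈ e) → (∃ e ∈ C, y ∈ e) → G.Adj x y → s(x, y) ∈ C) ∧
    ∀ x, (¬ ∃ e ∈ C, x ∈ e) →
      Relation.ReflTransGen (fun y z => G.Adj y z ∧ ¬ ∃ e ∈ C, z ∈ e) b x := by
  obtain ⟨u, v, p, huv, hp, -, hC, hb, hind, hconn⟩ := h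
  have hsupp : ∀ x, (∃ e ∈ C, x ∈ e) ↔ x ∈ p.support := by
    intro x
    subst hC
    constructor
    · rintro ⟨e, rfl | he, hx⟩
      · rcases Sym2.mem_iff.1 hx with rfl | rfl
        · exact p.start_mem_support
        · exact p.end_mem_support
      · exact p.mem_support_of_mem_edges he hx
    · intro hx
      rcases SimpleGraph.Walk.mem_support_iff_exists_mem_edges.1 hx with rfl | ⟨e, he, hxe⟩
      · exact ⟨_, Or.inl rfl, Sym2.mem_mk_right _ _⟩
      · exact ⟨e, Or.inr he, hxe⟩
  simp only [hsupp]
  exact ⟨hb, fun x y hx hy => hind x hx y hy, hconn⟩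

theorem IsPeripheral.isJordan (h : IsPeripheral G C b) : IsJordan (curve D C) := by
  obtain ⟨u, v, p, huv, hp, he, rfl, -⟩ := h
  refine ⟨_, _, _, _, arc_of_adj (D := D) huv, arc_of_isPath (D := D) p hp huv.ne,
    Subset.antisymm ?_ ?_, ?_⟩
  · rintro x ⟨hx, hxp⟩
    obtain ⟨a, ha, -, rfl⟩ := exists_mem_of_mem_curve
      (fun e he => p.edges_subset_edgeSet he) huv he hx hxp
    rcases Sym2.mem_iff.1 ha with rfl | rfl
    · exact Or.inl rfl
    · exact Or.inr rfl
  · rintro _ (rfl | rfl)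
    · exact ⟨(arc_of_adj (D := D) huv).left_mem, (arc_of_isPath (D := D) p hp huv.ne).left_mem⟩
    · exact ⟨(arc_of_adj (D := D) huv).right_mem, (arc_of_isPath (D := D) p hp huv.ne).right_mem⟩
  · rw [curve, curve, biUnion_insert]

theorem IsPeripheral.pos_notMem (h : IsPeripheral G C b) : D.pos b ∉ curve D C := by
  rw [pos_mem_curve_iff h.subset_edgeSet]
  exact h.vertices.1

theorem IsPeripheral.isPreconnected_diff (h : IsPeripheral G C b) (hb : ∃ y, G.Adj b y) :
    IsPreconnected (curve D G.edgeSet \ curve D C) := by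
  have hCe := h.subset_edgeSet
  obtain ⟨hbC, hind, hconn⟩ := h.vertices
  have hsub : ∀ {x y : V}, G.Adj x y → (¬ ∃ e ∈ C, x ∈ e) →
      D.arc s(x, y) \ {D.pos y} ⊆ curve D G.edgeSet \ curve D C := by
    rintro x y hxy hx q ⟨hq, hqy⟩
    refine ⟨mem_curve.2 ⟨_, hxy, hq⟩, fun hqC => ?_⟩
    obtain ⟨a, ha, haC, rfl⟩ := exists_mem_of_mem_curve hCe hxy
      (fun h => hx ⟨_, h, Sym2.mem_mk_left _ _⟩) hq hqC
    rcases Sym2.mem_iff.1 ha with rfl | rfl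
    · exact hx haC
    · exact hqy rfl
  have hpos : ∀ {x y : V}, G.Adj x y → (¬ ∃ e ∈ C, x ∈ e) →
      D.pos x ∈ curve D G.edgeSet \ curve D C := fun hxy hx =>
    hsub hxy hx ⟨(arc_of_adj hxy).left_mem, fun h => hxy.ne (D.pos_inj h)⟩
  have hvert : ∀ x, (¬ ∃ e ∈ C, x ∈ e) → ∃ t ⊆ curve D G.edgeSet \ curve D C,
      D.pos b ∈ t ∧ D.pos x ∈ t ∧ IsPreconnected t := by
    intro x hx
    have hr := hconn x hx
    clear hx
    induction hr with
    | refl =>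
      obtain ⟨y, hy⟩ := hb
      exact ⟨{D.pos b}, singleton_subset_iff.2 (hpos hy hbC), rfl, rfl, isPreconnected_singleton⟩
    | @tail y z hby hyz ih =>
      obtain ⟨t, ht, hbt, hyt, htc⟩ := ih
      have hy : ¬ ∃ e ∈ C, y ∈ e := by
        rw [← pos_mem_curve_iff (D := D) hCe]
        exact (ht hyt).2
      have ha := arc_of_adj (D := D) hyz.1
      refine ⟨t ∪ D.arc s(y, z), union_subset ht fun q hq => ?_, Or.inl hbt, Or.inr ha.right_mem,
        htc.union _ hyt ha.left_mem ha.isPreconnected⟩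
      by_cases hqz : q = D.pos z
      · exact hqz ▸ hpos hyz.1.symm hyz.2
      · exact hsub hyz.1 hy ⟨hq, hqz⟩
  refine isPreconnected_of_forall (D.pos b) ?_
  have key : ∀ x y q, G.Adj x y → q ∈ D.arc s(x, y) → q ∉ curve D C → (¬ ∃ e ∈ C, x ∈ e) →
      ∃ t ⊆ curve D G.edgeSet \ curve D C, D.pos b ∈ t ∧ q ∈ t ∧ IsPreconnected t := by
    intro x y q hxy hq hqC hx
    by_cases hqy : q = D.pos y
    · subst hqy
      rw [pos_mem_curve_iff hCe] at hqC
      exact hvert y hqC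
    · obtain ⟨t, ht, hbt, hxt, htc⟩ := hvert x hx
      have ha := arc_of_adj (D := D) hxy
      refine ⟨t ∪ D.arc s(x, y) \ {D.pos y}, union_subset ht (hsub hxy hx), Or.inl hbt,
        Or.inr ⟨hq, hqy⟩, htc.union _ hxt ⟨ha.left_mem, ha.ne⟩ ha.isPreconnected_diff_right⟩
  rintro q ⟨hq, hqC⟩
  obtain ⟨f, hf, hqf⟩ := mem_curve.1 hq
  induction f with
  | h x y =>
    by_cases hx : ∃ e ∈ C, x ∈ e
    · have hy : ¬ ∃ e ∈ C, y ∈ e := fun hy => hqC (mem_curve.2 ⟨_, hind x y hx hy hf, hqf⟩)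
      rw [Sym2.eq_swap] at hqf
      exact key y x q (G.adj_symm hf) hqf hqC hy
    · exact key x y q hf hqf hqC hx

end peripheral

theorem eq_of_mem_arc {e f : Sym2 V} (he : e ∈ G.edgeSet) (hf : f ∈ G.edgeSet) {x : Sphere2}
    (hx : x ∉ range D.pos) (hxe : x ∈ D.arc e) (hxf : x ∈ D.arc f) : e = f := by
  by_contra h
  obtain ⟨a, -, -, ha⟩ := D.arc_inter e he f hf h ⟨hxe, hxf⟩
  exact hx ⟨a, ha⟩

theorem exists_mem_arc_notMem_range {e : Sym2 V} (he : e ∈ G.edgeSet) :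
    ∃ x ∈ D.arc e, x ∉ range D.pos := by
  induction e with
  | h u v =>
    obtain ⟨x, hx, hxe⟩ := (arc_of_adj (D := D) he).diff_nonempty
    refine ⟨x, hx, ?_⟩
    rintro ⟨a, rfl⟩
    rcases Sym2.mem_iff.1 (D.arc_vertex _ he a hx) with rfl | rfl
    · exact hxe (Or.inl rfl)
    · exact hxe (Or.inr rfl)

theorem subset_of_curve_subset {C C' : Set (Sym2 V)} (hC : C ⊆ G.edgeSet) (hC' : C' ⊆ G.edgeSet)
    (h : curve D C ⊆ curve D C') : C ⊆ C' := by
  intro e he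
  obtain ⟨x, hx, hxV⟩ := exists_mem_arc_notMem_range (D := D) (hC he)
  obtain ⟨f, hf, hxf⟩ := mem_curve.1 (h (mem_curve.2 ⟨e, he, hx⟩))
  rwa [eq_of_mem_arc (hC he) (hC' hf) hxV hx hxf]

variable (G) in
/-- The peripheral cycles of `G`. -/
abbrev PeripheralCycle : Type _ := {C : Set (Sym2 V) // ∃ b, IsPeripheral G C b}

/-- A vertex off a given peripheral cycle. -/
def PeripheralCycle.base (i : PeripheralCycle G) : V := i.2.choose

theorem PeripheralCycle.isPeripheral (i : PeripheralCycle G) : IsPeripheral G i.1 i.base :=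
  i.2.choose_spec

variable (D) in
/-- The face of the drawing bounded by a peripheral cycle. -/
def faceOf (i : PeripheralCycle G) : Set Sphere2 := face (D.pos i.base) (curve D i.1)

section faces

variable (i : PeripheralCycle G)

theorem isJordan_curve : IsJordan (curve D i.1) := i.isPeripheral.isJordan

theorem base_notMem : D.pos i.base ∉ curve D i.1 := i.isPeripheral.pos_notMem

theorem frontier_faceOf : frontier (faceOf D i) = curve D i.1 :=
  frontier_face (isJordan_curve i) (base_notMem i)

theorem closure_faceOf : closure (faceOf D i) = faceOf D i ∪ curve D i.1 :=
  closure_face (isJordan_curve i) (base_notMem i)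

theorem curve_subset : curve D i.1 ⊆ curve D G.edgeSet :=
  curve_mono i.isPeripheral.subset_edgeSet

theorem disjoint_faceOf_curve (hG : ∀ x, ∃ y, G.Adj x y) :
    Disjoint (faceOf D i) (curve D G.edgeSet) := by
  have h1 : Disjoint (faceOf D i) (curve D i.1) := disjoint_face (base_notMem i)
  obtain ⟨y, hy⟩ := hG i.base
  have h2 : Disjoint (curve D G.edgeSet \ curve D i.1) (faceOf D i) :=
    disjoint_face_of_isPreconnected (isJordan_curve i) (base_notMem i)
      (i.isPeripheral.isPreconnected_diff ⟨y, hy⟩) disjoint_sdiff_left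
      ⟨mem_curve.2 ⟨_, hy, (arc_of_adj hy).left_mem⟩, base_notMem i⟩
  rw [disjoint_left]
  intro x hx hxG
  by_cases hxi : x ∈ curve D i.1
  · exact disjoint_left.1 h1 hx hxi
  · exact disjoint_left.1 h2 ⟨hxG, hxi⟩ hx

theorem subset_of_mem_faceOf {P : Set Sphere2} (hP : IsPreconnected P)
    (hPC : Disjoint P (curve D i.1)) {z : Sphere2} (hzP : z ∈ P) (hz : z ∈ faceOf D i) :
    P ⊆ faceOf D i := by
  refine subset_of_frontier_inter hP hzP hz ?_
  rw [frontier_faceOf]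
  exact hPC.inter_eq

variable {i} in
theorem disjoint_faceOf (hG : ∀ x, ∃ y, G.Adj x y) {j : PeripheralCycle G} (hij : i ≠ j) :
    Disjoint (faceOf D i) (faceOf D j) := by
  rw [disjoint_left]
  intro x hxi hxj
  have hsub : ∀ k l : PeripheralCycle G, x ∈ faceOf D k → x ∈ faceOf D l →
      faceOf D k ⊆ faceOf D l := fun k l hk hl =>
    subset_of_mem_faceOf l (isPreconnected_face (isJordan_curve k) (base_notMem k))
      ((disjoint_faceOf_curve k hG).mono_right (curve_subset l)) hk hl
  have heq : curve D i.1 = curve D j.1 := by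
    rw [← frontier_faceOf, ← frontier_faceOf, (hsub i j hxi hxj).antisymm (hsub j i hxj hxi)]
  exact hij (Subtype.ext ((subset_of_curve_subset i.isPeripheral.subset_edgeSet
    j.isPeripheral.subset_edgeSet heq.le).antisymm (subset_of_curve_subset
    j.isPeripheral.subset_edgeSet i.isPeripheral.subset_edgeSet heq.ge)))

end faces

theorem iUnion_faceOf [Fintype V] (h3 : ThreeConnected G) :
    ⋃ i : PeripheralCycle G, (faceOf D i ∪ curve D i.1) = univ := by
  have hG := exists_adj_of_threeConnected h3
  set Z := ⋃ i : PeripheralCycle G, (faceOf D i ∪ curve D i.1) with hZ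
  have hZi : ∀ i : PeripheralCycle G, faceOf D i ∪ curve D i.1 ⊆ Z :=
    subset_iUnion fun i : PeripheralCycle G => faceOf D i ∪ curve D i.1
  have hclosed : IsClosed Z := isClosed_iUnion_of_finite fun i => by
    rw [← closure_faceOf]; exact isClosed_closure
  have hcurve : curve D G.edgeSet ⊆ Z := by
    intro x hx
    obtain ⟨e, he, hxe⟩ := mem_curve.1 hx
    obtain ⟨C, -, b, -, -, hC, -, heC, -⟩ := exists_two_isPeripheral h3 he
    exact hZi ⟨C, b, hC⟩ (Or.inr (mem_curve.2 ⟨e, heC, hxe⟩))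
  have hpos : range D.pos ⊆ curve D G.edgeSet := by
    rintro _ ⟨x, rfl⟩
    obtain ⟨y, hy⟩ := hG x
    exact mem_curve.2 ⟨_, hy, (arc_of_adj hy).left_mem⟩
  have hnhds : ∀ x ∈ Z, x ∉ range D.pos → Z ∈ 𝓝 x := by
    intro x hx hxV
    obtain ⟨i, hi | hi⟩ := mem_iUnion.1 hx
    · exact mem_of_superset ((isOpen_face (isJordan_curve i) (base_notMem i)).mem_nhds hi)
        (subset_union_left.trans (hZi i))
    obtain ⟨e, he, hxe⟩ := mem_curve.1 (curve_subset i hi)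
    obtain ⟨C₁, C₂, b₁, b₂, hne, hC₁, hC₂, he₁, he₂⟩ := exists_two_isPeripheral h3 he
    let j : PeripheralCycle G := ⟨C₁, b₁, hC₁⟩
    let k : PeripheralCycle G := ⟨C₂, b₂, hC₂⟩
    have hjk : j ≠ k := fun h => hne (congrArg Subtype.val h)
    have hxj : x ∈ curve D j.1 := mem_curve.2 ⟨e, he₁, hxe⟩
    have hxk : x ∈ closure (faceOf D k) := by
      rw [closure_faceOf]
      exact Or.inr (mem_curve.2 ⟨e, he₂, hxe⟩)
    have hN : (curve D (G.edgeSet \ {e}))ᶜ ∈ 𝓝 x := by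
      refine IsOpen.mem_nhds (isOpen_compl_iff.2 ?_) fun h => ?_
      · exact (toFinite _).isClosed_biUnion fun f hf => (isCompact_arc hf.1).isClosed
      · obtain ⟨f, hf, hxf⟩ := mem_curve.1 h
        exact hf.2 (eq_of_mem_arc hf.1 he hxV hxf hxe)
    obtain ⟨M, hM, hMp⟩ := exists_isPreconnected_near (isJordan_curve j) (base_notMem j) hxj hN
    obtain ⟨z, hzM, hzk⟩ := mem_closure_iff_nhds.1 hxk M hM
    have hzj : z ∉ faceOf D j ∪ curve D j.1 := fun h => h.elim
      (fun h => disjoint_left.1 (disjoint_faceOf hG hjk) h hzk)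
      (fun h => disjoint_left.1 (disjoint_faceOf_curve k hG) hzk (curve_subset j h))
    refine mem_of_superset hM fun w hw => ?_
    by_cases hwj : w ∈ faceOf D j ∪ curve D j.1
    · exact hZi j hwj
    obtain ⟨P, hP, hPc, hzP, hwP⟩ := hMp z hzM w hw hzj hwj
    refine hZi k (Or.inl (subset_of_mem_faceOf k hPc (disjoint_left.2 fun y hy hyk => ?_) hzP hzk
      hwP))
    obtain ⟨f, hf, hyf⟩ := mem_curve.1 (curve_subset k hyk)
    by_cases hfe : f = e
    · exact (hP hy).2 (mem_curve.2 ⟨e, he₁, hfe ▸ hyf⟩)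
    · exact (hP hy).1 (mem_curve.2 ⟨f, ⟨hf, hfe⟩, hyf⟩)
  have hne : Nonempty V := Fintype.card_pos_iff.1 (by have := h3.1; omega)
  obtain ⟨v⟩ := hne
  obtain ⟨y, hy⟩ := hG v
  obtain ⟨C, -, b, -, -, hC, -⟩ := exists_two_isPeripheral h3 (e := s(v, y)) hy
  let i : PeripheralCycle G := ⟨C, b, hC⟩
  obtain ⟨a, ha⟩ : (faceOf D i).Nonempty := face_nonempty (isJordan_curve i) (base_notMem i)
  have hsub : (range D.pos)ᶜ ⊆ Z := by
    refine subset_of_frontier_inter (isPreconnected_compl_of_finite (finite_range _) ⟨v, rfl⟩)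
      (a := a) (fun h => disjoint_left.1 (disjoint_faceOf_curve i hG) ha (hpos h))
      (hZi i (Or.inl ha)) (eq_empty_iff_forall_notMem.2 ?_)
    rintro x ⟨hxV, hx⟩
    rw [hclosed.frontier_eq] at hx
    exact hx.2 (mem_interior_iff_mem_nhds.2 (hnhds x hx.1 hxV))
  refine eq_univ_of_forall fun x => ?_
  by_cases hx : x ∈ range D.pos
  · exact hcurve (hpos hx)
  · exact hsub hx

theorem exists_skeleton_map [Finite V] (D₁ D₂ : SphereEmbedding G) :
    ∃ h : Sphere2 → Sphere2, ContinuousOn h (curve D₁ G.edgeSet) ∧ InjOn h (curve D₁ G.edgeSet) ∧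
      (∀ e ∈ G.edgeSet, h '' D₁.arc e = D₂.arc e) ∧
      ∀ e ∈ G.edgeSet, ∀ v ∈ e, h (D₁.pos v) = D₂.pos v := by
  classical
  have hex : ∀ e : Sym2 V, ∃ g : Sphere2 → Sphere2, e ∈ G.edgeSet →
      ContinuousOn g (D₁.arc e) ∧ BijOn g (D₁.arc e) (D₂.arc e) ∧
      ∀ v ∈ e, g (D₁.pos v) = D₂.pos v := by
    intro e
    by_cases he : e ∈ G.edgeSet
    · induction e with
      | h u v =>
        obtain ⟨g, hg, hb, hu, hv⟩ := (arc_of_adj (D := D₁) he).exists_map (arc_of_adj (D := D₂) he)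
        refine ⟨g, fun _ => ⟨hg, hb, fun w hw => ?_⟩⟩
        rcases Sym2.mem_iff.1 hw with rfl | rfl
        · exact hu
        · exact hv
    · exact ⟨id, fun h => absurd h he⟩
  choose g hg using hex
  let h : Sphere2 → Sphere2 := fun x =>
    if hx : ∃ e ∈ G.edgeSet, x ∈ D₁.arc e then g hx.choose x else x
  have hh : ∀ e ∈ G.edgeSet, EqOn h (g e) (D₁.arc e) := by
    intro e he x hx
    have hex : ∃ e ∈ G.edgeSet, x ∈ D₁.arc e := ⟨e, he, hx⟩
    simp only [h]
    rw [dif_pos hex]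
    obtain ⟨h1, h2⟩ := hex.choose_spec
    by_cases hee : hex.choose = e
    · rw [hee]
    · obtain ⟨a, ha, hae, rfl⟩ := D₁.arc_inter _ h1 e he hee ⟨h2, hx⟩
      rw [(hg _ h1).2.2 a ha, (hg e he).2.2 a hae]
  refine ⟨h, ?_, ?_, fun e he => ?_, fun e he v hv => ?_⟩
  · rw [curve, biUnion_eq_iUnion]
    exact (locallyFinite_of_finite _).continuousOn_iUnion
      (fun e => (isCompact_arc e.2).isClosed) fun e => (hg e.1 e.2).1.congr (hh e.1 e.2)
  · intro x hx y hy hxy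
    obtain ⟨e, he, hxe⟩ := mem_curve.1 hx
    obtain ⟨f, hf, hyf⟩ := mem_curve.1 hy
    rw [hh e he hxe, hh f hf hyf] at hxy
    by_cases hef : e = f
    · subst hef
      exact (hg e he).2.1.injOn hxe hyf hxy
    · obtain ⟨a, hae, haf, ha⟩ := D₂.arc_inter e he f hf hef
        ⟨(hg e he).2.1.mapsTo hxe, hxy ▸ (hg f hf).2.1.mapsTo hyf⟩
      have h1 : x = D₁.pos a := (hg e he).2.1.injOn hxe (pos_mem_arc he hae)
        (by rw [(hg e he).2.2 a hae, ha])
      have h2 : y = D₁.pos a := (hg f hf).2.1.injOn hyf (pos_mem_arc hf haf)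
        (by rw [(hg f hf).2.2 a haf, ha, hxy])
      rw [h1, h2]
  · rw [(hh e he).image_eq, (hg e he).2.1.image_eq]
  · rw [hh e he (pos_mem_arc he hv), (hg e he).2.2 v hv]

theorem equivEmb_of_threeConnected [Fintype V] (h3 : ThreeConnected G)
    (D₁ D₂ : SphereEmbedding G) : D₁.EquivEmb D₂ := by
  classical
  have hG := exists_adj_of_threeConnected h3
  obtain ⟨h, hc, hi, harc, hpos⟩ := exists_skeleton_map D₁ D₂
  have hcurve : ∀ C ⊆ G.edgeSet, h '' curve D₁ C = curve D₂ C := by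
    intro C hC
    rw [curve, curve, image_iUnion₂]
    exact iUnion₂_congr fun e he => harc e (hC he)
  have hex : ∀ i : PeripheralCycle G, ∃ Φ : Sphere2 → Sphere2,
      ContinuousOn Φ (faceOf D₁ i ∪ curve D₁ i.1) ∧
      BijOn Φ (faceOf D₁ i) (faceOf D₂ i) ∧ EqOn Φ h (curve D₁ i.1) := by
    intro i
    have hsub := curve_subset (D := D₁) i
    have him := hcurve i.1 i.isPeripheral.subset_edgeSet
    have := exists_extension_face (isJordan_curve i) (base_notMem i) (hc.mono hsub) (hi.mono hsub)
      (m := D₂.pos i.base) (by rw [him]; exact base_notMem i)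
    rwa [him] at this
  choose Ψ hΨc hΨb hΨe using hex
  let Φ : Sphere2 → Sphere2 := fun x => if x ∈ curve D₁ G.edgeSet then h x else
    if hx : ∃ i, x ∈ faceOf D₁ i then Ψ hx.choose x else x
  have hΦh : ∀ x ∈ curve D₁ G.edgeSet, Φ x = h x := fun x hx => if_pos hx
  have hΦf : ∀ i, ∀ x ∈ faceOf D₁ i, Φ x = Ψ i x := by
    intro i x hx
    have hex : ∃ i, x ∈ faceOf D₁ i := ⟨i, hx⟩
    simp only [Φ]
    rw [if_neg (disjoint_left.1 (disjoint_faceOf_curve i hG) hx), dif_pos hex]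
    have : hex.choose = i := by
      by_contra hne
      exact disjoint_left.1 (disjoint_faceOf hG hne) hex.choose_spec hx
    rw [this]
  have hcov : ∀ (D : SphereEmbedding G) (x : Sphere2),
      x ∈ curve D G.edgeSet ∨ ∃ i, x ∈ faceOf D i := by
    intro D x
    have hx : x ∈ ⋃ i : PeripheralCycle G, (faceOf D i ∪ curve D i.1) := by
      rw [iUnion_faceOf h3]; trivial
    obtain ⟨i, hi | hi⟩ := mem_iUnion.1 hx
    · exact Or.inr ⟨i, hi⟩
    · exact Or.inl (curve_subset i hi)
  have hΦc : Continuous Φ := by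
    refine (locallyFinite_of_finite _).continuous (iUnion_faceOf (D := D₁) h3) (fun i => ?_)
      fun i => (hΨc i).congr ?_
    · rw [← closure_faceOf]; exact isClosed_closure
    · rintro x (hx | hx)
      · exact hΦf i x hx
      · rw [hΦh x (curve_subset i hx), hΨe i hx]
  have hmh : ∀ x ∈ curve D₁ G.edgeSet, Φ x ∈ curve D₂ G.edgeSet := fun x hx => by
    rw [hΦh x hx, ← hcurve _ subset_rfl]
    exact mem_image_of_mem h hx
  have hmf : ∀ i, ∀ x ∈ faceOf D₁ i, Φ x ∈ faceOf D₂ i := fun i x hx => by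
    rw [hΦf i x hx]
    exact (hΨb i).mapsTo hx
  have hbij : Function.Bijective Φ := by
    constructor
    · intro x y hxy
      rcases hcov D₁ x with hx | ⟨i, hx⟩ <;> rcases hcov D₁ y with hy | ⟨j, hy⟩
      · rw [hΦh x hx, hΦh y hy] at hxy
        exact hi hx hy hxy
      · exact absurd (hxy ▸ hmh x hx) (disjoint_left.1 (disjoint_faceOf_curve j hG) (hmf j y hy))
      · exact absurd (hxy ▸ hmh y hy) (disjoint_left.1 (disjoint_faceOf_curve i hG) (hmf i x hx))
      · have hij : i = j := by
          by_contra hne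
          exact disjoint_left.1 (disjoint_faceOf hG hne) (hmf i x hx) (hxy ▸ hmf j y hy)
        subst hij
        rw [hΦf i x hx, hΦf i y hy] at hxy
        exact (hΨb i).injOn hx hy hxy
    · intro y
      rcases hcov D₂ y with hy | ⟨i, hy⟩
      · rw [← hcurve _ subset_rfl] at hy
        obtain ⟨x, hx, rfl⟩ := hy
        exact ⟨x, hΦh x hx⟩
      · obtain ⟨x, hx, rfl⟩ := (hΨb i).surjOn hy
        exact ⟨x, hΦf i x hx⟩
  refine ⟨Continuous.homeoOfEquivCompactToT2 (f := Equiv.ofBijective Φ hbij) hΦc,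
    SimpleGraph.Iso.refl, fun v => ?_, fun e he => ?_⟩
  · obtain ⟨y, hy⟩ := hG v
    have hv : v ∈ s(v, y) := Sym2.mem_mk_left _ _
    change Φ (D₁.pos v) = D₂.pos v
    rw [hΦh _ (mem_curve.2 ⟨_, hy, pos_mem_arc hy hv⟩)]
    exact hpos _ hy v hv
  · have h1 : e.map (SimpleGraph.Iso.refl : G ≃g G) = e := by
      induction e with
      | h u v => rfl
    rw [h1, ← harc e he]
    exact image_congr fun x hx => hΦh x (mem_curve.2 ⟨e, he, hx⟩)

end drawing

end Whitney

/-- Whitney's theorem: every 3-connected planar graph has a unique embedding in the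
sphere up to homeomorphism, i.e. any two plane drawings of it are equivalent. -/
theorem stmt7 {V : Type*} [Fintype V] (G : SimpleGraph V)
    (hpl : G.IsPlanar) (h3 : ThreeConnected G)
    (D₁ D₂ : SphereEmbedding G) :
    D₁.EquivEmb D₂ := by
  exact Whitney.equivEmb_of_threeConnected h3 D₁ D₂


end
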